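/- Assume that the sequence (MSE_n)_{n≥1} with matched SNR λ' = λ converges uniformly in λ on compact subsets of ℝ₊. If σ' ≤ σ, then for all λ > 0, lim_{n→∞} MSE_n(σ,σ',λ,λ) = σ⁴ when λ ≤ 1/(σ²σ'²), and lim_{n→∞} MSE_n(σ,σ',λ,λ) = 2/λ − (1/(λ²σ'²))·(2/σ² − 1/σ'²) when λ ≥ 1/(σ²σ'²). -/

import Mathlib

open MeasureTheory ProbabilityTheory Filter Matrix

noncomputable section

instance {n : ℕ} : MeasurableSpace (Matrix (Fin n) (Fin n) ℝ) :=
  inferInstanceAs (MeasurableSpace (Fin n → Fin n → ℝ))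

/-- Squared Frobenius norm of a matrix. -/
def frobSq {n : ℕ} (M : Matrix (Fin n) (Fin n) ℝ) : ℝ := ∑ i, ∑ j, (M i j) ^ 2

/-- i.i.d. centered Gaussian prior with variance `v` on `ℝⁿ`. -/
def gaussPrior (n : ℕ) (v : ℝ) : Measure (Fin n → ℝ) :=
  Measure.pi fun _ => gaussianReal 0 (Real.toNNReal v)

/-- Law of the symmetric noise matrix `Z`: independent `N(0,1)` entries above the
diagonal and `N(0,2)` entries on the diagonal, extended symmetrically. -/
def noiseMeasure (n : ℕ) : Measure (Matrix (Fin n) (Fin n) ℝ) :=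
  (Measure.pi fun p : Fin n × Fin n =>
      gaussianReal 0 (if p.1 = p.2 then 2 else 1)).map
    (fun g => Matrix.of fun i j => if i ≤ j then g (i, j) else g (j, i))

/-- Observation matrix `Y = √(λ/n) s sᵀ + Z`. -/
def obs (n : ℕ) (lam : ℝ) (s : Fin n → ℝ) (Z : Matrix (Fin n) (Fin n) ℝ) :
    Matrix (Fin n) (Fin n) ℝ :=
  Real.sqrt (lam / n) • Matrix.vecMulVec s s + Z

/-- Posterior weight `exp(−¼‖Y−√(λ'/n) x xᵀ‖_F²)`. -/
def weight (n : ℕ) (lam' : ℝ) (Y : Matrix (Fin n) (Fin n) ℝ) (x : Fin n → ℝ) : ℝ :=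
  Real.exp (-(1 / 4) * frobSq (Y - Real.sqrt (lam' / n) • Matrix.vecMulVec x x))

/-- Gibbs (mismatched posterior) average `⟨f(x)⟩_{λ',σ'}` of an observable `f`. -/
def gibbs (n : ℕ) (sig' lam' : ℝ) (Y : Matrix (Fin n) (Fin n) ℝ)
    (f : (Fin n → ℝ) → ℝ) : ℝ :=
  (∫ x, f x * weight n lam' Y x ∂gaussPrior n (sig' ^ 2)) /
    (∫ x, weight n lam' Y x ∂gaussPrior n (sig' ^ 2))

/-- Posterior mean matrix `⟨x xᵀ⟩_{λ',σ'}`. -/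
def gibbsMatrix (n : ℕ) (sig' lam' : ℝ) (Y : Matrix (Fin n) (Fin n) ℝ) :
    Matrix (Fin n) (Fin n) ℝ :=
  Matrix.of fun i j => gibbs n sig' lam' Y (fun x => x i * x j)

/-- Mismatched matrix-MSE `MSE_n(σ,σ',λ,λ')`. -/
def MSE (n : ℕ) (sig sig' lam lam' : ℝ) : ℝ :=
  (1 / (n : ℝ) ^ 2) *
    ∫ p, frobSq (Matrix.vecMulVec p.1 p.1 -
        gibbsMatrix n sig' lam' (obs n lam p.1 p.2))
      ∂((gaussPrior n (sig ^ 2)).prod (noiseMeasure n))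

noncomputable section

/-! ### Section A: Gaussian product measures -/

theorem lintegral_pi_prod {κ : Type*} [Fintype κ] (μ : κ → Measure ℝ)
    [∀ k, IsProbabilityMeasure (μ k)] (f : κ → ℝ → ENNReal) (hf : ∀ k, Measurable (f k)) :
    ∫⁻ x, ∏ k, f k (x k) ∂(Measure.pi μ) = ∏ k, ∫⁻ t, f k t ∂(μ k) := by
  have h := lintegral_prod_eq_prod_lintegral_of_indepFun (μ := Measure.pi μ) Finset.univ
    (fun k (x : κ → ℝ) => f k (x k)) (iIndepFun_pi (fun k => (hf k).aemeasurable))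
    (fun k => (hf k).comp (measurable_pi_apply k))
  rw [h]
  refine Finset.prod_congr rfl fun k _ => ?_
  exact (measurePreserving_eval μ k).lintegral_comp (hf k)

theorem pi_withDensity_eq {κ : Type*} [Fintype κ] (μ : κ → Measure ℝ)
    [∀ k, IsProbabilityMeasure (μ k)] (f : κ → ℝ → ENNReal) (hf : ∀ k, Measurable (f k))
    [∀ k, SigmaFinite ((μ k).withDensity (f k))] :
    Measure.pi (fun k => (μ k).withDensity (f k)) =
      (Measure.pi μ).withDensity (fun x => ∏ k, f k (x k)) := by
  refine Measure.pi_eq fun s hs => ?_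
  rw [withDensity_apply _ (MeasurableSet.univ_pi hs), ← lintegral_indicator (MeasurableSet.univ_pi hs)]
  have : ∀ x : κ → ℝ, (Set.univ.pi s).indicator (fun x => ∏ k, f k (x k)) x =
      ∏ k, (s k).indicator (f k) (x k) := by
    intro x
    by_cases hx : x ∈ Set.univ.pi s
    · rw [Set.indicator_of_mem hx]
      refine Finset.prod_congr rfl fun k _ => ?_
      rw [Set.indicator_of_mem (hx k (Set.mem_univ k))]
    · rw [Set.indicator_of_notMem hx]
      simp only [Set.mem_pi, Set.mem_univ, true_imp_iff, not_forall] at hx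
      obtain ⟨k, hk⟩ := hx
      exact (Finset.prod_eq_zero (Finset.mem_univ k) (Set.indicator_of_notMem hk _)).symm
  simp_rw [this]
  rw [lintegral_pi_prod μ _ (fun k => (hf k).indicator (hs k))]
  refine Finset.prod_congr rfl fun k _ => ?_
  rw [withDensity_apply _ (hs k), lintegral_indicator (hs k)]

/-- standard Gaussian measure -/
def GG (κ : Type*) [Fintype κ] : Measure (κ → ℝ) := Measure.pi fun _ => gaussianReal 0 1

instance {κ : Type*} [Fintype κ] : IsProbabilityMeasure (GG κ) := by
  unfold GG; infer_instance

instance {n : ℕ} {v : ℝ} : IsProbabilityMeasure (gaussPrior n v) := by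
  unfold gaussPrior; infer_instance

theorem gaussianReal_shift (a : ℝ) :
    gaussianReal a 1 = (gaussianReal 0 1).withDensity
      (fun x => ENNReal.ofReal (Real.exp (a * x - a ^ 2 / 2))) := by
  rw [gaussianReal_of_var_ne_zero _ one_ne_zero, gaussianReal_of_var_ne_zero _ one_ne_zero,
    ← withDensity_mul _ (measurable_gaussianPDF 0 1) (by fun_prop)]
  congr 1
  ext x
  simp only [Pi.mul_apply, gaussianPDF, gaussianPDFReal]
  rw [← ENNReal.ofReal_mul (by positivity), mul_assoc _ (Real.exp _), ← Real.exp_add]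
  congr 3
  push_cast
  ring

theorem GG_shift {κ : Type*} [Fintype κ] (a : κ → ℝ) :
    (GG κ).map (fun g => g + a) = (GG κ).withDensity
      (fun g => ENNReal.ofReal (Real.exp (∑ k, (a k * g k - a k ^ 2 / 2)))) := by
  have h1 : ∀ k, (gaussianReal 0 1).map (fun t => t + a k) = (gaussianReal 0 1).withDensity
      (fun x => ENNReal.ofReal (Real.exp (a k * x - a k ^ 2 / 2))) := by
    intro k
    rw [gaussianReal_map_add_const, zero_add, gaussianReal_shift]
  have h2 := Measure.pi_map_pi (μ := fun _ : κ => gaussianReal 0 1)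
    (f := fun k t => t + a k)
    (hμ := fun k => by rw [gaussianReal_map_add_const]; infer_instance) (fun k => by fun_prop)
  have : ∀ k : κ, SigmaFinite ((gaussianReal 0 1).withDensity
      (fun x => ENNReal.ofReal (Real.exp (a k * x - a k ^ 2 / 2)))) := by
    intro k; rw [← gaussianReal_shift]; infer_instance
  unfold GG
  change Measure.map (fun (x : κ → ℝ) i => x i + a i) _ = _
  rw [h2]
  simp_rw [h1]
  rw [pi_withDensity_eq _ _ (fun k => by fun_prop)]
  congr 1
  ext g
  rw [Real.exp_sum, ENNReal.ofReal_prod_of_nonneg (fun _ _ => (Real.exp_pos _).le)]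

theorem volume_eq_gaussianReal (v : NNReal) (hv : v ≠ 0) :
    (volume : Measure ℝ) = (gaussianReal 0 v).withDensity
      (fun x => ENNReal.ofReal (√(2 * Real.pi * v) * Real.exp (x ^ 2 / (2 * v)))) := by
  rw [gaussianReal_of_var_ne_zero _ hv, ← withDensity_mul _ (measurable_gaussianPDF 0 v) (by fun_prop)]
  have : (gaussianPDF 0 v * fun x => ENNReal.ofReal (√(2 * Real.pi * v) *
      Real.exp (x ^ 2 / (2 * v)))) = 1 := by
    ext x
    simp only [Pi.mul_apply, gaussianPDF, gaussianPDFReal, Pi.one_apply]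
    rw [← ENNReal.ofReal_mul (by positivity)]
    have : (√(2 * Real.pi * v))⁻¹ * Real.exp (-(x - 0) ^ 2 / (2 * v)) *
        (√(2 * Real.pi * v) * Real.exp (x ^ 2 / (2 * v))) = 1 := by
      have h0 : √(2 * Real.pi * v) ≠ 0 := by
        have : (0:ℝ) < v := by positivity
        positivity
      have h1 : Real.exp (-(x - 0) ^ 2 / (2 * v)) * Real.exp (x ^ 2 / (2 * v)) = 1 := by
        rw [← Real.exp_add, ← Real.exp_zero]; congr 1; ring
      calc _ = (√(2 * Real.pi * v))⁻¹ * √(2 * Real.pi * v) * (Real.exp (-(x - 0) ^ 2 / (2 * v)) * Real.exp (x ^ 2 / (2 * v))) := by ring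
        _ = 1 := by rw [h1, inv_mul_cancel₀ h0]; ring
    rw [this, ENNReal.ofReal_one]
  rw [this, withDensity_one]

theorem volume_eq_prior (n : ℕ) (v : ℝ) (hv : 0 < v) :
    (volume : Measure (Fin n → ℝ)) = (gaussPrior n v).withDensity (fun x => ENNReal.ofReal
      ((2 * Real.pi * v) ^ ((n : ℝ) / 2) * Real.exp ((∑ i, x i ^ 2) / (2 * v)))) := by
  have hv' : Real.toNNReal v ≠ 0 := by simpa using hv
  have hvc : ((Real.toNNReal v : NNReal) : ℝ) = v := Real.coe_toNNReal _ hv.le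
  have h1 := volume_eq_gaussianReal _ hv'
  rw [hvc] at h1
  have : ∀ k : Fin n, SigmaFinite ((gaussianReal 0 (Real.toNNReal v)).withDensity
      (fun x => ENNReal.ofReal (√(2 * Real.pi * v) * Real.exp (x ^ 2 / (2 * v))))) := by
    intro k; rw [← h1]; infer_instance
  have h2 := pi_withDensity_eq (fun _ : Fin n => gaussianReal 0 (Real.toNNReal v))
    (fun _ x => ENNReal.ofReal (√(2 * Real.pi * v) * Real.exp (x ^ 2 / (2 * v))))
    (fun k => by fun_prop)
  rw [← h1, ← volume_pi] at h2
  rw [h2]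
  change (gaussPrior n v).withDensity _ = _
  congr 1
  ext x
  rw [← ENNReal.ofReal_prod_of_nonneg (fun _ _ => by positivity)]
  rw [Finset.prod_mul_distrib, ← Real.exp_sum, Finset.prod_const, Finset.card_univ, Fintype.card_fin,
    Finset.sum_div]
  have : √(2 * Real.pi * v) ^ n = (2 * Real.pi * v) ^ ((n : ℝ) / 2) := by
    rw [Real.sqrt_eq_rpow, ← Real.rpow_natCast, ← Real.rpow_mul (by positivity)]
    congr 1; ring
  rw [this]

/-- integration against the prior in Lebesgue form -/
theorem integral_volume_eq_prior (n : ℕ) (v : ℝ) (hv : 0 < v) (f : (Fin n → ℝ) → ℝ) :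
    ∫ x, f x = (2 * Real.pi * v) ^ ((n : ℝ) / 2) *
      ∫ x, f x * Real.exp ((∑ i, x i ^ 2) / (2 * v)) ∂gaussPrior n v := by
  rw [volume_eq_prior n v hv, integral_withDensity_eq_integral_toReal_smul
    (by fun_prop) (ae_of_all _ fun x => ENNReal.ofReal_lt_top), ← integral_const_mul]
  congr 1
  ext x
  rw [ENNReal.toReal_ofReal (by positivity), smul_eq_mul]
  ring

theorem integrable_volume_iff_prior (n : ℕ) (v : ℝ) (hv : 0 < v) (f : (Fin n → ℝ) → ℝ) :
    Integrable f ↔ Integrable (fun x => f x * Real.exp ((∑ i, x i ^ 2) / (2 * v)))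
      (gaussPrior n v) := by
  rw [volume_eq_prior n v hv, integrable_withDensity_iff_integrable_smul'
    (by fun_prop) (ae_of_all _ fun x => ENNReal.ofReal_lt_top)]
  have h0 : (2 * Real.pi * v) ^ ((n : ℝ) / 2) ≠ 0 := by positivity
  rw [← integrable_const_mul_iff (c := (2 * Real.pi * v) ^ ((n : ℝ) / 2)) h0.isUnit
    (fun x => f x * Real.exp ((∑ i, x i ^ 2) / (2 * v)))]
  refine iff_of_eq ?_
  congr 1
  ext x
  rw [ENNReal.toReal_ofReal (by positivity), smul_eq_mul]
  ring

theorem gaussian_1d (a b : ℝ) (ha : 0 < a) :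
    Integrable (fun t : ℝ => Real.exp (-a * t ^ 2 / 2 + b * t)) ∧
    ∫ t : ℝ, Real.exp (-a * t ^ 2 / 2 + b * t) =
      √(2 * Real.pi / a) * Real.exp (b ^ 2 / (2 * a)) := by
  have h : ∀ t : ℝ, Real.exp (-a * t ^ 2 / 2 + b * t) =
      Real.exp (b ^ 2 / (2 * a)) * Real.exp (-(a / 2) * (t - b / a) ^ 2) := by
    intro t
    rw [← Real.exp_add]; congr 1; field_simp; ring
  simp_rw [h]
  have hi : Integrable (fun t : ℝ => Real.exp (-(a / 2) * t ^ 2)) :=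
    integrable_exp_neg_mul_sq (by positivity)
  refine ⟨(hi.comp_sub_right (b / a)).const_mul _, ?_⟩
  rw [integral_const_mul, integral_sub_right_eq_self (fun t : ℝ => Real.exp (-(a / 2) * t ^ 2)),
    integral_gaussian, mul_comm]
  congr 2
  field_simp

theorem gaussian_nd (n : ℕ) (a : ℝ) (b : Fin n → ℝ) (ha : 0 < a) :
    Integrable (fun x : Fin n → ℝ => Real.exp (-a * (∑ i, x i ^ 2) / 2 + ∑ i, b i * x i)) ∧
    ∫ x : Fin n → ℝ, Real.exp (-a * (∑ i, x i ^ 2) / 2 + ∑ i, b i * x i) =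
      (2 * Real.pi / a) ^ ((n : ℝ) / 2) * Real.exp ((∑ i, b i ^ 2) / (2 * a)) := by
  have h : ∀ x : Fin n → ℝ, Real.exp (-a * (∑ i, x i ^ 2) / 2 + ∑ i, b i * x i) =
      ∏ i, Real.exp (-a * (x i) ^ 2 / 2 + b i * x i) := by
    intro x
    rw [← Real.exp_sum, Finset.sum_add_distrib, Finset.mul_sum, Finset.sum_div]
  simp_rw [h]
  refine ⟨Integrable.fintype_prod (f := fun i t => Real.exp (-a * t ^ 2 / 2 + b i * t))
    (fun i => (gaussian_1d a (b i) ha).1), ?_⟩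
  rw [integral_fintype_prod_volume_eq_prod (fun i t => Real.exp (-a * t ^ 2 / 2 + b i * t))]
  simp_rw [fun i => (gaussian_1d a (b i) ha).2]
  rw [Finset.prod_mul_distrib, ← Real.exp_sum, Finset.prod_const, Finset.card_univ, Fintype.card_fin,
    Finset.sum_div]
  have : √(2 * Real.pi / a) ^ n = (2 * Real.pi / a) ^ ((n : ℝ) / 2) := by
    rw [Real.sqrt_eq_rpow, ← Real.rpow_natCast, ← Real.rpow_mul (by positivity)]
    congr 1; ring
  rw [this]

theorem GG_update {κ : Type*} [Fintype κ] [DecidableEq κ] (k : κ) :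
    MeasurePreserving (fun p : (κ → ℝ) × ℝ => Function.update p.1 k p.2)
      ((GG κ).prod (gaussianReal 0 1)) (GG κ) := by
  have hm : Measurable (fun p : (κ → ℝ) × ℝ => Function.update p.1 k p.2) := by
    refine measurable_pi_lambda _ fun j => ?_
    by_cases h : j = k
    · subst h; simpa using measurable_snd
    · simp only [Function.update_of_ne h]; fun_prop
  refine ⟨hm, ?_⟩
  symm
  unfold GG
  refine Measure.pi_eq fun s hs => ?_
  rw [Measure.map_apply hm (MeasurableSet.univ_pi hs)]
  have : (fun p : (κ → ℝ) × ℝ => Function.update p.1 k p.2) ⁻¹' (Set.univ.pi s) =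
      (Set.univ.pi (Function.update s k Set.univ)) ×ˢ (s k) := by
    ext ⟨x, t⟩
    simp only [Set.mem_preimage, Set.mem_pi, Set.mem_univ, true_imp_iff, Set.mem_prod]
    constructor
    · intro h
      refine ⟨fun i => ?_, by simpa using h k⟩
      by_cases hi : i = k
      · subst hi; simp
      · simpa [Function.update_of_ne hi] using h i
    · rintro ⟨h1, h2⟩ i
      by_cases hi : i = k
      · subst hi; simpa using h2
      · simpa [Function.update_of_ne hi] using h1 i
  rw [this, Measure.prod_prod, Measure.pi_pi, ← Finset.mul_prod_erase _ _ (Finset.mem_univ k),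
    ← Finset.mul_prod_erase _ (fun i => gaussianReal 0 1 (s i)) (Finset.mem_univ k)]
  simp only [Function.update_self, measure_univ, one_mul]
  rw [mul_comm]
  congr 1
  refine Finset.prod_congr rfl fun i hi => ?_
  rw [Function.update_of_ne (Finset.ne_of_mem_erase hi)]

theorem stein_1d (f f' : ℝ → ℝ) (hd : ∀ t, HasDerivAt f (f' t) t)
    (hf : Integrable f (gaussianReal 0 1))
    (hf' : Integrable (fun t => f' t - t * f t) (gaussianReal 0 1)) :
    ∫ t, (f' t - t * f t) ∂gaussianReal 0 1 = 0 := by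
  have hpd : ∀ t, HasDerivAt (gaussianPDFReal 0 1) (-t * gaussianPDFReal 0 1 t) t := by
    intro t
    unfold gaussianPDFReal
    have h1 : HasDerivAt (fun x : ℝ => -(x - 0) ^ 2 / (2 * ((1 : NNReal) : ℝ))) (-t) t := by
      have := (((hasDerivAt_id t).sub_const 0).pow 2).neg.div_const (2 * ((1 : NNReal) : ℝ))
      refine this.congr_deriv ?_
      simp; ring
    refine (h1.exp.const_mul _).congr_deriv ?_
    ring
  have hIntg : ∀ h : ℝ → ℝ, Integrable h (gaussianReal 0 1) →
      Integrable (fun t => gaussianPDFReal 0 1 t * h t) := by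
    intro h hh
    rw [gaussianReal_of_var_ne_zero _ one_ne_zero, integrable_withDensity_iff_integrable_smul'
      (measurable_gaussianPDF 0 1) (ae_of_all _ fun x => gaussianPDF_lt_top)] at hh
    simpa [toReal_gaussianPDF] using hh
  rw [integral_gaussianReal_eq_integral_smul one_ne_zero]
  simp only [smul_eq_mul]
  refine integral_eq_zero_of_hasDerivAt_of_integrable (f := fun t => gaussianPDFReal 0 1 t * f t)
    ?_ (hIntg _ hf') (hIntg _ hf)
  intro t
  refine ((hpd t).mul (hd t)).congr_deriv ?_
  ring

/-- Gaussian integration by parts -/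
theorem GG_stein {κ : Type*} [Fintype κ] [DecidableEq κ] (k : κ) (h h' : (κ → ℝ) → ℝ)
    (hd : ∀ g, HasDerivAt (fun t => h (Function.update g k t)) (h' g) (g k))
    (hi : Integrable h (GG κ)) (hi1 : Integrable (fun g => g k * h g) (GG κ))
    (hi' : Integrable h' (GG κ)) :
    ∫ g, g k * h g ∂(GG κ) = ∫ g, h' g ∂(GG κ) := by
  have hmp := GG_update k
  have hI : Integrable (fun g => h' g - g k * h g) (GG κ) := hi'.sub hi1
  suffices hs : ∫ g, (h' g - g k * h g) ∂(GG κ) = 0 by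
    rw [integral_sub hi' hi1] at hs; linarith
  have hI2 := hmp.integrable_comp_of_integrable hI
  have hI3 := hmp.integrable_comp_of_integrable hi
  rw [← hmp.map_eq, integral_map hmp.measurable.aemeasurable (by rw [hmp.map_eq]; exact hI.1)]
  simp only [Function.comp_def] at hI2 hI3
  rw [integral_prod _ hI2]
  refine integral_eq_zero_of_ae ?_
  filter_upwards [hI2.prod_right_ae, hI3.prod_right_ae] with g hg1 hg2
  simp only [Function.update_self, Pi.zero_apply] at hg1 ⊢
  refine stein_1d _ _ (fun t => ?_) hg2 hg1
  have := hd (Function.update g k t)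
  simpa using this

theorem GG_eval {κ : Type*} [Fintype κ] (k : κ) :
    MeasurePreserving (fun g : κ → ℝ => g k) (GG κ) (gaussianReal 0 1) :=
  measurePreserving_eval _ k

theorem GG_memLp {κ : Type*} [Fintype κ] (k : κ) (p : ENNReal) (hp : p ≠ ⊤) :
    MemLp (fun g : κ → ℝ => g k) p (GG κ) :=
  (memLp_id_gaussianReal' p hp).comp_measurePreserving (GG_eval k)

theorem GG_sq {κ : Type*} [Fintype κ] (k l : κ) :
    Integrable (fun g : κ → ℝ => g k * g l) (GG κ) :=
  (GG_memLp k 2 (by simp)).integrable_mul (GG_memLp l 2 (by simp))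

theorem GG_cov {κ : Type*} [Fintype κ] [DecidableEq κ] (k l : κ) :
    ∫ g, g k * g l ∂(GG κ) = if k = l then 1 else 0 := by
  rw [GG_stein k (fun g => g l) (fun _ => if k = l then 1 else 0)]
  · simp
  · intro g
    by_cases hkl : k = l
    · subst hkl; simpa using hasDerivAt_id' (g k)
    · simp only [Function.update_of_ne (Ne.symm hkl), hkl, if_false]; exact hasDerivAt_const _ _
  · exact (GG_memLp l 1 (by simp)).integrable le_rfl
  · exact GG_sq k l
  · exact integrable_const _

theorem GG_mean {κ : Type*} [Fintype κ] (k : κ) : ∫ g, g k ∂(GG κ) = 0 := by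
  have h2 := integral_map (μ := GG κ) (φ := fun g : κ → ℝ => g k) (f := fun t : ℝ => t)
    (measurable_pi_apply k).aemeasurable (by fun_prop)
  rw [← h2, (GG_eval k).map_eq, integral_id_gaussianReal]

end

set_option linter.all false
set_option linter.deprecated false
noncomputable section

/-! ### Section B: Gaussian channels -/

def En {κ X : Type*} [Fintype κ] (v : X → κ → ℝ) (c y : κ → ℝ) (x : X) : ℝ :=
  (1 / 2) * ∑ k, (y k - c k * v x k) ^ 2

def Zp {κ X : Type*} [Fintype κ] [MeasurableSpace X] (ν : Measure X) (v : X → κ → ℝ)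
    (c y : κ → ℝ) : ℝ := ∫ x, Real.exp (-En v c y x) ∂ν

def post {κ X : Type*} [Fintype κ] [MeasurableSpace X] (ν : Measure X) (v : X → κ → ℝ)
    (c y : κ → ℝ) : Measure X := ν.tilted (fun x => -En v c y x)

theorem lin2 {Ω : Type*} [MeasurableSpace Ω] {μ : Measure Ω} [IsProbabilityMeasure μ] {f g : Ω → ℝ}
    (hf : Integrable f μ) (hg : Integrable g μ) (a b d : ℝ) :
    Integrable (fun x => a * f x + b * g x + d) μ ∧
    ∫ x, (a * f x + b * g x + d) ∂μ = a * ∫ x, f x ∂μ + b * ∫ x, g x ∂μ + d := by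
  have h1 := hf.const_mul a
  have h2 := hg.const_mul b
  have h12 : Integrable (fun x => a * f x + b * g x) μ := h1.add h2
  refine ⟨h12.add (integrable_const _), ?_⟩
  rw [integral_add h12 (integrable_const _), integral_add h1 h2, integral_const_mul,
    integral_const_mul]
  simp

theorem lin3 {Ω : Type*} [MeasurableSpace Ω] {μ : Measure Ω} [IsProbabilityMeasure μ]
    {f g h : Ω → ℝ} (hf : Integrable f μ) (hg : Integrable g μ) (hh : Integrable h μ) (a b c d : ℝ) :
    Integrable (fun x => a * f x + b * g x + c * h x + d) μ ∧
    ∫ x, (a * f x + b * g x + c * h x + d) ∂μ =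
      a * ∫ x, f x ∂μ + b * ∫ x, g x ∂μ + c * ∫ x, h x ∂μ + d := by
  have h1 := (lin2 hf hg a b 0).1
  have h2 := lin2 h1 hh 1 c d
  have h3 := (lin2 hf hg a b 0).2
  simp only [one_mul, add_zero] at h2 h3
  rw [h3] at h2
  exact h2

/-- second-moment assumption -/
structure L2 {κ X : Type*} [Fintype κ] [MeasurableSpace X] (ν : Measure X) (v : X → κ → ℝ) :
    Prop where
  meas : Measurable v
  sq : ∀ k, Integrable (fun x => v x k ^ 2) ν

section basic
variable {κ X : Type*} [Fintype κ] [MeasurableSpace X] {ν : Measure X} [IsProbabilityMeasure ν]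
  {v : X → κ → ℝ}

theorem L2.meask (hv : L2 ν v) (k : κ) : Measurable (fun x => v x k) :=
  (measurable_pi_apply k).comp hv.meas

theorem L2.memLp (hv : L2 ν v) (k : κ) : MemLp (fun x => v x k) 2 ν :=
  (memLp_two_iff_integrable_sq (hv.meask k).aestronglyMeasurable).2 (hv.sq k)

theorem L2.int (hv : L2 ν v) (k : κ) : Integrable (fun x => v x k) ν :=
  (hv.memLp k).integrable (by norm_num)

theorem En_nonneg (v : X → κ → ℝ) (c y : κ → ℝ) (x : X) : 0 ≤ En v c y x := by
  unfold En; positivity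

theorem En_meas (hv : Measurable v) (c y : κ → ℝ) : Measurable (En v c y) := by
  unfold En
  have : ∀ k, Measurable (fun x => v x k) := fun k => (measurable_pi_apply k).comp hv
  fun_prop

theorem expEn_le (v : X → κ → ℝ) (c y : κ → ℝ) (x : X) : Real.exp (-En v c y x) ≤ 1 := by
  rw [Real.exp_le_one_iff]; linarith [En_nonneg v c y x]

theorem expEn_int (hv : Measurable v) (c y : κ → ℝ) :
    Integrable (fun x => Real.exp (-En v c y x)) ν := by
  refine Integrable.of_bound (C := 1) ?_ (ae_of_all _ fun x => ?_)
  · exact ((En_meas hv c y).neg.exp).aestronglyMeasurable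
  · rw [Real.norm_eq_abs, abs_of_pos (Real.exp_pos _)]; exact expEn_le v c y x

theorem mul_expEn_int (hv : Measurable v) (c y : κ → ℝ) {f : X → ℝ} (hf : Integrable f ν) :
    Integrable (fun x => f x * Real.exp (-En v c y x)) ν := by
  refine hf.mul_bdd (c := 1) ((En_meas hv c y).neg.exp).aestronglyMeasurable
    (ae_of_all _ fun x => ?_)
  rw [Real.norm_eq_abs, abs_of_pos (Real.exp_pos _)]; exact expEn_le v c y x

theorem Zp_pos (hv : Measurable v) (c y : κ → ℝ) : 0 < Zp ν v c y :=
  integral_exp_pos (expEn_int hv c y)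

theorem Zp_le_one (hv : Measurable v) (c y : κ → ℝ) : Zp ν v c y ≤ 1 := by
  calc Zp ν v c y ≤ ∫ _, (1 : ℝ) ∂ν :=
        integral_mono (expEn_int hv c y) (integrable_const _) (fun x => expEn_le v c y x)
    _ = 1 := by simp

theorem post_prob (hv : Measurable v) (c y : κ → ℝ) : IsProbabilityMeasure (post ν v c y) :=
  isProbabilityMeasure_tilted (expEn_int hv c y)

theorem post_integral (c y : κ → ℝ) (f : X → ℝ) :
    ∫ x, f x ∂(post ν v c y) = (∫ x, f x * Real.exp (-En v c y x) ∂ν) / Zp ν v c y := by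
  unfold post
  rw [integral_tilted, ← integral_div]
  congr 1
  ext x
  simp only [smul_eq_mul, Zp]
  ring

theorem post_int (hv : Measurable v) (c y : κ → ℝ) {f : X → ℝ} (hf : Integrable f ν) :
    Integrable f (post ν v c y) := by
  unfold post
  rw [integrable_tilted_iff]
  · have := (mul_expEn_int hv c y hf)
    simpa [mul_comm, smul_eq_mul] using this
  · exact expEn_int hv c y

theorem En_int (hv : L2 ν v) (c y : κ → ℝ) : Integrable (En v c y) ν := by
  unfold En
  refine Integrable.const_mul (integrable_finsetSum _ fun k _ => ?_) _
  have : ∀ x, (y k - c k * v x k) ^ 2 = y k ^ 2 - 2 * y k * c k * v x k + c k ^ 2 * v x k ^ 2 := by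
    intro x; ring
  simp_rw [this]
  exact ((integrable_const _).sub ((hv.int k).const_mul _)).add ((hv.sq k).const_mul _)

theorem En_le (v : X → κ → ℝ) (c y : κ → ℝ) (x : X) :
    En v c y x ≤ ∑ k, (y k ^ 2 + c k ^ 2 * v x k ^ 2) := by
  unfold En
  rw [Finset.mul_sum]
  refine Finset.sum_le_sum fun k _ => ?_
  nlinarith [sq_nonneg (y k + c k * v x k)]

/-- the quadratic bound -/
def BD (ν : Measure X) (v : X → κ → ℝ) (c y : κ → ℝ) : ℝ :=
  ∑ k, (y k ^ 2 + c k ^ 2 * ∫ x, v x k ^ 2 ∂ν)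

theorem BD_nonneg (c y : κ → ℝ) : 0 ≤ BD ν v c y := by
  unfold BD
  refine Finset.sum_nonneg fun k _ => add_nonneg (sq_nonneg _) (mul_nonneg (sq_nonneg _) ?_)
  exact integral_nonneg fun x => sq_nonneg _

theorem integral_En_le (hv : L2 ν v) (c y : κ → ℝ) : ∫ x, En v c y x ∂ν ≤ BD ν v c y := by
  have h2 : ∀ k ∈ Finset.univ, Integrable (fun x => y k ^ 2 + c k ^ 2 * v x k ^ 2) ν :=
    fun k _ => (integrable_const _).add ((hv.sq k).const_mul _)
  have h1 : Integrable (fun x => ∑ k, (y k ^ 2 + c k ^ 2 * v x k ^ 2)) ν :=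
    integrable_finsetSum _ h2
  refine (integral_mono (En_int hv c y) h1 (fun x => En_le v c y x)).trans ?_
  rw [integral_finsetSum _ h2]
  unfold BD
  refine le_of_eq (Finset.sum_congr rfl fun k _ => ?_)
  rw [integral_add (integrable_const _) ((hv.sq k).const_mul _), integral_const_mul]
  simp

theorem neg_log_Zp_le (hv : L2 ν v) (c y : κ → ℝ) : -Real.log (Zp ν v c y) ≤ BD ν v c y := by
  refine le_trans ?_ (integral_En_le hv c y)
  set m := ∫ x, En v c y x ∂ν with hm
  have h : Real.exp (-m) ≤ Zp ν v c y := by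
    have hl := lin2 (En_int hv c y) (En_int hv c y) (-1) 0 (1 + m)
    have h1 : ∫ x, Real.exp (-m) * (-1 * En v c y x + 0 * En v c y x + (1 + m)) ∂ν ≤
        Zp ν v c y := by
      refine integral_mono (hl.1.const_mul _) (expEn_int hv.meas c y) fun x => ?_
      dsimp only
      have : Real.exp (-En v c y x) = Real.exp (-m) * Real.exp (-En v c y x + m) := by
        rw [← Real.exp_add]; congr 1; ring
      rw [this]
      gcongr
      linarith [Real.add_one_le_exp (-En v c y x + m)]
    rw [integral_const_mul, hl.2, ← hm] at h1
    simpa using h1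
  have := Real.log_le_log (Real.exp_pos _) h
  rw [Real.log_exp] at this
  linarith

theorem post_En_le (hv : L2 ν v) (c y : κ → ℝ) :
    ∫ x, En v c y x ∂(post ν v c y) ≤ BD ν v c y := by
  refine le_trans ?_ (neg_log_Zp_le hv c y)
  set m := ∫ x, En v c y x ∂(post ν v c y) with hm
  have hZ := Zp_pos (ν := ν) hv.meas c y
  have hm' : ∫ x, En v c y x * Real.exp (-En v c y x) ∂ν = m * Zp ν v c y := by
    rw [hm, post_integral, div_mul_cancel₀ _ hZ.ne']
  have i1 := mul_expEn_int (ν := ν) hv.meas c y (En_int hv c y)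
  have i2 := expEn_int (ν := ν) hv.meas c y
  have h1 : ∫ x, Real.exp m * (En v c y x * Real.exp (-En v c y x) +
      (1 - m) * Real.exp (-En v c y x)) ∂ν ≤ ∫ _, (1:ℝ) ∂ν := by
    refine integral_mono ((i1.add (i2.const_mul _)).const_mul _) (integrable_const _) fun x => ?_
    dsimp only
    have h2 := Real.add_one_le_exp (En v c y x - m)
    have h3 : Real.exp m * Real.exp (-En v c y x) * Real.exp (En v c y x - m) = 1 := by
      rw [← Real.exp_add, ← Real.exp_add, ← Real.exp_zero]; congr 1; ring
    have h4 : 0 < Real.exp m * Real.exp (-En v c y x) := by positivity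
    nlinarith [mul_le_mul_of_nonneg_left h2 h4.le]
  rw [integral_const_mul, integral_add i1 (i2.const_mul _), integral_const_mul, hm'] at h1
  have h5 : Real.exp m * Zp ν v c y ≤ 1 := by
    simp only [integral_const, probReal_univ, smul_eq_mul, mul_one] at h1
    unfold Zp at h1 ⊢
    nlinarith
  have := Real.log_le_log (by positivity) h5
  rw [Real.log_mul (Real.exp_ne_zero _) hZ.ne', Real.log_exp, Real.log_one] at this
  linarith

theorem post_sq_le (hv : L2 ν v) (c y : κ → ℝ) (k : κ) :
    c k ^ 2 * ∫ x, v x k ^ 2 ∂(post ν v c y) ≤ 2 * y k ^ 2 + 4 * BD ν v c y := by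
  have := post_prob (ν := ν) hv.meas c y
  have h := post_En_le hv c y
  have hi := post_int hv.meas c y (En_int hv c y)
  have h1 : ∫ x, c k ^ 2 * v x k ^ 2 ∂(post ν v c y) ≤
      ∫ x, (2 * y k ^ 2 + 4 * En v c y x) ∂(post ν v c y) := by
    refine integral_mono ((post_int hv.meas c y (hv.sq k)).const_mul _)
      ((integrable_const _).add (hi.const_mul _)) fun x => ?_
    dsimp only
    have h2 : (y k - c k * v x k) ^ 2 ≤ 2 * En v c y x := by
      unfold En
      have := Finset.single_le_sum (f := fun k => (y k - c k * v x k) ^ 2)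
        (fun i _ => sq_nonneg _) (Finset.mem_univ k)
      linarith
    nlinarith [sq_nonneg (2 * y k - c k * v x k)]
  rw [integral_const_mul, integral_add (integrable_const _) (hi.const_mul _),
    integral_const_mul] at h1
  simp only [integral_const, probReal_univ, smul_eq_mul, one_mul, integral_const_mul] at h1
  linarith

theorem post_mean_sq_le (hv : L2 ν v) (c y : κ → ℝ) {f : X → ℝ} (hf : Integrable f ν)
    (hf2 : Integrable (fun x => f x ^ 2) ν) :
    (∫ x, f x ∂(post ν v c y)) ^ 2 ≤ ∫ x, f x ^ 2 ∂(post ν v c y) := by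
  have := post_prob (ν := ν) hv.meas c y
  have i1 := post_int hv.meas c y hf
  have i2 := post_int hv.meas c y hf2
  set m := ∫ x, f x ∂(post ν v c y) with hm
  have h : 0 ≤ ∫ x, (f x - m) ^ 2 ∂(post ν v c y) := integral_nonneg fun x => sq_nonneg _
  have : ∀ x, (f x - m) ^ 2 = 1 * f x ^ 2 + (-2 * m) * f x + m ^ 2 := by intro x; ring
  simp_rw [this] at h
  rw [(lin2 i2 i1 _ _ _).2, ← hm] at h
  nlinarith

theorem num_meas (hv : Measurable v) (c : κ → ℝ) {f : X → ℝ} (hf : Measurable f) :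
    Measurable (fun y : κ → ℝ => ∫ x, f x * Real.exp (-En v c y x) ∂ν) := by
  have h : StronglyMeasurable (fun p : (κ → ℝ) × X => f p.2 * Real.exp (-En v c p.1 p.2)) := by
    refine Measurable.stronglyMeasurable ?_
    unfold En
    have : ∀ k, Measurable (fun x => v x k) := fun k => (measurable_pi_apply k).comp hv
    fun_prop
  exact h.integral_prod_right.measurable

theorem Zp_meas (hv : Measurable v) (c : κ → ℝ) : Measurable (fun y => Zp ν v c y) := by
  have := num_meas (ν := ν) hv c (f := fun _ => 1) measurable_const
  simpa [Zp] using this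

theorem av_meas (hv : Measurable v) (c : κ → ℝ) {f : X → ℝ} (hf : Measurable f) :
    Measurable (fun y => ∫ x, f x ∂(post ν v c y)) := by
  simp_rw [post_integral]
  exact (num_meas hv c hf).div (Zp_meas hv c)

end basic
end

set_option linter.all false
set_option linter.deprecated false
noncomputable section

/-! ### Derivative of the averaged log-partition function -/

section deriv
variable {κ X S : Type*} [Fintype κ] [MeasurableSpace X] {ν : Measure X} [IsProbabilityMeasure ν]
  {v : X → κ → ℝ} [MeasurableSpace S] {μ : Measure S} [IsProbabilityMeasure μ] {w : S → κ → ℝ}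

/-- observation -/
def Yv (c w g : κ → ℝ) : κ → ℝ := fun k => g k + c k * w k

structure CPath (c c' : ℝ → κ → ℝ) (t0 ε M : ℝ) : Prop where
  eps : 0 < ε
  M0 : 0 ≤ M
  der : ∀ t ∈ Metric.ball t0 ε, ∀ k, HasDerivAt (fun t => c t k) (c' t k) t
  nn : ∀ t ∈ Metric.ball t0 ε, ∀ k, 0 ≤ c t k
  le : ∀ t ∈ Metric.ball t0 ε, ∀ k, c t k ≤ M
  dle : ∀ t ∈ Metric.ball t0 ε, ∀ k, |c' t k| ≤ M * c t k

def dE (v : X → κ → ℝ) (c c' w g : κ → ℝ) (x : X) : ℝ :=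
  ∑ k, (Yv c w g k - c k * v x k) * (c' k * (w k - v x k))

theorem En_hasDeriv {c c' : ℝ → κ → ℝ} {t : ℝ} (hc : ∀ k, HasDerivAt (fun t => c t k) (c' t k) t)
    (w g : κ → ℝ) (x : X) :
    HasDerivAt (fun t => En v (c t) (Yv (c t) w g) x) (dE v (c t) (c' t) w g x) t := by
  unfold En dE
  have h : ∀ k ∈ Finset.univ, HasDerivAt (fun t => (Yv (c t) w g k - c t k * v x k) ^ 2)
      (2 * ((Yv (c t) w g k - c t k * v x k) * (c' t k * (w k - v x k)))) t := by
    intro k _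
    have h1 : HasDerivAt (fun t => Yv (c t) w g k - c t k * v x k)
        (c' t k * w k - c' t k * v x k) t := by
      unfold Yv
      exact (((hc k).mul_const _).const_add _).sub ((hc k).mul_const _)
    refine (h1.pow 2).congr_deriv ?_
    push_cast; ring
  refine ((HasDerivAt.fun_sum h).const_mul (1 / 2)).congr_deriv ?_
  rw [← Finset.mul_sum]; ring

theorem dE_meas (hv : Measurable v) (c c' w g : κ → ℝ) : Measurable (dE v c c' w g) := by
  unfold dE
  have : ∀ k, Measurable (fun x => v x k) := fun k => (measurable_pi_apply k).comp hv
  fun_prop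

theorem dE_bound1 {c c' : κ → ℝ} {M : ℝ} (M0 : 0 ≤ M) (hc0 : ∀ k, 0 ≤ c k) (hc : ∀ k, c k ≤ M)
    (hc' : ∀ k, |c' k| ≤ M * c k) (w g : κ → ℝ) (x : X) :
    |dE v c c' w g x| ≤ M * (4 * En v c (Yv c w g) x + ∑ k, g k ^ 2) := by
  unfold dE En
  refine (Finset.abs_sum_le_sum_abs _ _).trans ?_
  rw [← mul_assoc, Finset.mul_sum, ← Finset.sum_add_distrib, Finset.mul_sum]
  refine Finset.sum_le_sum fun k _ => ?_
  set r := Yv c w g k - c k * v x k with hr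
  have e1 : c k * (w k - v x k) = r - g k := by rw [hr, Yv]; ring
  rw [abs_mul, abs_mul]
  have e2 : |c' k| * |w k - v x k| ≤ M * |r - g k| := by
    rw [← e1, abs_mul, abs_of_nonneg (hc0 k), ← mul_assoc]
    gcongr; exact hc' k
  calc |r| * (|c' k| * |w k - v x k|) ≤ |r| * (M * |r - g k|) := by gcongr
    _ = M * (|r| * |r - g k|) := by ring
    _ ≤ M * (4 * (1 / 2) * r ^ 2 + g k ^ 2) := by
        gcongr
        have h1 := abs_sub r (g k)
        have h2 := sq_abs r
        have h3 := sq_abs (g k)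
        nlinarith [abs_nonneg r, abs_nonneg (g k), sq_nonneg (|r| - |g k|)]

theorem dE_bound2 {c c' : κ → ℝ} {M : ℝ} (M0 : 0 ≤ M) (hc0 : ∀ k, 0 ≤ c k) (hc : ∀ k, c k ≤ M)
    (hc' : ∀ k, |c' k| ≤ M * c k) (w g : κ → ℝ) (x : X) :
    |dE v c c' w g x| ≤ ∑ k, M ^ 2 * (g k ^ 2 + (1 + M) * (2 * w k ^ 2 + 2 * v x k ^ 2)) := by
  unfold dE
  refine (Finset.abs_sum_le_sum_abs _ _).trans ?_
  refine Finset.sum_le_sum fun k _ => ?_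
  have e1 : Yv c w g k - c k * v x k = g k + c k * (w k - v x k) := by rw [Yv]; ring
  rw [e1, abs_mul, abs_mul]
  set d := w k - v x k
  have hd : d ^ 2 ≤ 2 * w k ^ 2 + 2 * v x k ^ 2 := by
    simp only [d]; nlinarith [sq_nonneg (w k + v x k)]
  have e2 : |c' k| ≤ M ^ 2 := by
    refine (hc' k).trans ?_; nlinarith [hc k]
  have e3 : |g k + c k * d| ≤ |g k| + M * |d| := by
    refine (abs_add_le _ _).trans ?_
    rw [abs_mul, abs_of_nonneg (hc0 k)]
    gcongr; exact hc k
  calc |g k + c k * d| * (|c' k| * |d|) ≤ (|g k| + M * |d|) * (M ^ 2 * |d|) := by gcongr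
    _ = M ^ 2 * (|g k| * |d| + M * |d| ^ 2) := by ring
    _ ≤ M ^ 2 * (g k ^ 2 + (1 + M) * d ^ 2) := by
        refine mul_le_mul_of_nonneg_left ?_ (sq_nonneg M)
        have h2 := sq_abs d
        have h3 := sq_abs (g k)
        rw [h2]
        nlinarith [abs_nonneg d, abs_nonneg (g k), sq_nonneg (|d| - |g k|)]
    _ ≤ _ := by gcongr

theorem Zp_hasDeriv (hv : L2 ν v) {c c' : ℝ → κ → ℝ} {t0 ε M : ℝ} (hp : CPath c c' t0 ε M)
    (w g : κ → ℝ) (t : ℝ) (ht : t ∈ Metric.ball t0 ε) :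
    Integrable (dE v (c t) (c' t) w g) ν ∧
    HasDerivAt (fun t => Real.log (Zp ν v (c t) (Yv (c t) w g)))
      (-∫ x, dE v (c t) (c' t) w g x ∂(post ν v (c t) (Yv (c t) w g))) t := by
  have hbi : Integrable (fun x => ∑ k, M ^ 2 * (g k ^ 2 + (1 + M) * (2 * w k ^ 2 + 2 * v x k ^ 2))) ν := by
    refine integrable_finsetSum _ fun k _ => ?_
    exact ((integrable_const _).add (((integrable_const _).add
      ((hv.sq k).const_mul _)).const_mul _)).const_mul _
  have hdi : Integrable (dE v (c t) (c' t) w g) ν := by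
    refine hbi.mono' (dE_meas hv.meas _ _ _ _).aestronglyMeasurable (ae_of_all _ fun x => ?_)
    exact dE_bound2 hp.M0 (hp.nn t ht) (hp.le t ht) (hp.dle t ht) w g x
  refine ⟨hdi, ?_⟩
  have h := (hasDerivAt_integral_of_dominated_loc_of_deriv_le (μ := ν)
    (F := fun t x => Real.exp (-En v (c t) (Yv (c t) w g) x))
    (F' := fun t x => Real.exp (-En v (c t) (Yv (c t) w g) x) * (-dE v (c t) (c' t) w g x))
    (s := Metric.ball t0 ε) (x₀ := t) (Metric.isOpen_ball.mem_nhds ht)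
    (Eventually.of_forall fun t => (expEn_int hv.meas _ _).1)
    (expEn_int hv.meas _ _)
    (((En_meas hv.meas _ _).neg.exp.mul (dE_meas hv.meas _ _ _ _).neg).aestronglyMeasurable)
    (bound := fun x => ∑ k, M ^ 2 * (g k ^ 2 + (1 + M) * (2 * w k ^ 2 + 2 * v x k ^ 2)))
    (ae_of_all _ fun x u hu => by
      rw [Real.norm_eq_abs, abs_mul, abs_neg, abs_of_pos (Real.exp_pos _)]
      refine le_trans (mul_le_of_le_one_left (abs_nonneg _) (expEn_le _ _ _ _)) ?_
      exact dE_bound2 hp.M0 (hp.nn u hu) (hp.le u hu) (hp.dle u hu) w g x) hbi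
    (ae_of_all _ fun x u hu => (En_hasDeriv (hp.der u hu) w g x).neg.exp)).2
  have hl := h.log (Zp_pos (ν := ν) hv.meas (c t) (Yv (c t) w g)).ne'
  refine hl.congr_deriv ?_
  rw [post_integral, ← neg_div, ← integral_neg]
  congr 2
  ext x; ring

/-- uniform quadratic bound -/
def QB (ν : Measure X) (v : X → κ → ℝ) (M : ℝ) (w g : κ → ℝ) : ℝ :=
  ∑ k, (2 * g k ^ 2 + M ^ 2 * (2 * w k ^ 2 + ∫ x, v x k ^ 2 ∂ν))

theorem BD_le_QB {c : κ → ℝ} {M : ℝ} (hc0 : ∀ k, 0 ≤ c k) (hc : ∀ k, c k ≤ M) (w g : κ → ℝ) :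
    BD ν v c (Yv c w g) ≤ QB ν v M w g := by
  unfold BD QB Yv
  refine Finset.sum_le_sum fun k _ => ?_
  have h1 : c k ^ 2 ≤ M ^ 2 := pow_le_pow_left₀ (hc0 k) (hc k) 2
  have h2 : 0 ≤ ∫ x, v x k ^ 2 ∂ν := integral_nonneg fun x => sq_nonneg _
  nlinarith [sq_nonneg (g k - c k * w k), mul_le_mul_of_nonneg_right h1 (sq_nonneg (w k)),
    mul_le_mul_of_nonneg_right h1 h2]

theorem sq_le_QB (M : ℝ) (w g : κ → ℝ) : ∑ k, g k ^ 2 ≤ QB ν v M w g := by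
  unfold QB
  refine Finset.sum_le_sum fun k _ => ?_
  have h2 : 0 ≤ ∫ x, v x k ^ 2 ∂ν := integral_nonneg fun x => sq_nonneg _
  have : 0 ≤ M ^ 2 * (2 * w k ^ 2 + ∫ x, v x k ^ 2 ∂ν) := by positivity
  nlinarith [sq_nonneg (g k)]

theorem QB_int (ν : Measure X) (v : X → κ → ℝ) (hw : L2 μ w) (M : ℝ) :
    Integrable (fun p : S × (κ → ℝ) => QB ν v M (w p.1) p.2) (μ.prod (GG κ)) := by
  unfold QB
  refine integrable_finsetSum _ fun k _ => ?_
  have h1 : Integrable (fun p : S × (κ → ℝ) => p.2 k ^ 2) (μ.prod (GG κ)) := by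
    have := (GG_sq k k).comp_snd μ
    simpa [sq] using this
  have h2 : Integrable (fun p : S × (κ → ℝ) => w p.1 k ^ 2) (μ.prod (GG κ)) :=
    (hw.sq k).comp_fst (GG κ)
  exact (h1.const_mul 2).add (((h2.const_mul 2).add (integrable_const _)).const_mul _)

theorem Yv_meas (hw : Measurable w) (c : κ → ℝ) :
    Measurable (fun p : S × (κ → ℝ) => Yv c (w p.1) p.2) := by
  unfold Yv
  have : ∀ k, Measurable (fun x => w x k) := fun k => (measurable_pi_apply k).comp hw
  fun_prop

theorem logZp_meas (hv : Measurable v) (hw : Measurable w) (c : κ → ℝ) :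
    Measurable (fun p : S × (κ → ℝ) => Real.log (Zp ν v c (Yv c (w p.1) p.2))) :=
  ((Zp_meas hv c).comp (Yv_meas hw c)).log

theorem logZp_abs_le (hv : L2 ν v) {c : κ → ℝ} {M : ℝ} (hc0 : ∀ k, 0 ≤ c k) (hc : ∀ k, c k ≤ M)
    (w g : κ → ℝ) : |Real.log (Zp ν v c (Yv c w g))| ≤ QB ν v M w g := by
  rw [abs_of_nonpos (Real.log_nonpos (Zp_pos hv.meas _ _).le (Zp_le_one hv.meas _ _))]
  exact (neg_log_Zp_le hv _ _).trans (BD_le_QB hc0 hc w g)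

theorem logZp_int (hv : L2 ν v) (hw : L2 μ w) {c : κ → ℝ} (hc0 : ∀ k, 0 ≤ c k) :
    Integrable (fun p : S × (κ → ℝ) => Real.log (Zp ν v c (Yv c (w p.1) p.2))) (μ.prod (GG κ)) := by
  have hM : ∀ k, c k ≤ ∑ k, c k := fun k => Finset.single_le_sum (fun i _ => hc0 i) (Finset.mem_univ k)
  exact (QB_int ν v hw (∑ k, c k)).mono' (logZp_meas hv.meas hw.meas c).aestronglyMeasurable
    (ae_of_all _ fun p => logZp_abs_le hv hc0 hM _ _)

/-- averaged log partition function -/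
def FF (μ : Measure S) (ν : Measure X) (w : S → κ → ℝ) (v : X → κ → ℝ) (c : κ → ℝ) : ℝ :=
  ∫ p, Real.log (Zp ν v c (Yv c (w p.1) p.2)) ∂(μ.prod (GG κ))

theorem FF_deriv0 (hv : L2 ν v) (hw : L2 μ w) {c c' : ℝ → κ → ℝ} {t0 ε M : ℝ}
    (hp : CPath c c' t0 ε M) :
    HasDerivAt (fun t => FF μ ν w v (c t)) (∫ p, (-∫ x, dE v (c t0) (c' t0) (w p.1) p.2 x
      ∂(post ν v (c t0) (Yv (c t0) (w p.1) p.2))) ∂(μ.prod (GG κ))) t0 := by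
  have ht0 : t0 ∈ Metric.ball t0 ε := Metric.mem_ball_self hp.eps
  refine (hasDerivAt_integral_of_dominated_loc_of_deriv_le (μ := μ.prod (GG κ))
    (F := fun t p => Real.log (Zp ν v (c t) (Yv (c t) (w p.1) p.2)))
    (F' := fun t p => -∫ x, dE v (c t) (c' t) (w p.1) p.2 x
      ∂(post ν v (c t) (Yv (c t) (w p.1) p.2)))
    (s := Metric.ball t0 ε) (x₀ := t0) (Metric.isOpen_ball.mem_nhds ht0)
    (Eventually.of_forall fun t => (logZp_meas hv.meas hw.meas _).aestronglyMeasurable)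
    (logZp_int hv hw (hp.nn t0 ht0)) ?_
    (bound := fun p => M * (5 * QB ν v M (w p.1) p.2)) ?_ ?_ ?_).2
  · simp_rw [post_integral]
    refine Measurable.aestronglyMeasurable ?_
    refine (Measurable.div ?_ ((Zp_meas hv.meas _).comp (Yv_meas hw.meas _))).neg
    have h : StronglyMeasurable (fun q : (S × (κ → ℝ)) × X =>
        dE v (c t0) (c' t0) (w q.1.1) q.1.2 q.2 *
          Real.exp (-En v (c t0) (Yv (c t0) (w q.1.1) q.1.2) q.2)) := by
      refine Measurable.stronglyMeasurable ?_
      unfold dE En Yv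
      have h1 : ∀ k, Measurable (fun x => v x k) := hv.meask
      have h2 : ∀ k, Measurable (fun x => w x k) := hw.meask
      fun_prop
    exact h.integral_prod_right.measurable
  · refine ae_of_all _ fun p t ht => ?_
    have hpr := post_prob (ν := ν) hv.meas (c t) (Yv (c t) (w p.1) p.2)
    rw [norm_neg, Real.norm_eq_abs]
    refine (abs_integral_le_integral_abs).trans ?_
    have hl := lin2 (post_int hv.meas (c t) (Yv (c t) (w p.1) p.2)
      (En_int hv (c t) (Yv (c t) (w p.1) p.2))) (integrable_const (0:ℝ)) (M * 4) 0
      (M * ∑ k, p.2 k ^ 2)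
    have h1 : ∫ x, |dE v (c t) (c' t) (w p.1) p.2 x| ∂(post ν v (c t) (Yv (c t) (w p.1) p.2)) ≤
        M * 4 * (∫ x, En v (c t) (Yv (c t) (w p.1) p.2) x
          ∂(post ν v (c t) (Yv (c t) (w p.1) p.2))) + M * ∑ k, p.2 k ^ 2 := by
      have := integral_mono (post_int hv.meas (c t) (Yv (c t) (w p.1) p.2)
        (Zp_hasDeriv hv hp (w p.1) p.2 t ht).1.abs) hl.1 (fun x => by
          have := dE_bound1 (v := v) hp.M0 (hp.nn t ht) (hp.le t ht) (hp.dle t ht) (w p.1) p.2 x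
          dsimp only; linarith)
      rw [hl.2] at this
      simpa using this
    refine h1.trans ?_
    have h2 := post_En_le hv (c t) (Yv (c t) (w p.1) p.2)
    have h3 := BD_le_QB (ν := ν) (v := v) (hp.nn t ht) (hp.le t ht) (w p.1) p.2
    have h4 := sq_le_QB (ν := ν) (v := v) M (w p.1) p.2
    have := hp.M0
    nlinarith
  · exact ((QB_int ν v hw M).const_mul 5).const_mul M
  · exact ae_of_all _ fun p t ht => (Zp_hasDeriv hv hp (w p.1) p.2 t ht).2

end deriv
end

set_option linter.all false
set_option linter.deprecated false
noncomputable section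

section ibp
variable {κ X S : Type*} [Fintype κ] [MeasurableSpace X] {ν : Measure X} [IsProbabilityMeasure ν]
  {v : X → κ → ℝ} [MeasurableSpace S] {μ : Measure S} [IsProbabilityMeasure μ] {w : S → κ → ℝ}

theorem En_update_deriv [DecidableEq κ] (c y : κ → ℝ) (k : κ) (x : X) (t : ℝ) :
    HasDerivAt (fun t => En v c (Function.update y k t) x) (t - c k * v x k) t := by
  unfold En
  have h : ∀ j ∈ Finset.univ, HasDerivAt (fun t => (Function.update y k t j - c j * v x j) ^ 2)
      (if j = k then 2 * (t - c k * v x k) else 0) t := by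
    intro j _
    by_cases hj : j = k
    · subst hj
      simp only [Function.update_self, if_true]
      refine (((hasDerivAt_id' t).sub_const (c j * v x j)).pow 2).congr_deriv ?_
      push_cast; ring
    · simp only [Function.update_of_ne hj, hj, if_false]
      exact hasDerivAt_const _ _
  refine ((HasDerivAt.fun_sum h).const_mul (1 / 2)).congr_deriv ?_
  simp

theorem num_deriv [DecidableEq κ] (hv : L2 ν v) (c y : κ → ℝ) (k : κ) {f : X → ℝ}
    (hf : Integrable f ν) (hfv : Integrable (fun x => f x * v x k) ν) :
    HasDerivAt (fun t => ∫ x, f x * Real.exp (-En v c (Function.update y k t) x) ∂ν)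
      (∫ x, f x * (c k * v x k - y k) * Real.exp (-En v c y x) ∂ν) (y k) := by
  have h := (hasDerivAt_integral_of_dominated_loc_of_deriv_le (μ := ν)
    (F := fun t x => f x * Real.exp (-En v c (Function.update y k t) x))
    (F' := fun t x => f x * (Real.exp (-En v c (Function.update y k t) x) * (-(t - c k * v x k))))
    (s := Metric.ball (y k) 1) (x₀ := y k) (Metric.ball_mem_nhds _ one_pos)
    (Eventually.of_forall fun t => (mul_expEn_int hv.meas _ _ hf).1)
    (mul_expEn_int hv.meas _ _ hf)
    (hf.1.mul ((En_meas hv.meas _ _).neg.exp.mul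
      ((measurable_const.sub ((hv.meask k).const_mul _)).neg)).aestronglyMeasurable)
    (bound := fun x => (|y k| + 1) * |f x| + |c k| * |f x * v x k|)
    (ae_of_all _ fun x u hu => by
      rw [Real.norm_eq_abs, abs_mul, abs_mul, abs_neg, abs_of_pos (Real.exp_pos _)]
      have h1 : |u| ≤ |y k| + 1 := by
        have := (abs_sub_abs_le_abs_sub u (y k))
        rw [Metric.mem_ball, Real.dist_eq] at hu
        linarith
      have h2 : |u - c k * v x k| ≤ (|y k| + 1) + |c k| * |v x k| := by
        refine (abs_sub _ _).trans ?_
        rw [abs_mul]; gcongr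
      have h3 := mul_le_of_le_one_left (abs_nonneg (u - c k * v x k))
        (expEn_le v c (Function.update y k u) x)
      calc _ ≤ |f x| * ((|y k| + 1) + |c k| * |v x k|) := by
              gcongr; exact h3.trans h2
        _ = _ := by rw [abs_mul (f x)]; ring)
    ((hf.abs.const_mul _).add (hfv.abs.const_mul _))
    (ae_of_all _ fun x u hu => ((En_update_deriv c y k x u).neg.exp).const_mul (f x))).2
  refine h.congr_deriv ?_
  congr 1
  ext x
  rw [Function.update_eq_self]; ring

theorem av_deriv [DecidableEq κ] (hv : L2 ν v) (c y : κ → ℝ) (k : κ) :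
    HasDerivAt (fun t => ∫ x, v x k ∂(post ν v c (Function.update y k t)))
      (c k * (∫ x, v x k ^ 2 ∂(post ν v c y) - (∫ x, v x k ∂(post ν v c y)) ^ 2)) (y k) := by
  have h1 := num_deriv hv c y k (hv.int k) (by simpa [sq] using hv.sq k)
  have h2 := num_deriv hv c y k (f := fun _ => (1:ℝ)) (integrable_const _) (by simpa using hv.int k)
  simp only [one_mul] at h2
  have hZ := Zp_pos (ν := ν) hv.meas c y
  simp_rw [post_integral]
  have h3 := h1.div h2 (by rw [Function.update_eq_self]; exact hZ.ne')
  simp only [Function.update_eq_self] at h3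
  refine h3.congr_deriv ?_
  have iv := mul_expEn_int hv.meas c y (hv.int k)
  have iv2 := mul_expEn_int hv.meas c y (hv.sq k)
  have i0 := expEn_int (ν := ν) hv.meas c y
  have e1 : ∫ x, v x k * (c k * v x k - y k) * Real.exp (-En v c y x) ∂ν =
      c k * ∫ x, v x k ^ 2 * Real.exp (-En v c y x) ∂ν -
        y k * ∫ x, v x k * Real.exp (-En v c y x) ∂ν := by
    rw [← integral_const_mul, ← integral_const_mul, ← integral_sub (iv2.const_mul _) (iv.const_mul _)]
    congr 1; ext x; ring
  have e2 : ∫ x, (c k * v x k - y k) * Real.exp (-En v c y x) ∂ν =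
      c k * ∫ x, v x k * Real.exp (-En v c y x) ∂ν - y k * Zp ν v c y := by
    unfold Zp
    rw [← integral_const_mul, ← integral_const_mul, ← integral_sub (iv.const_mul _) (i0.const_mul _)]
    congr 1; ext x; ring
  rw [e1, e2]
  change ((c k * _ - _) * Zp ν v c y - _) / Zp ν v c y ^ 2 = _
  field_simp
  ring

/-- posterior mean of the k-th channel component, as function of (s,g) -/
def Ak (ν : Measure X) (v : X → κ → ℝ) (w : S → κ → ℝ) (c : κ → ℝ) (k : κ) (p : S × (κ → ℝ)) : ℝ :=
  ∫ x, v x k ∂(post ν v c (Yv c (w p.1) p.2))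

def Bk (ν : Measure X) (v : X → κ → ℝ) (w : S → κ → ℝ) (c : κ → ℝ) (k : κ) (p : S × (κ → ℝ)) : ℝ :=
  ∫ x, v x k ^ 2 ∂(post ν v c (Yv c (w p.1) p.2))

theorem Ak_meas (hv : L2 ν v) (hw : L2 μ w) (c : κ → ℝ) (k : κ) : Measurable (Ak ν v w c k) :=
  (av_meas hv.meas c (hv.meask k)).comp (Yv_meas hw.meas c)

theorem Bk_meas (hv : L2 ν v) (hw : L2 μ w) (c : κ → ℝ) (k : κ) : Measurable (Bk ν v w c k) :=
  (av_meas hv.meas c ((hv.meask k).pow_const 2)).comp (Yv_meas hw.meas c)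

theorem Bk_int (hv : L2 ν v) (hw : L2 μ w) {c : κ → ℝ} (hc0 : ∀ k, 0 ≤ c k) (k : κ)
    (hk : 0 < c k) : Integrable (Bk ν v w c k) (μ.prod (GG κ)) := by
  have hM : ∀ k, c k ≤ ∑ k, c k := fun k => Finset.single_le_sum (fun i _ => hc0 i) (Finset.mem_univ k)
  refine ((QB_int ν v hw (∑ k, c k)).const_mul (6 / c k ^ 2)).mono'
    (Bk_meas hv hw c k).aestronglyMeasurable (ae_of_all _ fun p => ?_)
  have h0 : 0 ≤ Bk ν v w c k p := integral_nonneg fun x => sq_nonneg _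
  rw [Real.norm_eq_abs, abs_of_nonneg h0]
  have h1 := post_sq_le hv c (Yv c (w p.1) p.2) k
  have h2 := BD_le_QB (ν := ν) (v := v) hc0 hM (w p.1) p.2
  have h3 : Yv c (w p.1) p.2 k ^ 2 ≤ BD ν v c (Yv c (w p.1) p.2) := by
    unfold BD
    have hn : ∀ j, 0 ≤ c j ^ 2 * ∫ x, v x j ^ 2 ∂ν := fun j =>
      mul_nonneg (sq_nonneg _) (integral_nonneg fun x => sq_nonneg _)
    have := Finset.single_le_sum (f := fun j => Yv c (w p.1) p.2 j ^ 2 + c j ^ 2 * ∫ x, v x j ^ 2 ∂ν)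
      (fun i _ => add_nonneg (sq_nonneg _) (hn i)) (Finset.mem_univ k)
    linarith [hn k]
  rw [div_mul_eq_mul_div, le_div_iff₀ (by positivity)]
  change c k ^ 2 * Bk ν v w c k p ≤ _ at h1
  linarith

theorem Ak_sq_le (hv : L2 ν v) (c : κ → ℝ) (k : κ) (p : S × (κ → ℝ)) :
    Ak ν v w c k p ^ 2 ≤ Bk ν v w c k p := post_mean_sq_le hv _ _ (hv.int k) (hv.sq k)

theorem Ak_memLp (hv : L2 ν v) (hw : L2 μ w) {c : κ → ℝ} (hc0 : ∀ k, 0 ≤ c k) (k : κ)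
    (hk : 0 < c k) : MemLp (Ak ν v w c k) 2 (μ.prod (GG κ)) := by
  rw [memLp_two_iff_integrable_sq (Ak_meas hv hw c k).aestronglyMeasurable]
  refine (Bk_int hv hw hc0 k hk).mono' ((Ak_meas hv hw c k).pow_const 2).aestronglyMeasurable
    (ae_of_all _ fun p => ?_)
  rw [Real.norm_eq_abs, abs_of_nonneg (sq_nonneg _)]
  exact Ak_sq_le hv c k p

theorem g_memLp (k : κ) : MemLp (fun p : S × (κ → ℝ) => p.2 k) 2 (μ.prod (GG κ)) :=
  (GG_memLp k 2 (by simp)).comp_snd μ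

theorem w_memLp (hw : L2 μ w) (k : κ) :
    MemLp (fun p : S × (κ → ℝ) => w p.1 k) 2 (μ.prod (GG κ)) :=
  (hw.memLp k).comp_fst _

theorem ibp_k (hv : L2 ν v) (hw : L2 μ w) {c : κ → ℝ} (hc0 : ∀ k, 0 ≤ c k) (k : κ)
    (hk : 0 < c k) :
    ∫ p, p.2 k * Ak ν v w c k p ∂(μ.prod (GG κ)) =
      ∫ p, c k * (Bk ν v w c k p - Ak ν v w c k p ^ 2) ∂(μ.prod (GG κ)) := by
  classical
  have hA := Ak_memLp hv hw hc0 k hk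
  have i1 : Integrable (fun p : S × (κ → ℝ) => p.2 k * Ak ν v w c k p) (μ.prod (GG κ)) :=
    (g_memLp k).integrable_mul hA
  have i2 : Integrable (fun p : S × (κ → ℝ) => c k * (Bk ν v w c k p - Ak ν v w c k p ^ 2))
      (μ.prod (GG κ)) := ((Bk_int hv hw hc0 k hk).sub hA.integrable_sq).const_mul _
  have i3 := hA.integrable (by norm_num)
  rw [integral_prod _ i1, integral_prod _ i2]
  refine integral_congr_ae ?_
  filter_upwards [i1.prod_right_ae, i2.prod_right_ae, i3.prod_right_ae] with s h1 h2 h3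
  refine GG_stein k (fun g => Ak ν v w c k (s, g)) _ (fun g => ?_) h3 h1 h2
  have h := av_deriv hv c (Yv c (w s) g) k
  have e : ∀ t, Yv c (w s) (Function.update g k t) =
      Function.update (Yv c (w s) g) k (t + c k * w s k) := by
    intro t
    ext j
    by_cases hj : j = k
    · subst hj; simp [Yv]
    · simp [Yv, Function.update_of_ne hj]
  simp only [Ak, Bk, e]
  have h' : HasDerivAt (fun t => ∫ x, v x k ∂(post ν v c (Function.update (Yv c (w s) g) k t)))
      (c k * (∫ x, v x k ^ 2 ∂(post ν v c (Yv c (w s) g)) -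
        (∫ x, v x k ∂(post ν v c (Yv c (w s) g))) ^ 2)) (g k + c k * w s k) := h
  exact h'.comp_add_const (g k) (c k * w s k)

theorem gw_zero (hw : L2 μ w) (k : κ) : ∫ p, p.2 k * w p.1 k ∂(μ.prod (GG κ)) = 0 := by
  have := integral_prod_mul (μ := μ) (ν := GG κ) (fun s => w s k) (fun g => g k)
  simp_rw [mul_comm (_ : ℝ) (w _ k)]
  rw [this, GG_mean, mul_zero]

theorem term_k (hv : L2 ν v) (hw : L2 μ w) {c : κ → ℝ} (hc0 : ∀ k, 0 ≤ c k) (k : κ)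
    (a : ℝ) (ha : c k = 0 → a = 0) :
    Integrable (fun p => a * (p.2 k * (w p.1 k - Ak ν v w c k p) + c k * (w p.1 k ^ 2 -
      2 * w p.1 k * Ak ν v w c k p + Bk ν v w c k p))) (μ.prod (GG κ)) ∧
    ∫ p, a * (p.2 k * (w p.1 k - Ak ν v w c k p) + c k * (w p.1 k ^ 2 -
      2 * w p.1 k * Ak ν v w c k p + Bk ν v w c k p)) ∂(μ.prod (GG κ)) =
    c k * a * ∫ p, (w p.1 k - Ak ν v w c k p) ^ 2 ∂(μ.prod (GG κ)) := by
  rcases (hc0 k).eq_or_lt with h0 | hk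
  · rw [ha h0.symm]; simp
  have hA := Ak_memLp hv hw hc0 k hk
  have i1 : Integrable (fun p : S × (κ → ℝ) => p.2 k * Ak ν v w c k p) (μ.prod (GG κ)) :=
    (g_memLp k).integrable_mul hA
  have i2 : Integrable (fun p : S × (κ → ℝ) => p.2 k * w p.1 k) (μ.prod (GG κ)) :=
    (g_memLp k).integrable_mul (w_memLp hw k)
  have i3 : Integrable (fun p : S × (κ → ℝ) => w p.1 k * Ak ν v w c k p) (μ.prod (GG κ)) :=
    (w_memLp hw k).integrable_mul hA
  have i4 := (w_memLp (κ := κ) hw k).integrable_sq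
  have i5 := Bk_int hv hw hc0 k hk
  have i6 := hA.integrable_sq
  have l1 := lin3 i2 i1 i4 1 (-1) (c k) 0
  have l2 := lin3 l1.1 i3 i5 a (a * c k * (-2)) (a * c k) 0
  have l3 := lin3 i4 i3 i6 1 (-2) 1 0
  have e1 : (fun p : S × (κ → ℝ) => a * (p.2 k * (w p.1 k - Ak ν v w c k p) + c k * (w p.1 k ^ 2 -
      2 * w p.1 k * Ak ν v w c k p + Bk ν v w c k p))) = fun p =>
      a * (1 * (p.2 k * w p.1 k) + -1 * (p.2 k * Ak ν v w c k p) + c k * w p.1 k ^ 2 + 0) +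
        a * c k * (-2) * (w p.1 k * Ak ν v w c k p) + a * c k * Bk ν v w c k p + 0 := by
    ext p; ring
  have e2 : (fun p : S × (κ → ℝ) => (w p.1 k - Ak ν v w c k p) ^ 2) = fun p =>
      1 * w p.1 k ^ 2 + -2 * (w p.1 k * Ak ν v w c k p) + 1 * Ak ν v w c k p ^ 2 + 0 := by
    ext p; ring
  have hibp := ibp_k hv hw hc0 k hk
  rw [integral_const_mul, integral_sub i5 i6] at hibp
  rw [e1, e2]
  refine ⟨l2.1, ?_⟩
  rw [l2.2, l1.2, l3.2, gw_zero hw, hibp]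
  ring

/-- main derivative formula -/
theorem FF_deriv (hv : L2 ν v) (hw : L2 μ w) {c c' : ℝ → κ → ℝ} {t0 ε M : ℝ}
    (hp : CPath c c' t0 ε M) :
    HasDerivAt (fun t => FF μ ν w v (c t)) (-∑ k, c t0 k * c' t0 k *
      ∫ p, (w p.1 k - Ak ν v w (c t0) k p) ^ 2 ∂(μ.prod (GG κ))) t0 := by
  have ht0 : t0 ∈ Metric.ball t0 ε := Metric.mem_ball_self hp.eps
  refine (FF_deriv0 hv hw hp).congr_deriv ?_
  have ha : ∀ k, c t0 k = 0 → c' t0 k = 0 := by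
    intro k hk
    have := hp.dle t0 ht0 k
    rw [hk, mul_zero] at this
    exact abs_nonpos_iff.1 this
  have T := fun k => term_k hv hw (hp.nn t0 ht0) k (c' t0 k) (ha k)
  rw [integral_neg]
  congr 1
  simp_rw [← fun k => (T k).2]
  rw [← integral_finsetSum _ fun k _ => (T k).1]
  congr 1
  ext p
  have hpr := post_prob (ν := ν) hv.meas (c t0) (Yv (c t0) (w p.1) p.2)
  have L := fun k => lin2 (post_int hv.meas (c t0) (Yv (c t0) (w p.1) p.2) (hv.int k))
    (post_int hv.meas (c t0) (Yv (c t0) (w p.1) p.2) (hv.sq k))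
    (-(c' t0 k * p.2 k) - 2 * c' t0 k * c t0 k * w p.1 k) (c' t0 k * c t0 k)
    (c' t0 k * (p.2 k * w p.1 k + c t0 k * w p.1 k ^ 2))
  have e : ∀ x, dE v (c t0) (c' t0) (w p.1) p.2 x = ∑ k,
      ((-(c' t0 k * p.2 k) - 2 * c' t0 k * c t0 k * w p.1 k) * v x k +
        (c' t0 k * c t0 k) * v x k ^ 2 +
        (c' t0 k * (p.2 k * w p.1 k + c t0 k * w p.1 k ^ 2))) := by
    intro x
    unfold dE Yv
    refine Finset.sum_congr rfl fun k _ => ?_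
    ring
  simp_rw [e]
  rw [integral_finsetSum _ fun k _ => (L k).1]
  refine Finset.sum_congr rfl fun k _ => ?_
  rw [(L k).2]
  unfold Ak Bk
  ring

end ibp
end

set_option linter.all false
set_option linter.deprecated false
noncomputable section

section ibp
variable {κ X S : Type*} [Fintype κ] [MeasurableSpace X] {ν : Measure X} [IsProbabilityMeasure ν]
  {v : X → κ → ℝ} [MeasurableSpace S] {μ : Measure S} [IsProbabilityMeasure μ] {w : S → κ → ℝ}


theorem Zp_cont (hv : Measurable v) {c : ℝ → κ → ℝ} (hc : ∀ k, Continuous fun t => c t k) (w g : κ → ℝ) :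
    Continuous (fun t => Zp ν v (c t) (Yv (c t) w g)) := by
  refine continuous_of_dominated (F := fun t x => Real.exp (-En v (c t) (Yv (c t) w g) x))
    (bound := fun _ => 1) (fun t => (expEn_int hv _ _).1)
    (fun t => ae_of_all _ fun x => ?_) (integrable_const _) (ae_of_all _ fun x => ?_)
  · rw [Real.norm_eq_abs, abs_of_pos (Real.exp_pos _)]; exact expEn_le _ _ _ _
  · unfold En Yv
    fun_prop

theorem bound_c {c : ℝ → κ → ℝ} (hc : ∀ k, Continuous fun t => c t k)
    (a b : ℝ) : ∃ M, ∀ t ∈ Set.Icc a b, ∀ k, c t k ≤ M := by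
  have hcs : Continuous (fun t => ∑ k, |c t k|) := continuous_finset_sum _ fun k _ => (hc k).abs
  obtain ⟨M, hM⟩ := (isCompact_Icc (a := a) (b := b)).bddAbove_image hcs.continuousOn
  refine ⟨M, fun t ht k => ?_⟩
  refine (le_abs_self _).trans (le_trans ?_ (hM ⟨t, ht, rfl⟩))
  exact Finset.single_le_sum (f := fun k => |c t k|) (fun i _ => abs_nonneg _) (Finset.mem_univ k)

/-- continuity of the averaged log-partition function in the couplings -/
theorem FF_cont (hv : L2 ν v) (hw : L2 μ w) {c : ℝ → κ → ℝ} (hc : ∀ k, Continuous fun t => c t k)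
    {a b : ℝ} (hc0 : ∀ t ∈ Set.Icc a b, ∀ k, 0 ≤ c t k) :
    ContinuousOn (fun t => FF μ ν w v (c t)) (Set.Icc a b) := by
  obtain ⟨M, hM⟩ := bound_c hc a b
  refine continuousOn_of_dominated (F := fun t (p : S × (κ → ℝ)) =>
    Real.log (Zp ν v (c t) (Yv (c t) (w p.1) p.2))) (bound := fun p => QB ν v M (w p.1) p.2)
    (fun t _ => (logZp_meas hv.meas hw.meas _).aestronglyMeasurable)
    (fun t ht => ae_of_all _ fun p => logZp_abs_le hv (hc0 t ht) (hM t ht) _ _)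
    (QB_int ν v hw M) (ae_of_all _ fun p => ?_)
  exact ContinuousOn.log (Zp_cont hv.meas hc _ _).continuousOn (fun t _ => (Zp_pos hv.meas _ _).ne')

end ibp
end

set_option linter.all false
set_option linter.deprecated false
noncomputable section

/-! ### Nishimori identities -/
section nish
variable {κ X : Type*} [Fintype κ] [MeasurableSpace X] {μ : Measure X} [IsProbabilityMeasure μ]
  {w : X → κ → ℝ}

def Kd (w : X → κ → ℝ) (c : κ → ℝ) (p : X × (κ → ℝ)) : ℝ :=
  Real.exp (∑ k, (c k * w p.1 k * p.2 k - (c k * w p.1 k) ^ 2 / 2))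

theorem Kd_meas (hw : Measurable w) (c : κ → ℝ) : Measurable (Kd w c) := by
  unfold Kd
  have : ∀ k, Measurable (fun x => w x k) := fun k => (measurable_pi_apply k).comp hw
  fun_prop

theorem Kd_pos (c : κ → ℝ) (p : X × (κ → ℝ)) : 0 < Kd w c p := Real.exp_pos _

theorem Kd_eq (c : κ → ℝ) (x : X) (g : κ → ℝ) :
    Kd w c (x, g) = Real.exp ((1 / 2) * ∑ k, g k ^ 2) * Real.exp (-En w c g x) := by
  unfold Kd En
  rw [← Real.exp_add]
  congr 1
  rw [Finset.mul_sum, Finset.mul_sum, ← Finset.sum_neg_distrib, ← Finset.sum_add_distrib]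
  refine Finset.sum_congr rfl fun k _ => ?_
  ring

theorem map_Yv (hw : Measurable w) (c : κ → ℝ) :
    (μ.prod (GG κ)).map (fun p => (p.1, Yv c (w p.1) p.2)) =
      (μ.prod (GG κ)).withDensity (fun p => ENNReal.ofReal (Kd w c p)) := by
  have hm : Measurable (fun p : X × (κ → ℝ) => (p.1, Yv c (w p.1) p.2)) :=
    measurable_fst.prodMk (Yv_meas hw c)
  refine Measure.ext_of_lintegral _ fun f hf => ?_
  have hfc : Measurable (fun p : X × (κ → ℝ) => f (p.1, Yv c (w p.1) p.2)) := hf.comp hm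
  rw [lintegral_map hf hm, lintegral_prod _ hfc.aemeasurable,
    lintegral_withDensity_eq_lintegral_mul _ (Kd_meas hw c).ennreal_ofReal hf,
    lintegral_prod _ ((Kd_meas hw c).ennreal_ofReal.mul hf).aemeasurable]
  refine lintegral_congr fun s => ?_
  have h := GG_shift (fun k => c k * w s k)
  have hfs : Measurable (fun g => f (s, g)) := hf.comp measurable_prodMk_left
  have h2 : ∫⁻ g, f (s, Yv c (w s) g) ∂(GG κ) =
      ∫⁻ g, f (s, g) ∂((GG κ).map (fun g => g + fun k => c k * w s k)) := by
    rw [lintegral_map hfs (by fun_prop)]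
    rfl
  rw [h2, h, lintegral_withDensity_eq_lintegral_mul _ (by fun_prop) hfs]
  rfl

theorem int_Yv (hw : Measurable w) (c : κ → ℝ) {f : X × (κ → ℝ) → ℝ} (hf : Measurable f) :
    (Integrable (fun p => f (p.1, Yv c (w p.1) p.2)) (μ.prod (GG κ)) ↔
      Integrable (fun p => f p * Kd w c p) (μ.prod (GG κ))) ∧
    ∫ p, f (p.1, Yv c (w p.1) p.2) ∂(μ.prod (GG κ)) = ∫ p, f p * Kd w c p ∂(μ.prod (GG κ)) := by
  have hm : Measurable (fun p : X × (κ → ℝ) => (p.1, Yv c (w p.1) p.2)) :=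
    measurable_fst.prodMk (Yv_meas hw c)
  constructor
  · have h1 := integrable_map_measure (μ := μ.prod (GG κ)) (g := f) hf.aestronglyMeasurable
      hm.aemeasurable
    rw [map_Yv hw, integrable_withDensity_iff_integrable_smul' (Kd_meas hw c).ennreal_ofReal
      (ae_of_all _ fun p => ENNReal.ofReal_lt_top)] at h1
    refine h1.symm.trans (iff_of_eq ?_)
    congr 1
    ext p
    rw [ENNReal.toReal_ofReal (Kd_pos c p).le, smul_eq_mul, mul_comm]
  · rw [← integral_map hm.aemeasurable hf.aestronglyMeasurable, map_Yv hw,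
      integral_withDensity_eq_integral_toReal_smul (Kd_meas hw c).ennreal_ofReal
      (ae_of_all _ fun p => ENNReal.ofReal_lt_top)]
    congr 1
    ext p
    rw [ENNReal.toReal_ofReal (Kd_pos c p).le, smul_eq_mul, mul_comm]

theorem Kd_int (hw : Measurable w) (c g : κ → ℝ) : Integrable (fun x => Kd w c (x, g)) μ := by
  simp_rw [Kd_eq]
  exact (expEn_int hw c g).const_mul _

theorem post_Kd (hw : Measurable w) (c g : κ → ℝ) (f : X → ℝ) :
    (∫ x, f x ∂(post μ w c g)) * ∫ x, Kd w c (x, g) ∂μ = ∫ x, f x * Kd w c (x, g) ∂μ := by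
  simp_rw [Kd_eq]
  rw [post_integral, integral_const_mul]
  change _ * (_ * Zp μ w c g) = _
  have hZ := (Zp_pos (ν := μ) hw c g).ne'
  have e : ∀ x, f x * (Real.exp ((1 / 2) * ∑ k, g k ^ 2) * Real.exp (-En w c g x)) =
    Real.exp ((1 / 2) * ∑ k, g k ^ 2) * (f x * Real.exp (-En w c g x)) := by intro x; ring
  simp_rw [e]
  rw [integral_const_mul]
  field_simp

theorem nish (hw : Measurable w) (c : κ → ℝ) {f : X → ℝ} {ψ : (κ → ℝ) → ℝ} (hf : Measurable f)
    (hψ : Measurable ψ)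
    (h1 : Integrable (fun p => f p.1 * ψ (Yv c (w p.1) p.2)) (μ.prod (GG κ))) :
    Integrable (fun p => (∫ x, f x ∂(post μ w c (Yv c (w p.1) p.2))) * ψ (Yv c (w p.1) p.2))
      (μ.prod (GG κ)) ∧
    ∫ p, f p.1 * ψ (Yv c (w p.1) p.2) ∂(μ.prod (GG κ)) =
    ∫ p, (∫ x, f x ∂(post μ w c (Yv c (w p.1) p.2))) * ψ (Yv c (w p.1) p.2) ∂(μ.prod (GG κ)) := by
  have m1 : Measurable (fun p : X × (κ → ℝ) => f p.1 * ψ p.2) := by fun_prop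
  have hav : Measurable (fun y => ∫ x, f x ∂(post μ w c y)) := av_meas hw c hf
  have m2 : Measurable (fun p : X × (κ → ℝ) => (∫ x, f x ∂(post μ w c p.2)) * ψ p.2) :=
    (hav.comp measurable_snd).mul (hψ.comp measurable_snd)
  obtain ⟨a1, a2⟩ := int_Yv (μ := μ) hw c m1
  obtain ⟨b1, b2⟩ := int_Yv (μ := μ) hw c m2
  have i1 := a1.1 h1
  have i2 : Integrable (fun p : X × (κ → ℝ) => (∫ x, f x ∂(post μ w c p.2)) * ψ p.2 * Kd w c p)
      (μ.prod (GG κ)) := by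
    have m3 : Measurable (fun p : X × (κ → ℝ) => (∫ x, f x ∂(post μ w c p.2)) * ψ p.2 * Kd w c p) :=
      m2.mul (Kd_meas hw c)
    rw [integrable_prod_iff' m3.aestronglyMeasurable]
    refine ⟨ae_of_all _ fun g => (Kd_int hw c g).const_mul ((∫ x, f x ∂(post μ w c g)) * ψ g), ?_⟩
    have h3 := i1.integral_prod_right.norm
    refine h3.congr (ae_of_all _ fun g => ?_)
    dsimp only
    have e1 : ∫ x, f x * ψ g * Kd w c (x, g) ∂μ =
        ψ g * ((∫ x, f x ∂(post μ w c g)) * ∫ x, Kd w c (x, g) ∂μ) := by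
      rw [post_Kd hw, ← integral_const_mul]
      congr 1; ext x; ring
    rw [e1]
    simp_rw [norm_mul]
    rw [integral_const_mul]
    have e2 : ∀ x, ‖Kd w c (x, g)‖ = Kd w c (x, g) := fun x => by
      rw [Real.norm_eq_abs, abs_of_pos (Kd_pos _ _)]
    simp_rw [e2]
    rw [Real.norm_of_nonneg (integral_nonneg fun x => (Kd_pos c (x, g)).le)]
    ring
  refine ⟨b1.2 i2, ?_⟩
  refine a2.trans (Eq.trans ?_ b2.symm)
  rw [integral_prod_symm _ i1, integral_prod_symm _ i2]
  congr 1
  ext g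
  dsimp only
  rw [integral_const_mul, mul_right_comm, post_Kd hw, ← integral_mul_const]
  congr 1
  ext x; ring

theorem nish1 (hw : Measurable w) (c : κ → ℝ) {f : X → ℝ} (hf : Measurable f)
    (h1 : Integrable f μ) :
    Integrable (fun p => ∫ x, f x ∂(post μ w c (Yv c (w p.1) p.2))) (μ.prod (GG κ)) ∧
    ∫ p, (∫ x, f x ∂(post μ w c (Yv c (w p.1) p.2))) ∂(μ.prod (GG κ)) = ∫ x, f x ∂μ := by
  have i : Integrable (fun p : X × (κ → ℝ) => f p.1) (μ.prod (GG κ)) := h1.comp_fst _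
  have := nish hw c hf (ψ := fun _ => 1) measurable_const (by simpa using i)
  simp only [mul_one] at this
  refine ⟨this.1, this.2.symm.trans ?_⟩
  rw [integral_prod _ i]
  simp

theorem nish_sq (hw : L2 μ w) {c : κ → ℝ} (hc0 : ∀ k, 0 ≤ c k) (k : κ) (hk : 0 < c k) :
    ∫ p, (w p.1 k - Ak μ w w c k p) ^ 2 ∂(μ.prod (GG κ)) =
      ∫ x, w x k ^ 2 ∂μ - ∫ p, Ak μ w w c k p ^ 2 ∂(μ.prod (GG κ)) := by
  have hA := Ak_memLp hw hw hc0 k hk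
  have i3 : Integrable (fun p : X × (κ → ℝ) => w p.1 k * Ak μ w w c k p) (μ.prod (GG κ)) :=
    (w_memLp hw k).integrable_mul hA
  have i4 := (w_memLp (κ := κ) hw k).integrable_sq
  have i6 := hA.integrable_sq
  have l3 := lin3 i4 i3 i6 1 (-2) 1 0
  have e2 : (fun p : X × (κ → ℝ) => (w p.1 k - Ak μ w w c k p) ^ 2) = fun p =>
      1 * w p.1 k ^ 2 + -2 * (w p.1 k * Ak μ w w c k p) + 1 * Ak μ w w c k p ^ 2 + 0 := by
    ext p; ring
  rw [e2, l3.2]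
  have hn := (nish hw.meas c (hw.meask k) (av_meas (ν := μ) hw.meas c (hw.meask k)) i3).2
  have e3 : ∫ p, w p.1 k * Ak μ w w c k p ∂(μ.prod (GG κ)) =
      ∫ p, Ak μ w w c k p ^ 2 ∂(μ.prod (GG κ)) := by
    refine hn.trans ?_
    congr 1; ext p; unfold Ak; ring
  have e4 : ∫ p, w p.1 k ^ 2 ∂(μ.prod (GG κ)) = ∫ x, w x k ^ 2 ∂μ := by
    have := integral_prod _ i4
    simpa using this
  rw [e3, e4]; ring

/-- nonnegativity of the averaged log-likelihood ratio -/
theorem loglik_nonneg (hw : L2 μ w) {c : κ → ℝ} (hc0 : ∀ k, 0 ≤ c k) :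
    0 ≤ ∫ p, (Real.log (Zp μ w c (Yv c (w p.1) p.2)) + (1 / 2) * ∑ k, Yv c (w p.1) p.2 k ^ 2)
      ∂(μ.prod (GG κ)) := by
  have hKb : ∀ g, ∫ x, Kd w c (x, g) ∂μ = Real.exp ((1 / 2) * ∑ k, g k ^ 2) * Zp μ w c g := by
    intro g
    simp_rw [Kd_eq]
    rw [integral_const_mul]; rfl
  have hpos : ∀ g, 0 < ∫ x, Kd w c (x, g) ∂μ := fun g => by
    rw [hKb]; exact mul_pos (Real.exp_pos _) (Zp_pos hw.meas c g)
  have mK : Measurable (fun g => ∫ x, Kd w c (x, g) ∂μ) := by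
    simp_rw [hKb]
    have := Zp_meas (ν := μ) hw.meas c
    fun_prop
  have mI : Measurable (fun p : X × (κ → ℝ) => (∫ x, Kd w c (x, p.2) ∂μ)⁻¹) :=
    (mK.comp measurable_snd).inv
  obtain ⟨a1, a2⟩ := int_Yv (μ := μ) hw.meas c mI
  have i1 : Integrable (fun p : X × (κ → ℝ) => (∫ x, Kd w c (x, p.2) ∂μ)⁻¹ * Kd w c p)
      (μ.prod (GG κ)) := by
    have m3 : Measurable (fun p : X × (κ → ℝ) => (∫ x, Kd w c (x, p.2) ∂μ)⁻¹ * Kd w c p) :=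
      mI.mul (Kd_meas hw.meas c)
    rw [integrable_prod_iff' m3.aestronglyMeasurable]
    refine ⟨ae_of_all _ fun g => (Kd_int hw.meas c g).const_mul ((∫ x, Kd w c (x, g) ∂μ)⁻¹), ?_⟩
    refine (integrable_const (1:ℝ)).congr (ae_of_all _ fun g => ?_)
    dsimp only
    simp_rw [norm_mul]
    rw [integral_const_mul]
    have e2 : ∀ x, ‖Kd w c (x, g)‖ = Kd w c (x, g) := fun x => by
      rw [Real.norm_eq_abs, abs_of_pos (Kd_pos _ _)]
    simp_rw [e2]
    rw [Real.norm_of_nonneg (inv_pos.2 (hpos g)).le, inv_mul_cancel₀ (hpos g).ne']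
  have e1 : ∫ p : X × (κ → ℝ), (∫ x, Kd w c (x, Yv c (w p.1) p.2) ∂μ)⁻¹ ∂(μ.prod (GG κ)) = 1 := by
    refine a2.trans ?_
    rw [integral_prod_symm _ i1]
    have : ∀ g : κ → ℝ, ∫ x, (∫ x, Kd w c (x, g) ∂μ)⁻¹ * Kd w c (x, g) ∂μ = 1 := by
      intro g
      rw [integral_const_mul, inv_mul_cancel₀ (hpos g).ne']
    simp [this]
  have iY : Integrable (fun p : X × (κ → ℝ) => (1 / 2) * ∑ k, Yv c (w p.1) p.2 k ^ 2)
      (μ.prod (GG κ)) := by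
    refine (integrable_finsetSum _ fun k _ => ?_).const_mul _
    unfold Yv
    exact ((g_memLp k).add ((w_memLp hw k).const_mul _)).integrable_sq
  have h0 : 0 = ∫ p : X × (κ → ℝ), (1 - (∫ x, Kd w c (x, Yv c (w p.1) p.2) ∂μ)⁻¹)
      ∂(μ.prod (GG κ)) := by
    rw [integral_sub (integrable_const _) (a1.2 i1), e1]; simp
  rw [h0]
  refine integral_mono ((integrable_const _).sub (a1.2 i1)) ((logZp_int hw hw hc0).add iY) fun p => ?_
  dsimp only
  have h2 : Real.log (Zp μ w c (Yv c (w p.1) p.2)) + (1 / 2) * ∑ k, Yv c (w p.1) p.2 k ^ 2 =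
      Real.log (∫ x, Kd w c (x, Yv c (w p.1) p.2) ∂μ) := by
    rw [hKb, Real.log_mul (Real.exp_ne_zero _) (Zp_pos hw.meas _ _).ne', Real.log_exp]; ring
  rw [h2]
  exact Real.one_sub_inv_le_log_of_pos (hpos _)

end nish
end

set_option linter.all false
set_option linter.deprecated false
noncomputable section

/-! ### Derivative along square-root paths -/
section sqrtpath
variable {κ X S : Type*} [Fintype κ] [MeasurableSpace X] [MeasurableSpace S]
  {ν : Measure X} [IsProbabilityMeasure ν] {μ : Measure S} [IsProbabilityMeasure μ]
  {v : X → κ → ℝ} {w : S → κ → ℝ}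

theorem CPath_sqrt (u a : κ → ℝ) (t0 : ℝ) (h : ∀ k, 0 < u k + a k * t0 ∨ (u k = 0 ∧ a k = 0)) :
    ∃ ε M, CPath (fun t k => √(u k + a k * t)) (fun t k => a k / (2 * √(u k + a k * t))) t0 ε M := by
  set D : κ → ℝ := fun k => u k + a k * t0 with hD
  have hD0 : ∀ k, 0 ≤ D k := fun k => by
    rcases h k with h | h
    · exact h.le
    · simp [hD, h.1, h.2]
  have hev : ∀ᶠ t in nhds t0, ∀ k, (u k = 0 ∧ a k = 0) ∨
      (0 < D k ∧ D k / 2 < u k + a k * t ∧ u k + a k * t < 2 * D k) := by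
    refine Filter.eventually_all.2 fun k => ?_
    rcases h k with h | h
    · have hc : ContinuousAt (fun t => u k + a k * t) t0 := by fun_prop
      have h1 : ∀ᶠ t in nhds t0, D k / 2 < u k + a k * t :=
        hc.eventually (lt_mem_nhds (by change D k / 2 < D k; have : 0 < D k := h; linarith))
      have h2 : ∀ᶠ t in nhds t0, u k + a k * t < 2 * D k :=
        hc.eventually (gt_mem_nhds (by change D k < 2 * D k; have : 0 < D k := h; linarith))
      filter_upwards [h1, h2] with t ht1 ht2
      exact Or.inr ⟨h, ht1, ht2⟩
    · exact Eventually.of_forall fun _ => Or.inl h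
  obtain ⟨ε, hε, hb⟩ := Metric.eventually_nhds_iff.1 hev
  have hbb : ∀ t ∈ Metric.ball t0 ε, ∀ k, (u k = 0 ∧ a k = 0) ∨
      (0 < D k ∧ D k / 2 < u k + a k * t ∧ u k + a k * t < 2 * D k) := fun t ht k => hb ht k
  have hMk : ∀ k, √(2 * D k) + |a k| / D k ≤ ∑ k, (√(2 * D k) + |a k| / D k) := fun k =>
    Finset.single_le_sum (f := fun k => √(2 * D k) + |a k| / D k)
      (fun i _ => add_nonneg (Real.sqrt_nonneg _) (div_nonneg (abs_nonneg _) (hD0 i))) (Finset.mem_univ k)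
  refine ⟨ε, ∑ k, (√(2 * D k) + |a k| / D k), hε, ?_, ?_, ?_, ?_, ?_⟩
  · exact Finset.sum_nonneg fun i _ =>
      add_nonneg (Real.sqrt_nonneg _) (div_nonneg (abs_nonneg _) (hD0 i))
  · intro t ht k
    rcases hbb t ht k with ⟨h1, h2⟩ | ⟨h1, h2, h3⟩
    · simp only [h1, h2]
      simpa using hasDerivAt_const t (0:ℝ)
    · have : HasDerivAt (fun t => u k + a k * t) (a k) t := by
        simpa using ((hasDerivAt_id t).const_mul (a k)).const_add (u k)
      exact this.sqrt (by linarith)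
  · intro t ht k; exact Real.sqrt_nonneg _
  · intro t ht k
    refine le_trans ?_ (hMk k)
    have : 0 ≤ |a k| / D k := div_nonneg (abs_nonneg _) (hD0 k)
    have h2 : √(u k + a k * t) ≤ √(2 * D k) := by
      refine Real.sqrt_le_sqrt ?_
      rcases hbb t ht k with ⟨h1, h2⟩ | ⟨h1, h2, h3⟩
      · simp [h1, h2, hD0 k]
      · exact h3.le
    linarith
  · intro t ht k
    have h0 : 0 ≤ √(u k + a k * t) := Real.sqrt_nonneg _
    refine le_trans ?_ (mul_le_mul_of_nonneg_right (hMk k) h0)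
    rcases hbb t ht k with ⟨h1, h2⟩ | ⟨h1, h2, h3⟩
    · simp [h1, h2]
    · have hp : 0 < u k + a k * t := by linarith
      have hs := Real.sqrt_pos.2 hp
      have hss := Real.mul_self_sqrt hp.le
      rw [abs_div, abs_of_pos (by positivity : 0 < 2 * √(u k + a k * t))]
      rw [div_le_iff₀ (by positivity)]
      have e : (√(2 * D k) + |a k| / D k) * √(u k + a k * t) * (2 * √(u k + a k * t)) =
          2 * (u k + a k * t) * √(2 * D k) + |a k| / D k * (2 * (u k + a k * t)) := by
        linear_combination (2 * (√(2 * D k) + |a k| / D k)) * hss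
      rw [e]
      have h4 : |a k| ≤ |a k| / D k * (2 * (u k + a k * t)) := by
        rw [div_mul_eq_mul_div, le_div_iff₀ h1]
        exact mul_le_mul_of_nonneg_left (by linarith) (abs_nonneg _)
      have h5 : 0 ≤ 2 * (u k + a k * t) * √(2 * D k) := by positivity
      linarith

theorem FF_sqrt_deriv (hv : L2 ν v) (hw : L2 μ w) (u a : κ → ℝ) (t0 : ℝ)
    (h : ∀ k, 0 < u k + a k * t0 ∨ (u k = 0 ∧ a k = 0)) :
    HasDerivAt (fun t => FF μ ν w v (fun k => √(u k + a k * t)))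
      (-∑ k, a k / 2 * ∫ p, (w p.1 k - Ak ν v w (fun k => √(u k + a k * t0)) k p) ^ 2
        ∂(μ.prod (GG κ))) t0 := by
  obtain ⟨ε, M, hp⟩ := CPath_sqrt u a t0 h
  refine (FF_deriv hv hw hp).congr_deriv ?_
  congr 1
  refine Finset.sum_congr rfl fun k _ => ?_
  congr 1
  rcases h k with h | h
  · have := Real.sqrt_pos.2 h
    field_simp
  · simp [h.1, h.2]

end sqrtpath

/-! ### The concrete channel -/

abbrev KK (n : ℕ) := (Fin n × Fin n) ⊕ Fin n

def vm {n : ℕ} (x : Fin n → ℝ) (p : Fin n × Fin n) : ℝ :=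
  if p.1 < p.2 then x p.1 * x p.2 else if p.1 = p.2 then x p.1 * x p.2 / √2 else 0

def vs {n : ℕ} (x : Fin n → ℝ) : KK n → ℝ := Sum.elim (vm x) x

def cs (n : ℕ) (α β : ℝ) : KK n → ℝ := Sum.elim (fun _ => √α) (fun _ => √β)

def nq {n : ℕ} (x : Fin n → ℝ) : ℝ := ∑ i, x i ^ 2
def dt {n : ℕ} (x y : Fin n → ℝ) : ℝ := ∑ i, x i * y i

theorem nq_nonneg {n : ℕ} (x : Fin n → ℝ) : 0 ≤ nq x := Finset.sum_nonneg fun i _ => sq_nonneg _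

theorem symsum {n : ℕ} (a : Fin n → Fin n → ℝ) (ha : ∀ i j, a i j = a j i) :
    ∑ i, ∑ j, a i j = 2 * ∑ p : Fin n × Fin n,
      (if p.1 < p.2 then a p.1 p.2 else if p.1 = p.2 then a p.1 p.2 / 2 else 0) := by
  rw [Fintype.sum_prod_type, two_mul]
  have hc := Finset.sum_comm (s := Finset.univ) (t := Finset.univ) (f := fun i j : Fin n =>
    (if i < j then a i j else if i = j then a i j / 2 else 0))
  nth_rw 2 [hc]
  rw [← Finset.sum_add_distrib]
  conv_rhs => rw [Finset.sum_congr rfl (fun i _ => (Finset.sum_add_distrib).symm)]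
  refine Finset.sum_congr rfl fun i _ => Finset.sum_congr rfl fun j _ => ?_
  dsimp only
  rcases lt_trichotomy i j with h | h | h
  · simp [h, h.not_gt, h.ne']
  · subst h; simp
  · simp [h, h.not_gt, h.ne', ha i j]

theorem vm_mul {n : ℕ} (x y : Fin n → ℝ) : ∑ p, vm x p * vm y p = (1 / 2) * dt x y ^ 2 := by
  have h := symsum (fun i j => x i * y i * (x j * y j)) (fun i j => mul_comm _ _)
  have h1 : dt x y ^ 2 = ∑ i, ∑ j, x i * y i * (x j * y j) := by
    rw [dt, sq, Finset.sum_mul_sum]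
  rw [h1, h, ← mul_assoc]
  norm_num
  refine Finset.sum_congr rfl fun p _ => ?_
  unfold vm
  have h2 : √2 * √2 = (2:ℝ) := Real.mul_self_sqrt (by norm_num)
  split_ifs
  · ring
  · rw [div_mul_div_comm, h2]; ring
  · simp

theorem vm_sq {n : ℕ} (x : Fin n → ℝ) : ∑ p, vm x p ^ 2 = (1 / 2) * nq x ^ 2 := by
  have := vm_mul x x
  simpa [dt, nq, sq] using this

theorem vm_meas {n : ℕ} (p : Fin n × Fin n) : Measurable (fun x : Fin n → ℝ => vm x p) := by
  unfold vm
  split_ifs <;> fun_prop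

theorem vs_meas {n : ℕ} : Measurable (vs : (Fin n → ℝ) → KK n → ℝ) := by
  refine measurable_pi_lambda _ fun k => ?_
  rcases k with p | i
  · exact vm_meas p
  · exact measurable_pi_apply i

theorem nq_meas {n : ℕ} : Measurable (nq : (Fin n → ℝ) → ℝ) := by unfold nq; fun_prop

theorem prior_memLp {n : ℕ} (v : ℝ) (i : Fin n) (p : ENNReal) (hp : p ≠ ⊤) :
    MemLp (fun x : Fin n → ℝ => x i) p (gaussPrior n v) :=
  (memLp_id_gaussianReal' p hp).comp_measurePreserving (measurePreserving_eval _ i)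

theorem prior_mul_memLp {n : ℕ} (v : ℝ) (i j : Fin n) :
    MemLp (fun x : Fin n → ℝ => x i * x j) 2 (gaussPrior n v) := by
  have : ENNReal.HolderTriple 4 4 2 := by
    constructor
    rw [← ENNReal.toReal_eq_toReal_iff' (by simp) (by simp), ENNReal.toReal_add (by simp) (by simp)]
    simp; norm_num
  exact MemLp.mul (p := 4) (q := 4) (r := 2) (prior_memLp v j 4 (by simp)) (prior_memLp v i 4 (by simp))

theorem vm_memLp {n : ℕ} (v : ℝ) (p : Fin n × Fin n) :
    MemLp (fun x : Fin n → ℝ => vm x p) 2 (gaussPrior n v) := by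
  have := prior_mul_memLp v p.1 p.2
  unfold vm
  split_ifs
  · exact this
  · simp_rw [div_eq_mul_inv]; exact this.mul_const _
  · simp

theorem vs_L2 (n : ℕ) (v : ℝ) : L2 (gaussPrior n v) (vs : (Fin n → ℝ) → KK n → ℝ) := by
  refine ⟨vs_meas, fun k => ?_⟩
  rcases k with p | i
  · exact (vm_memLp v p).integrable_sq
  · exact (prior_memLp v i 2 (by simp)).integrable_sq

theorem FF_cs_deriv {n : ℕ} {X S : Type*} [MeasurableSpace X] [MeasurableSpace S]
    {ν : Measure X} [IsProbabilityMeasure ν] {μ : Measure S} [IsProbabilityMeasure μ]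
    {v : X → KK n → ℝ} {w : S → KK n → ℝ} (hv : L2 ν v) (hw : L2 μ w) (b1 a1 b2 a2 t0 : ℝ)
    (h1 : 0 < b1 + a1 * t0 ∨ (b1 = 0 ∧ a1 = 0)) (h2 : 0 < b2 + a2 * t0 ∨ (b2 = 0 ∧ a2 = 0)) :
    HasDerivAt (fun t => FF μ ν w v (cs n (b1 + a1 * t) (b2 + a2 * t)))
      (-(a1 / 2 * ∑ p, ∫ q, (w q.1 (Sum.inl p) -
          Ak ν v w (cs n (b1 + a1 * t0) (b2 + a2 * t0)) (Sum.inl p) q) ^ 2 ∂(μ.prod (GG (KK n)))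
        + a2 / 2 * ∑ i, ∫ q, (w q.1 (Sum.inr i) -
          Ak ν v w (cs n (b1 + a1 * t0) (b2 + a2 * t0)) (Sum.inr i) q) ^ 2 ∂(μ.prod (GG (KK n))))) t0 := by
  have key := FF_sqrt_deriv hv hw (Sum.elim (fun _ => b1) (fun _ => b2))
    (Sum.elim (fun _ => a1) (fun _ => a2)) t0 (by rintro (k | k) <;> simpa)
  have e : ∀ t, (fun k : KK n => √((Sum.elim (fun _ => b1) (fun _ => b2) : KK n → ℝ) k +
      (Sum.elim (fun _ => a1) (fun _ => a2) : KK n → ℝ) k * t)) =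
      cs n (b1 + a1 * t) (b2 + a2 * t) := by
    intro t; ext k; rcases k with k | k <;> rfl
  simp only [e] at key
  refine key.congr_deriv ?_
  rw [Fintype.sum_sum_type]
  simp only [Sum.elim_inl, Sum.elim_inr, Finset.mul_sum]

/-! ### linking with the frozen definitions -/

def Zs {n : ℕ} (g : KK n → ℝ) : Matrix (Fin n) (Fin n) ℝ := Matrix.of fun i j =>
  if i = j then √2 * g (Sum.inl (i, j)) else if i ≤ j then g (Sum.inl (i, j)) else g (Sum.inl (j, i))

theorem matrix_meas {n : ℕ} {Ω : Type*} [MeasurableSpace Ω] {f : Ω → Matrix (Fin n) (Fin n) ℝ}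
    (h : ∀ i j, Measurable (fun x => f x i j)) : Measurable f :=
  measurable_pi_lambda _ fun i => measurable_pi_lambda _ fun j => h i j

theorem matrix_apply_meas {n : ℕ} (i j : Fin n) :
    Measurable (fun M : Matrix (Fin n) (Fin n) ℝ => M i j) :=
  (measurable_pi_apply j).comp (measurable_pi_apply i)

theorem Zs_meas {n : ℕ} : Measurable (Zs : (KK n → ℝ) → Matrix (Fin n) (Fin n) ℝ) := by
  refine matrix_meas fun i j => ?_
  unfold Zs
  simp only [Matrix.of_apply]
  split_ifs <;> fun_prop

theorem noise_eq (n : ℕ) : noiseMeasure n = (GG (KK n)).map Zs := by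
  have h1 : (Measure.pi fun p : Fin n × Fin n => gaussianReal 0 (if p.1 = p.2 then 2 else 1)) =
      (GG (KK n)).map (fun g p => (if p.1 = p.2 then √2 else 1) * g (Sum.inl p)) := by
    refine Measure.pi_eq fun s hs => ?_
    rw [Measure.map_apply (by fun_prop) (MeasurableSet.univ_pi hs)]
    have : (fun (g : KK n → ℝ) (p : Fin n × Fin n) => (if p.1 = p.2 then √2 else 1) *
        g (Sum.inl p)) ⁻¹' (Set.univ.pi s) = Set.univ.pi (Sum.elim (fun p =>
          (fun t => (if p.1 = p.2 then √2 else 1) * t) ⁻¹' s p) (fun _ => Set.univ)) := by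
      ext g
      simp [Set.mem_pi]
    rw [this, GG, Measure.pi_pi, Fintype.prod_sum_type]
    simp only [Sum.elim_inl, Sum.elim_inr, measure_univ, Finset.prod_const_one, mul_one]
    refine Finset.prod_congr rfl fun p _ => ?_
    rw [← Measure.map_apply (by fun_prop) (hs p), gaussianReal_map_const_mul]
    congr 2
    · simp
    · split_ifs
      · ext; simp
      · simp
  rw [noiseMeasure, h1, Measure.map_map _ (by fun_prop)]
  · congr 1
    ext g i j
    simp only [Function.comp, Zs, Matrix.of_apply]
    by_cases h : i = j
    · subst h; simp
    · by_cases h2 : i ≤ j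
      · simp [h, h2]
      · simp [h, h2, Ne.symm h]
  · refine matrix_meas fun i j => ?_
    simp only [Matrix.of_apply]
    split_ifs <;> fun_prop

end

set_option linter.all false
set_option linter.deprecated false
noncomputable section

def rest {n : ℕ} (g : KK n → ℝ) : ℝ :=
  ∑ p : Fin n × Fin n, (if p.2 < p.1 then g (Sum.inl p) ^ 2 else 0) + ∑ i, g (Sum.inr i) ^ 2

theorem frob_obs {n : ℕ} (lam : ℝ) (s x : Fin n → ℝ) (g : KK n → ℝ) :
    (1 / 4) * frobSq (obs n lam s (Zs g) - √(lam / n) • Matrix.vecMulVec x x) =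
      En vs (cs n (lam / n) 0) (Yv (cs n (lam / n) 0) (vs s) g) x - (1 / 2) * rest g := by
  unfold frobSq
  set c := √(lam / n)
  have e : ∀ i j : Fin n, ((obs n lam s (Zs g) - c • Matrix.vecMulVec x x) i j) ^ 2 =
      (c * (s i * s j) + Zs g i j - c * (x i * x j)) ^ 2 := by
    intro i j
    simp [obs, Matrix.vecMulVec_apply, c]
  simp_rw [e]
  rw [symsum _ (fun i j => by
    have : Zs g i j = Zs g j i := by
      simp only [Zs, Matrix.of_apply]
      rcases lt_trichotomy i j with h | h | h
      · simp [h.ne, h.ne', h.le, h.not_ge]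
      · subst h; simp
      · simp [h.ne, h.ne', h.le, h.not_ge]
    rw [this]; ring)]
  unfold En rest
  rw [Fintype.sum_sum_type]
  have e2 : ∑ i, (Yv (cs n (lam / n) 0) (vs s) g (Sum.inr i) -
      cs n (lam / n) 0 (Sum.inr i) * vs x (Sum.inr i)) ^ 2 = ∑ i, g (Sum.inr i) ^ 2 := by
    simp [Yv, cs]
  rw [e2]
  have e3 : ∑ p : Fin n × Fin n, (Yv (cs n (lam / n) 0) (vs s) g (Sum.inl p) -
      cs n (lam / n) 0 (Sum.inl p) * vs x (Sum.inl p)) ^ 2 =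
      ∑ p : Fin n × Fin n, (if p.1 < p.2 then (c * (s p.1 * s p.2) + Zs g p.1 p.2 - c * (x p.1 * x p.2)) ^ 2
        else if p.1 = p.2 then
          (c * (s p.1 * s p.2) + Zs g p.1 p.2 - c * (x p.1 * x p.2)) ^ 2 / 2 else 0) +
      ∑ p : Fin n × Fin n, (if p.2 < p.1 then g (Sum.inl p) ^ 2 else 0) := by
    rw [← Finset.sum_add_distrib]
    refine Finset.sum_congr rfl fun p _ => ?_
    obtain ⟨i, j⟩ := p
    simp only [Yv, cs, vs, Sum.elim_inl, vm, Zs, Matrix.of_apply]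
    rcases lt_trichotomy i j with h | h | h
    · simp only [h, h.ne, h.le, h.not_gt, if_true, if_false]; ring
    · subst h
      simp only [lt_irrefl, if_true, if_false]
      have h2 : √2 ^ 2 = (2:ℝ) := Real.sq_sqrt (by norm_num)
      have h3 : √2 ≠ 0 := by positivity
      change (g (Sum.inl (i, i)) + c * (s i * s i / √2) - c * (x i * x i / √2)) ^ 2 = _
      clear_value c
      field_simp
      rw [h2]
      ring_nf
    · simp only [h, h.not_gt, h.ne', if_true, if_false]; ring
  rw [e3]
  ring

theorem weight_obs {n : ℕ} (lam : ℝ) (s x : Fin n → ℝ) (g : KK n → ℝ) :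
    weight n lam (obs n lam s (Zs g)) x = Real.exp ((1 / 2) * rest g) *
      Real.exp (-En vs (cs n (lam / n) 0) (Yv (cs n (lam / n) 0) (vs s) g) x) := by
  unfold weight
  rw [← Real.exp_add, neg_mul, frob_obs]
  congr 1; ring

theorem gibbs_obs {n : ℕ} (sig' lam : ℝ) (s : Fin n → ℝ) (g : KK n → ℝ) (f : (Fin n → ℝ) → ℝ) :
    gibbs n sig' lam (obs n lam s (Zs g)) f =
      ∫ x, f x ∂(post (gaussPrior n (sig' ^ 2)) vs (cs n (lam / n) 0)
        (Yv (cs n (lam / n) 0) (vs s) g)) := by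
  rw [post_integral]
  unfold gibbs Zp
  simp_rw [weight_obs, mul_left_comm (f _)]
  rw [integral_const_mul, integral_const_mul]
  exact mul_div_mul_left _ _ (Real.exp_ne_zero _)

theorem frob_mse {n : ℕ} (sig' lam : ℝ) (s : Fin n → ℝ) (g : KK n → ℝ) :
    frobSq (Matrix.vecMulVec s s - gibbsMatrix n sig' lam (obs n lam s (Zs g))) =
      2 * ∑ p, (vs s (Sum.inl p) - Ak (gaussPrior n (sig' ^ 2)) vs vs (cs n (lam / n) 0)
        (Sum.inl p) (s, g)) ^ 2 := by
  unfold frobSq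
  have e : ∀ i j : Fin n, ((Matrix.vecMulVec s s - gibbsMatrix n sig' lam (obs n lam s (Zs g))) i j) ^ 2
      = (s i * s j - ∫ x, x i * x j ∂(post (gaussPrior n (sig' ^ 2)) vs (cs n (lam / n) 0)
        (Yv (cs n (lam / n) 0) (vs s) g))) ^ 2 := by
    intro i j
    simp [gibbsMatrix, Matrix.vecMulVec_apply, gibbs_obs]
  simp_rw [e]
  rw [symsum _ (fun i j => by simp_rw [mul_comm])]
  congr 1
  refine Finset.sum_congr rfl fun p _ => ?_
  obtain ⟨i, j⟩ := p
  unfold Ak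
  simp only [vs, Sum.elim_inl, vm]
  rcases lt_trichotomy i j with h | h | h
  · simp only [h, if_true]
  · subst h
    simp only [lt_irrefl, if_true, if_false]
    rw [integral_div, ← sub_div, div_pow, Real.sq_sqrt (by norm_num)]
  · simp [h.not_gt, h.ne']

theorem gibbs_meas {n : ℕ} (sig' lam : ℝ) {f : (Fin n → ℝ) → ℝ} (hf : Measurable f) :
    Measurable (fun Y : Matrix (Fin n) (Fin n) ℝ => gibbs n sig' lam Y f) := by
  have hw : Measurable (fun p : Matrix (Fin n) (Fin n) ℝ × (Fin n → ℝ) => weight n lam p.1 p.2) := by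
    unfold weight frobSq
    have : ∀ i j, Measurable (fun p : Matrix (Fin n) (Fin n) ℝ × (Fin n → ℝ) =>
        (p.1 - √(lam / n) • Matrix.vecMulVec p.2 p.2) i j) := by
      intro i j
      simp only [Matrix.sub_apply, Matrix.smul_apply, Matrix.vecMulVec_apply, smul_eq_mul]
      have h1 : Measurable (fun p : Matrix (Fin n) (Fin n) ℝ × (Fin n → ℝ) => p.1 i j) :=
        (matrix_apply_meas i j).comp measurable_fst
      fun_prop
    refine Measurable.exp (Measurable.const_mul ?_ _)
    exact Finset.measurable_sum _ fun i _ => Finset.measurable_sum _ fun j _ => (this i j).pow_const 2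
  unfold gibbs
  refine Measurable.div ?_ ?_
  · have : Measurable (fun p : Matrix (Fin n) (Fin n) ℝ × (Fin n → ℝ) => f p.2 * weight n lam p.1 p.2) :=
      (hf.comp measurable_snd).mul hw
    exact this.stronglyMeasurable.integral_prod_right.measurable
  · exact hw.stronglyMeasurable.integral_prod_right.measurable

theorem frob_meas {n : ℕ} (sig' lam : ℝ) :
    Measurable (fun p : (Fin n → ℝ) × Matrix (Fin n) (Fin n) ℝ =>
      frobSq (Matrix.vecMulVec p.1 p.1 - gibbsMatrix n sig' lam (obs n lam p.1 p.2))) := by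
  have ho : Measurable (fun p : (Fin n → ℝ) × Matrix (Fin n) (Fin n) ℝ => obs n lam p.1 p.2) := by
    refine matrix_meas fun i j => ?_
    simp only [obs, Matrix.add_apply, Matrix.smul_apply, Matrix.vecMulVec_apply, smul_eq_mul]
    have h1 : Measurable (fun p : (Fin n → ℝ) × Matrix (Fin n) (Fin n) ℝ => p.2 i j) :=
      (matrix_apply_meas i j).comp measurable_snd
    fun_prop
  unfold frobSq
  refine Finset.measurable_sum _ fun i _ => Finset.measurable_sum _ fun j _ => ?_
  refine Measurable.pow_const ?_ 2
  simp only [Matrix.sub_apply, Matrix.vecMulVec_apply, gibbsMatrix, Matrix.of_apply]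
  have h2 : Measurable (fun p : (Fin n → ℝ) × Matrix (Fin n) (Fin n) ℝ =>
      gibbs n sig' lam (obs n lam p.1 p.2) (fun x => x i * x j)) :=
    (gibbs_meas sig' lam (f := fun x => x i * x j) (by fun_prop)).comp ho
  fun_prop

theorem MSE_eq {n : ℕ} (hn : 0 < n) (sig sig' lam : ℝ) (hl : 0 < lam) :
    MSE n sig sig' lam lam = (2 / (n:ℝ) ^ 2) * ∑ p : Fin n × Fin n,
      ∫ q, (vs q.1 (Sum.inl p) - Ak (gaussPrior n (sig' ^ 2)) vs vs (cs n (lam / n) 0)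
        (Sum.inl p) q) ^ 2 ∂((gaussPrior n (sig ^ 2)).prod (GG (KK n))) := by
  have hn' : (0:ℝ) < n := by exact_mod_cast hn
  unfold MSE
  have hmap : (gaussPrior n (sig ^ 2)).prod (noiseMeasure n) =
      ((gaussPrior n (sig ^ 2)).prod (GG (KK n))).map (Prod.map id Zs) := by
    rw [noise_eq, ← Measure.map_prod_map _ _ measurable_id Zs_meas, Measure.map_id]
  rw [hmap, integral_map (measurable_id.prodMap Zs_meas).aemeasurable
    (frob_meas sig' lam).aestronglyMeasurable]
  simp only [Prod.map_fst, Prod.map_snd, id]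
  have e : ∀ q : (Fin n → ℝ) × (KK n → ℝ), frobSq (Matrix.vecMulVec q.1 q.1 -
      gibbsMatrix n sig' lam (obs n lam q.1 (Zs q.2))) =
      2 * ∑ p, (vs q.1 (Sum.inl p) - Ak (gaussPrior n (sig' ^ 2)) vs vs (cs n (lam / n) 0)
        (Sum.inl p) q) ^ 2 := fun q => frob_mse sig' lam q.1 q.2
  simp_rw [e]
  have hc0 : ∀ k, 0 ≤ cs n (lam / n) 0 k := by
    rintro (k | k) <;> exact Real.sqrt_nonneg _
  rw [integral_const_mul, integral_finsetSum]
  · ring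
  · intro p _
    refine MemLp.integrable_sq (MemLp.sub ?_ ?_)
    · exact w_memLp (vs_L2 n _) (Sum.inl p)
    · refine Ak_memLp (vs_L2 n _) (vs_L2 n _) hc0 _ ?_
      simp only [cs, Sum.elim_inl]
      positivity

def Phi (n : ℕ) (sig sig' lam : ℝ) : ℝ :=
  (1 / (n:ℝ)) * FF (gaussPrior n (sig ^ 2)) (gaussPrior n (sig' ^ 2)) vs vs (cs n (lam / n) 0)

theorem Phi_deriv {n : ℕ} (hn : 0 < n) (sig sig' lam : ℝ) (hl : 0 < lam) :
    HasDerivAt (fun l => Phi n sig sig' l) (-(1 / 4) * MSE n sig sig' lam lam) lam := by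
  have hn' : (0:ℝ) < n := by exact_mod_cast hn
  have h := FF_cs_deriv (vs_L2 n (sig' ^ 2)) (vs_L2 n (sig ^ 2)) 0 (1 / n) 0 0 lam
    (Or.inl (by positivity)) (Or.inr ⟨rfl, rfl⟩)
  have e : ∀ t : ℝ, cs n (0 + 1 / n * t) (0 + 0 * t) = cs n (t / n) 0 := by
    intro t; congr 1 <;> ring
  simp only [e] at h
  unfold Phi
  refine (h.const_mul (1 / (n:ℝ))).congr_deriv ?_
  rw [MSE_eq hn _ _ _ hl]
  field_simp
  ring

theorem Phi_anti {n : ℕ} (hn : 0 < n) (sig sig' : ℝ) {l1 l2 : ℝ} (h1 : 0 < l1) (h12 : l1 ≤ l2) :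
    Phi n sig sig' l2 ≤ Phi n sig sig' l1 := by
  have hd : ∀ l ∈ Set.Ioi (0:ℝ), HasDerivAt (fun l => Phi n sig sig' l) (-(1 / 4) * MSE n sig sig' l l) l :=
    fun l hl => Phi_deriv hn sig sig' l hl
  have := antitoneOn_of_deriv_nonpos (convex_Ioi (0:ℝ)) (f := fun l => Phi n sig sig' l)
    (fun l hl => (hd l hl).continuousAt.continuousWithinAt)
    (fun l hl => (hd l (interior_subset hl)).differentiableAt.differentiableWithinAt)
    (fun l hl => by
      rw [(hd l (interior_subset hl)).deriv]
      have : 0 ≤ MSE n sig sig' l l := by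
        unfold MSE
        refine mul_nonneg (by positivity) (integral_nonneg fun p => ?_)
        exact Finset.sum_nonneg fun i _ => Finset.sum_nonneg fun j _ => sq_nonneg _
      linarith)
  exact this h1 (lt_of_lt_of_le h1 h12) h12
end

set_option linter.all false
set_option linter.deprecated false
noncomputable section

/-! ### Lebesgue form -/

def lpm {n : ℕ} (y : KK n → ℝ) (x : Fin n → ℝ) : ℝ := ∑ p, y (Sum.inl p) * vm x p
def yr {n : ℕ} (y : KK n → ℝ) : Fin n → ℝ := fun i => y (Sum.inr i)
def ysq {n : ℕ} (y : KK n → ℝ) : ℝ := ∑ k, y k ^ 2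

def ham {n : ℕ} (γ α : ℝ) (y : KK n → ℝ) (x : Fin n → ℝ) : ℝ :=
  -γ * nq x / 2 + √α * lpm y x - α * nq x ^ 2 / 4

def ZL {n : ℕ} (γ α : ℝ) (y : KK n → ℝ) : ℝ := ∫ x, Real.exp (ham γ α y x)

theorem neg_En {n : ℕ} {α β : ℝ} (hα : 0 ≤ α) (hβ : 0 ≤ β) (y : KK n → ℝ) (x : Fin n → ℝ) :
    -En vs (cs n α β) y x = -(1 / 2) * ysq y + (√α * lpm y x - α * nq x ^ 2 / 4) +
      (√β * dt (yr y) x - β * nq x / 2) := by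
  unfold En ysq
  have e : ∀ k, (y k - cs n α β k * vs x k) ^ 2 = y k ^ 2 - 2 * (cs n α β k * (y k * vs x k)) +
      cs n α β k ^ 2 * vs x k ^ 2 := by intro k; ring
  simp_rw [e]
  rw [Finset.sum_add_distrib, Finset.sum_sub_distrib, ← Finset.mul_sum]
  have e1 : ∑ k, cs n α β k * (y k * vs x k) = √α * lpm y x + √β * dt (yr y) x := by
    rw [Fintype.sum_sum_type]
    simp [cs, vs, lpm, dt, yr, Finset.mul_sum]
  have e2 : ∑ k, cs n α β k ^ 2 * vs x k ^ 2 = α * ((1 / 2) * nq x ^ 2) + β * nq x := by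
    rw [Fintype.sum_sum_type, ← vm_sq]
    simp [cs, vs, nq, Finset.mul_sum, Real.sq_sqrt hα, Real.sq_sqrt hβ]
  rw [e1, e2]; ring

theorem lpm_meas {n : ℕ} : Measurable (fun p : (KK n → ℝ) × (Fin n → ℝ) => lpm p.1 p.2) := by
  unfold lpm
  have : ∀ q, Measurable (fun p : (KK n → ℝ) × (Fin n → ℝ) => vm p.2 q) :=
    fun q => (vm_meas q).comp measurable_snd
  fun_prop

theorem ham_meas2 {n : ℕ} (γ α : ℝ) :
    Measurable (fun p : (KK n → ℝ) × (Fin n → ℝ) => ham γ α p.1 p.2) := by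
  unfold ham
  have h1 := lpm_meas (n := n)
  have h2 : Measurable (fun p : (KK n → ℝ) × (Fin n → ℝ) => nq p.2) := nq_meas.comp measurable_snd
  fun_prop

theorem ham_meas {n : ℕ} (γ α : ℝ) (y : KK n → ℝ) : Measurable (ham γ α y) :=
  Measurable.of_uncurry_left (f := ham γ α) (ham_meas2 γ α)

theorem ZL_meas {n : ℕ} (γ α : ℝ) : Measurable (fun y : KK n → ℝ => ZL γ α y) :=
  (ham_meas2 γ α).exp.stronglyMeasurable.integral_prod_right.measurable

theorem lpm_le {n : ℕ} {α : ℝ} (hα : 0 ≤ α) (y : KK n → ℝ) (x : Fin n → ℝ) :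
    √α * lpm y x ≤ ysq y + α * nq x ^ 2 / 8 := by
  have h : √α * lpm y x ≤ ∑ p : Fin n × Fin n, (y (Sum.inl p) ^ 2 + α / 4 * vm x p ^ 2) := by
    rw [lpm, Finset.mul_sum]
    refine Finset.sum_le_sum fun p _ => ?_
    have := Real.mul_self_sqrt hα
    nlinarith [sq_nonneg (y (Sum.inl p) - √α / 2 * vm x p)]
  rw [Finset.sum_add_distrib, ← Finset.mul_sum, vm_sq] at h
  have h2 : ∑ p : Fin n × Fin n, y (Sum.inl p) ^ 2 ≤ ysq y := by
    rw [ysq, Fintype.sum_sum_type]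
    have : 0 ≤ ∑ i, y (Sum.inr i) ^ 2 := Finset.sum_nonneg fun i _ => sq_nonneg _
    linarith
  linarith

theorem ham_le {n : ℕ} {α : ℝ} (hα : 0 < α) (γ : ℝ) (y : KK n → ℝ) (x : Fin n → ℝ) :
    ham γ α y x ≤ (ysq y + (1 - γ) ^ 2 / (2 * α)) + (-1 * nq x / 2 + ∑ i, (0:ℝ) * x i) := by
  have h := lpm_le hα.le y x
  unfold ham
  have h2 : (1 - γ) / 2 * nq x - α * nq x ^ 2 / 8 ≤ (1 - γ) ^ 2 / (2 * α) := by
    rw [le_div_iff₀ (by positivity)]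
    nlinarith [sq_nonneg ((1 - γ) - α * nq x / 2)]
  simp only [zero_mul, Finset.sum_const_zero]
  linarith

theorem exp_ham_int {n : ℕ} {α : ℝ} (hα : 0 < α) (γ : ℝ) (y : KK n → ℝ) :
    Integrable (fun x : Fin n → ℝ => Real.exp (ham γ α y x)) := by
  refine (((gaussian_nd n 1 (fun _ => 0) one_pos).1).const_mul
    (Real.exp (ysq y + (1 - γ) ^ 2 / (2 * α)))).mono'
    (ham_meas γ α y).exp.aestronglyMeasurable (ae_of_all _ fun x => ?_)
  rw [Real.norm_eq_abs, abs_of_pos (Real.exp_pos _), ← Real.exp_add]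
  exact Real.exp_le_exp.2 (ham_le hα γ y x)

theorem ZL_pos {n : ℕ} {α : ℝ} (hα : 0 < α) (γ : ℝ) (y : KK n → ℝ) : 0 < ZL γ α y :=
  integral_exp_pos (exp_ham_int hα γ y)

theorem log_ZL_le {n : ℕ} {α : ℝ} (hα : 0 < α) (γ : ℝ) (y : KK n → ℝ) :
    Real.log (ZL γ α y) ≤ ysq y + (1 - γ) ^ 2 / (2 * α) + (n:ℝ) / 2 * Real.log (2 * Real.pi) := by
  have hg := gaussian_nd n 1 (fun _ => 0) one_pos
  have h1 : ZL γ α y ≤ Real.exp (ysq y + (1 - γ) ^ 2 / (2 * α)) * (2 * Real.pi) ^ ((n:ℝ) / 2) := by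
    have e : (2 * Real.pi) ^ ((n:ℝ) / 2) =
        ∫ x : Fin n → ℝ, Real.exp (-1 * (∑ i, x i ^ 2) / 2 + ∑ i, (fun _ => (0:ℝ)) i * x i) := by
      rw [hg.2]; simp
    rw [e, ← integral_const_mul]
    refine integral_mono (exp_ham_int hα γ y) (hg.1.const_mul _) fun x => ?_
    dsimp only
    rw [← Real.exp_add]
    exact Real.exp_le_exp.2 (ham_le hα γ y x)
  refine (Real.log_le_log (ZL_pos hα γ y) h1).trans ?_
  rw [Real.log_mul (Real.exp_ne_zero _) (by positivity), Real.log_exp, Real.log_rpow (by positivity)]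

theorem ZL_anti {n : ℕ} {α : ℝ} (hα : 0 < α) {γ γ' : ℝ} (h : γ ≤ γ') (y : KK n → ℝ) :
    ZL γ' α y ≤ ZL γ α y := by
  refine integral_mono (exp_ham_int hα γ' y) (exp_ham_int hα γ y) fun x => Real.exp_le_exp.2 ?_
  unfold ham
  nlinarith [nq_nonneg x, mul_le_mul_of_nonneg_right h (nq_nonneg x)]

/-- Partition function with Gaussian prior in Lebesgue form. -/
theorem Zp_prior {n : ℕ} {α β v : ℝ} (hα : 0 ≤ α) (hβ : 0 ≤ β) (hv : 0 < v) (y : KK n → ℝ) :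
    ∫ x : Fin n → ℝ, Real.exp (ham (1 / v) α y x + (√β * dt (yr y) x - β * nq x / 2)) =
      (2 * Real.pi * v) ^ ((n:ℝ) / 2) * (Real.exp ((1 / 2) * ysq y) *
        Zp (gaussPrior n v) vs (cs n α β) y) := by
  rw [integral_volume_eq_prior n v hv, Zp, ← integral_const_mul (Real.exp _)]
  congr 2
  ext x
  rw [neg_En hα hβ, ← Real.exp_add, ← Real.exp_add]
  congr 1
  unfold ham nq
  field_simp
  ring

theorem Zp_ZL {n : ℕ} {α v : ℝ} (hα : 0 < α) (hv : 0 < v) (y : KK n → ℝ) :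
    Real.log (ZL (1 / v) α y) = (n:ℝ) / 2 * Real.log (2 * Real.pi * v) + (1 / 2) * ysq y +
      Real.log (Zp (gaussPrior n v) vs (cs n α 0) y) := by
  have h := Zp_prior (n := n) hα.le le_rfl hv y
  simp only [Real.sqrt_zero, zero_mul, zero_div, sub_zero, add_zero] at h
  rw [ZL, h, Real.log_mul (by positivity) (mul_pos (Real.exp_pos _) (Zp_pos vs_meas _ _)).ne',
    Real.log_mul (Real.exp_ne_zero _) (Zp_pos vs_meas _ _).ne', Real.log_exp,
    Real.log_rpow (by positivity)]
  ring

theorem cs_nonneg (n : ℕ) (α β : ℝ) : ∀ k, 0 ≤ cs n α β k := by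
  rintro (k | k) <;> exact Real.sqrt_nonneg _

section exps
variable {n : ℕ} {S : Type*} [MeasurableSpace S] {μ : Measure S} [IsProbabilityMeasure μ]
  {w : S → KK n → ℝ}

theorem ysq_int (hw : L2 μ w) (c : KK n → ℝ) :
    Integrable (fun q : S × (KK n → ℝ) => ysq (Yv c (w q.1) q.2)) (μ.prod (GG (KK n))) := by
  unfold ysq
  refine integrable_finsetSum _ fun k _ => ?_
  unfold Yv
  exact ((g_memLp k).add ((w_memLp hw k).const_mul _)).integrable_sq

theorem integral_ysq (hw : L2 μ w) (c : KK n → ℝ) :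
    ∫ q : S × (KK n → ℝ), ysq (Yv c (w q.1) q.2) ∂(μ.prod (GG (KK n))) =
      ((n:ℝ) ^ 2 + n) + ∑ k, c k ^ 2 * ∫ s, w s k ^ 2 ∂μ := by
  unfold ysq
  rw [integral_finsetSum _ (fun k _ => by
    unfold Yv
    exact ((g_memLp k).add ((w_memLp hw k).const_mul _)).integrable_sq)]
  have : ∀ k, ∫ q : S × (KK n → ℝ), Yv c (w q.1) q.2 k ^ 2 ∂(μ.prod (GG (KK n))) =
      1 + c k ^ 2 * ∫ s, w s k ^ 2 ∂μ := by
    intro k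
    have i1 : Integrable (fun q : S × (KK n → ℝ) => q.2 k ^ 2) (μ.prod (GG (KK n))) :=
      (g_memLp (μ := μ) k).integrable_sq
    have i2 : Integrable (fun q : S × (KK n → ℝ) => w q.1 k ^ 2) (μ.prod (GG (KK n))) :=
      (w_memLp hw k).integrable_sq
    have i3 : Integrable (fun q : S × (KK n → ℝ) => w q.1 k * q.2 k) (μ.prod (GG (KK n))) :=
      (hw.int k).mul_prod ((GG_memLp k 1 (by simp)).integrable le_rfl)
    have h3 : ∫ q : S × (KK n → ℝ), w q.1 k * q.2 k ∂(μ.prod (GG (KK n))) = 0 := by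
      rw [integral_prod_mul (fun s => w s k) (fun g : KK n → ℝ => g k), GG_mean, mul_zero]
    have l := (lin3 i1 i2 i3 1 (c k ^ 2) (2 * c k) 0).2
    have e : (fun q : S × (KK n → ℝ) => Yv c (w q.1) q.2 k ^ 2) = fun q => 1 * q.2 k ^ 2 +
        c k ^ 2 * w q.1 k ^ 2 + 2 * c k * (w q.1 k * q.2 k) + 0 := by
      ext q; unfold Yv; ring
    rw [e, l, h3, integral_prod _ i1, integral_prod _ i2]
    have := GG_cov k k
    simp [← sq] at this
    simp [this]
  simp_rw [this]
  rw [Finset.sum_add_distrib]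
  simp [sq]

theorem logZL_int (hw : L2 μ w) (c : KK n → ℝ) (hc : ∀ k, 0 ≤ c k) {α : ℝ} (hα : 0 < α) (γ : ℝ)
    (hcα : ∀ p, c (Sum.inl p) = √α) (hcr : ∀ i, c (Sum.inr i) = 0) :
    Integrable (fun q : S × (KK n → ℝ) => Real.log (ZL γ α (Yv c (w q.1) q.2))) (μ.prod (GG (KK n))) := by
  have hce : c = cs n α 0 := by
    ext k; rcases k with k | k
    · simp [cs, hcα]
    · simp [cs, hcr]
  have hY := Yv_meas hw.meas c
  have hm : Measurable (fun q : S × (KK n → ℝ) => Real.log (ZL γ α (Yv c (w q.1) q.2))) :=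
    ((ZL_meas γ α).comp hY).log
  have iy := ysq_int hw c
  have ilog := logZp_int (vs_L2 n 1) hw hc
  set G := max γ 1 with hG
  have hG0 : 0 < G := lt_of_lt_of_le one_pos (le_max_right _ _)
  have hv0 : 0 < 1 / G := by positivity
  have il2 := logZp_int (vs_L2 n (1 / G)) hw hc
  have ib1 : Integrable (fun q : S × (KK n → ℝ) => 1 * ysq (Yv c (w q.1) q.2) + 0 * ysq (Yv c (w q.1) q.2) +
      ((1 - γ) ^ 2 / (2 * α) + (n:ℝ) / 2 * Real.log (2 * Real.pi))) (μ.prod (GG (KK n))) :=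
    (lin2 iy iy 1 0 _).1
  have ib2 := (lin2 iy il2 (1 / 2) 1 ((n:ℝ) / 2 * Real.log (2 * Real.pi * (1 / G)))).1
  refine (ib1.norm.add ib2.norm).mono' hm.aestronglyMeasurable (ae_of_all _ fun q => ?_)
  simp only [Pi.add_apply]
  have hu := log_ZL_le hα γ (Yv c (w q.1) q.2)
  have hl1 := Zp_ZL hα hv0 (Yv c (w q.1) q.2)
  rw [one_div_one_div, ← hce] at hl1
  have hl2 := Real.log_le_log (ZL_pos hα _ _) (ZL_anti hα (le_max_left γ 1) (Yv c (w q.1) q.2))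
  rw [← hG] at hl2
  rw [Real.norm_eq_abs, abs_le]
  constructor
  · have h1 := neg_abs_le (1 / 2 * ysq (Yv c (w q.1) q.2) + 1 * Real.log (Zp (gaussPrior n (1 / G)) vs c (Yv c (w q.1) q.2)) +
      (n:ℝ) / 2 * Real.log (2 * Real.pi * (1 / G)))
    have h2 := norm_nonneg (1 * ysq (Yv c (w q.1) q.2) + 0 * ysq (Yv c (w q.1) q.2) +
      ((1 - γ) ^ 2 / (2 * α) + (n:ℝ) / 2 * Real.log (2 * Real.pi)))
    rw [← Real.norm_eq_abs] at h1
    linarith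
  · have h1 := le_abs_self (1 * ysq (Yv c (w q.1) q.2) + 0 * ysq (Yv c (w q.1) q.2) +
      ((1 - γ) ^ 2 / (2 * α) + (n:ℝ) / 2 * Real.log (2 * Real.pi)))
    have h2 := norm_nonneg (1 / 2 * ysq (Yv c (w q.1) q.2) + 1 * Real.log (Zp (gaussPrior n (1 / G)) vs c (Yv c (w q.1) q.2)) +
      (n:ℝ) / 2 * Real.log (2 * Real.pi * (1 / G)))
    rw [← Real.norm_eq_abs] at h1
    linarith

end exps

/-- normalised free energy in Lebesgue form -/
def XX (n : ℕ) (sig γ lam : ℝ) : ℝ := (1 / (n:ℝ)) *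
  ∫ q, Real.log (ZL γ (lam / n) (Yv (cs n (lam / n) 0) (vs q.1) q.2))
    ∂((gaussPrior n (sig ^ 2)).prod (GG (KK n)))

/-- second moment of the normalised squared norm -/
def Sn (n : ℕ) (sig : ℝ) : ℝ := ∫ s, (nq s / n) ^ 2 ∂(gaussPrior n (sig ^ 2))

theorem sum_vm_sq_int (n : ℕ) (sig : ℝ) : ∑ p : Fin n × Fin n,
    ∫ s, vs s (Sum.inl p) ^ 2 ∂(gaussPrior n (sig ^ 2)) = (1 / 2) * (n:ℝ) ^ 2 * Sn n sig := by
  rw [← integral_finsetSum _ (fun p _ => (vs_L2 n (sig ^ 2)).sq (Sum.inl p)), Sn,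
    ← integral_const_mul]
  congr 1
  ext s
  simp only [vs, Sum.elim_inl]
  rw [vm_sq]
  rcases Nat.eq_zero_or_pos n with h | h
  · subst h; simp [nq]
  · have : (n:ℝ) ≠ 0 := by positivity
    field_simp

theorem Phi_XX {n : ℕ} (hn : 0 < n) (sig : ℝ) {sig' lam : ℝ} (hs : 0 < sig') (hl : 0 < lam) :
    Phi n sig sig' lam = XX n sig (1 / sig' ^ 2) lam - (1 / 2) * Real.log (2 * Real.pi * sig' ^ 2)
      - ((n:ℝ) + 1) / 2 - lam * Sn n sig / 4 := by
  have hn' : (0:ℝ) < n := by exact_mod_cast hn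
  have hα : 0 < lam / n := by positivity
  have hv : 0 < sig' ^ 2 := by positivity
  have hw := vs_L2 n (sig ^ 2)
  unfold XX Phi FF
  simp_rw [Zp_ZL hα hv]
  have iy := ysq_int hw (cs n (lam / n) 0)
  have il := logZp_int (vs_L2 n (sig' ^ 2)) hw (cs_nonneg n (lam / n) 0)
  have l := (lin2 iy il (1 / 2) 1 ((n:ℝ) / 2 * Real.log (2 * Real.pi * sig' ^ 2))).2
  have e : (fun q : (Fin n → ℝ) × (KK n → ℝ) => (n:ℝ) / 2 * Real.log (2 * Real.pi * sig' ^ 2) +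
      1 / 2 * ysq (Yv (cs n (lam / n) 0) (vs q.1) q.2) +
      Real.log (Zp (gaussPrior n (sig' ^ 2)) vs (cs n (lam / n) 0) (Yv (cs n (lam / n) 0) (vs q.1) q.2)))
      = fun q => 1 / 2 * ysq (Yv (cs n (lam / n) 0) (vs q.1) q.2) + 1 * Real.log (Zp (gaussPrior n (sig' ^ 2)) vs
        (cs n (lam / n) 0) (Yv (cs n (lam / n) 0) (vs q.1) q.2)) +
        (n:ℝ) / 2 * Real.log (2 * Real.pi * sig' ^ 2) := by ext q; ring
  rw [e, l, integral_ysq hw, Fintype.sum_sum_type]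
  have e2 : ∑ p : Fin n × Fin n, cs n (lam / n) 0 (Sum.inl p) ^ 2 *
      ∫ s, vs s (Sum.inl p) ^ 2 ∂(gaussPrior n (sig ^ 2)) = lam / n * ((1 / 2) * (n:ℝ) ^ 2 * Sn n sig) := by
    simp only [cs, Sum.elim_inl, Real.sq_sqrt hα.le]
    rw [← Finset.mul_sum, sum_vm_sq_int]
  rw [e2]
  simp only [cs, Sum.elim_inr, Real.sqrt_zero]
  simp
  field_simp
  ring

end

set_option linter.all false
set_option linter.deprecated false
noncomputable section

/-! ### Gaussian integral with a rank one spike -/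

theorem dt_comm {n : ℕ} (x y : Fin n → ℝ) : dt x y = dt y x := by
  unfold dt; simp_rw [mul_comm]

theorem lint_of_int {Ω : Type*} [MeasurableSpace Ω] {μ : Measure Ω} {f : Ω → ℝ}
    (hi : Integrable (fun x => Real.exp (f x)) μ) :
    ∫⁻ x, ENNReal.ofReal (Real.exp (f x)) ∂μ = ENNReal.ofReal (∫ x, Real.exp (f x) ∂μ) :=
  (ofReal_integral_eq_lintegral_ofReal hi (ae_of_all _ fun x => (Real.exp_pos _).le)).symm

theorem gauss_spike {n : ℕ} {a α : ℝ} (ha : 0 < a) (hα : 0 ≤ α) (s b : Fin n → ℝ)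
    (hκ : α * nq s / a < 1) :
    Integrable (fun x : Fin n → ℝ => Real.exp (-a * nq x / 2 + α / 2 * dt s x ^ 2 + dt b x)) ∧
    ∫ x : Fin n → ℝ, Real.exp (-a * nq x / 2 + α / 2 * dt s x ^ 2 + dt b x) =
      (2 * Real.pi / a) ^ ((n:ℝ) / 2) * Real.exp (nq b / (2 * a)) *
      (√(1 / (1 - α * nq s / a)) *
        Real.exp (α * dt b s ^ 2 / (2 * a ^ 2 * (1 - α * nq s / a)))) := by
  set κ := α * nq s / a with hκd
  have hm : Measurable (fun x : Fin n → ℝ => -a * nq x / 2 + α / 2 * dt s x ^ 2 + dt b x) := by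
    unfold nq dt; fun_prop
  have h1k : 0 < 1 - κ := by linarith
  have hpi : 0 < √(2 * Real.pi) := by positivity
  have hsα := Real.sq_sqrt hα
  set R : ℝ := (2 * Real.pi / a) ^ ((n:ℝ) / 2) * Real.exp (nq b / (2 * a)) *
      (√(2 * Real.pi / (1 - κ)) * Real.exp ((√α * dt b s / a) ^ 2 / (2 * (1 - κ)))) with hR
  -- the joint integral
  have step1 : ∀ x : Fin n → ℝ, ENNReal.ofReal (√(2 * Real.pi)) *
      ENNReal.ofReal (Real.exp (-a * nq x / 2 + α / 2 * dt s x ^ 2 + dt b x)) =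
      ∫⁻ z : ℝ, ENNReal.ofReal (Real.exp ((-a * nq x / 2 + dt b x) +
        (-1 * z ^ 2 / 2 + √α * dt s x * z))) := by
    intro x
    have hg := gaussian_1d 1 (√α * dt s x) one_pos
    have e : ∀ z : ℝ, ENNReal.ofReal (Real.exp ((-a * nq x / 2 + dt b x) +
        (-1 * z ^ 2 / 2 + √α * dt s x * z))) = ENNReal.ofReal (Real.exp (-a * nq x / 2 + dt b x)) *
        ENNReal.ofReal (Real.exp (-1 * z ^ 2 / 2 + √α * dt s x * z)) := by
      intro z
      rw [Real.exp_add, ENNReal.ofReal_mul (Real.exp_pos _).le]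
    simp_rw [e]
    rw [lintegral_const_mul _ (by fun_prop), lint_of_int hg.1, hg.2,
      ← ENNReal.ofReal_mul (by positivity), ← ENNReal.ofReal_mul (by positivity)]
    congr 1
    rw [mul_left_comm, ← Real.exp_add]
    simp only [div_one, mul_one]
    congr 2
    rw [mul_pow, hsα]; ring
  have step2 : ∀ z : ℝ, ∫⁻ x : Fin n → ℝ, ENNReal.ofReal (Real.exp ((-a * nq x / 2 + dt b x) +
        (-1 * z ^ 2 / 2 + √α * dt s x * z))) =
      ENNReal.ofReal ((2 * Real.pi / a) ^ ((n:ℝ) / 2) * Real.exp (nq b / (2 * a))) *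
      ENNReal.ofReal (Real.exp (-(1 - κ) * z ^ 2 / 2 + (√α * dt b s / a) * z)) := by
    intro z
    have hg := gaussian_nd n a (fun i => b i + √α * z * s i) ha
    have e : ∀ x : Fin n → ℝ, ENNReal.ofReal (Real.exp ((-a * nq x / 2 + dt b x) +
        (-1 * z ^ 2 / 2 + √α * dt s x * z))) = ENNReal.ofReal (Real.exp (-1 * z ^ 2 / 2)) *
        ENNReal.ofReal (Real.exp (-a * (∑ i, x i ^ 2) / 2 + ∑ i, (b i + √α * z * s i) * x i)) := by
      intro x
      rw [← ENNReal.ofReal_mul (Real.exp_pos _).le, ← Real.exp_add]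
      have : ∑ i, (b i + √α * z * s i) * x i = dt b x + √α * z * dt s x := by
        unfold dt
        rw [Finset.mul_sum, ← Finset.sum_add_distrib]
        refine Finset.sum_congr rfl fun i _ => ?_
        ring
      rw [this]; unfold nq
      congr 2; ring
    simp_rw [e]
    rw [lintegral_const_mul _ (by fun_prop), lint_of_int hg.1, hg.2,
      ← ENNReal.ofReal_mul (by positivity), ← ENNReal.ofReal_mul (by positivity)]
    congr 1
    rw [mul_left_comm, mul_assoc, ← Real.exp_add, ← Real.exp_add]
    congr 2
    have : ∑ i, (b i + √α * z * s i) ^ 2 = nq b + 2 * √α * z * dt b s + α * z ^ 2 * nq s := by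
      unfold nq dt
      rw [Finset.mul_sum, Finset.mul_sum, ← Finset.sum_add_distrib, ← Finset.sum_add_distrib]
      refine Finset.sum_congr rfl fun i _ => ?_
      linear_combination (z ^ 2 * s i ^ 2) * hsα
    rw [this, hκd]
    field_simp
    ring
  have hmm : Measurable (fun p : (Fin n → ℝ) × ℝ => ENNReal.ofReal (Real.exp ((-a * nq p.1 / 2 + dt b p.1) +
        (-1 * p.2 ^ 2 / 2 + √α * dt s p.1 * p.2)))) := by
    unfold nq dt; fun_prop
  have hg1 := gaussian_1d (1 - κ) (√α * dt b s / a) h1k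
  have step3 : ENNReal.ofReal (√(2 * Real.pi)) * ∫⁻ x : Fin n → ℝ,
      ENNReal.ofReal (Real.exp (-a * nq x / 2 + α / 2 * dt s x ^ 2 + dt b x)) = ENNReal.ofReal R := by
    rw [← lintegral_const_mul _ (hm.exp.ennreal_ofReal)]
    simp_rw [step1]
    rw [lintegral_lintegral_swap hmm.aemeasurable]
    simp_rw [step2]
    rw [lintegral_const_mul _ (by fun_prop), lint_of_int hg1.1, hg1.2,
      ← ENNReal.ofReal_mul (by positivity)]
  have hR0 : 0 ≤ R := by positivity
  have step4 : ∫⁻ x : Fin n → ℝ,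
      ENNReal.ofReal (Real.exp (-a * nq x / 2 + α / 2 * dt s x ^ 2 + dt b x)) =
      ENNReal.ofReal (R / √(2 * Real.pi)) := by
    have h0 : ENNReal.ofReal (√(2 * Real.pi)) ≠ 0 := by simpa using Real.pi_pos
    have e : ENNReal.ofReal R = ENNReal.ofReal (√(2 * Real.pi)) * ENNReal.ofReal (R / √(2 * Real.pi)) := by
      rw [← ENNReal.ofReal_mul hpi.le]
      congr 1; field_simp
    rw [e] at step3
    exact (ENNReal.mul_right_inj h0 ENNReal.ofReal_ne_top).1 step3
  have hIntg : Integrable (fun x : Fin n → ℝ => Real.exp (-a * nq x / 2 + α / 2 * dt s x ^ 2 + dt b x)) := by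
    refine ⟨hm.exp.aestronglyMeasurable, ?_⟩
    rw [hasFiniteIntegral_iff_ofReal (ae_of_all _ fun x => (Real.exp_pos _).le), step4]
    exact ENNReal.ofReal_lt_top
  refine ⟨hIntg, ?_⟩
  rw [lint_of_int hIntg] at step4
  have h5 := (ENNReal.ofReal_eq_ofReal_iff (integral_nonneg fun x => (Real.exp_pos _).le)
    (by positivity)).1 step4
  rw [h5, hR]
  have e6 : √(2 * Real.pi / (1 - κ)) = √(2 * Real.pi) * √(1 / (1 - κ)) := by
    rw [← Real.sqrt_mul (by positivity)]; congr 1; ring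
  have e7 : (√α * dt b s / a) ^ 2 / (2 * (1 - κ)) = α * dt b s ^ 2 / (2 * a ^ 2 * (1 - κ)) := by
    rw [div_pow, mul_pow, hsα]; field_simp
  rw [e6, e7]
  field_simp

/-! ### Guerra-type interpolation upper bound -/

theorem sum_A_ge {n : ℕ} {ν : Measure (Fin n → ℝ)} [IsProbabilityMeasure ν] (hν : L2 ν vs)
    (c y : KK n → ℝ) :
    (1 / 2) * (∑ i, (∫ x, vs x (Sum.inr i) ∂(post ν vs c y)) ^ 2) ^ 2 ≤
      ∑ p, (∫ x, vs x (Sum.inl p) ∂(post ν vs c y)) ^ 2 := by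
  have hP := post_prob (ν := ν) hν.meas c y
  set m : Fin n → ℝ := fun i => ∫ x, vs x (Sum.inr i) ∂(post ν vs c y) with hm
  set A : Fin n × Fin n → ℝ := fun p => ∫ x, vs x (Sum.inl p) ∂(post ν vs c y) with hA
  have hmi : ∀ i, Integrable (fun x : Fin n → ℝ => x i) ν := fun i => hν.int (Sum.inr i)
  have hAi : ∀ p, Integrable (fun x : Fin n → ℝ => vm x p) ν := fun p => hν.int (Sum.inl p)
  have hd : Integrable (fun x => dt x m) ν := by
    unfold dt; exact integrable_finsetSum _ fun i _ => (hmi i).mul_const _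
  have hd2e : (fun x => dt x m ^ 2) = fun x => ∑ p, (2 * vm m p) * vm x p := by
    ext x
    have := vm_mul x m
    simp_rw [mul_assoc, ← Finset.mul_sum, mul_comm (vm m _)]
    linarith
  have hd2 : Integrable (fun x => dt x m ^ 2) ν := by
    rw [hd2e]; exact integrable_finsetSum _ fun p _ => (hAi p).const_mul _
  have j := post_mean_sq_le hν c y hd hd2
  have e1 : ∫ x, dt x m ∂(post ν vs c y) = ∑ i, m i ^ 2 := by
    unfold dt
    rw [integral_finsetSum _ (fun i _ => (post_int hν.meas c y (hmi i)).mul_const _)]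
    refine Finset.sum_congr rfl fun i _ => ?_
    rw [integral_mul_const, sq]; rfl
  have e2 : ∫ x, dt x m ^ 2 ∂(post ν vs c y) = 2 * ∑ p, A p * vm m p := by
    rw [hd2e, integral_finsetSum _ (fun p _ => (post_int hν.meas c y (hAi p)).const_mul _),
      Finset.mul_sum]
    refine Finset.sum_congr rfl fun p _ => ?_
    rw [integral_const_mul]
    simp only [hA, vs, Sum.elim_inl]; ring
  rw [e1, e2] at j
  have h3 : 0 ≤ ∑ p, (A p - vm m p) ^ 2 := Finset.sum_nonneg fun p _ => sq_nonneg _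
  have e3 : ∑ p, (A p - vm m p) ^ 2 = ∑ p, A p ^ 2 - 2 * ∑ p, A p * vm m p + ∑ p, vm m p ^ 2 := by
    rw [Finset.mul_sum, ← Finset.sum_sub_distrib, ← Finset.sum_add_distrib]
    refine Finset.sum_congr rfl fun p _ => ?_
    ring
  rw [vm_sq] at e3
  have e4 : nq m = ∑ i, m i ^ 2 := rfl
  rw [e4] at e3
  linarith

theorem interp_ub {n : ℕ} {ν : Measure (Fin n → ℝ)} [IsProbabilityMeasure ν] (hν : L2 ν vs)
    {α Q : ℝ} (hα : 0 < α) (hQ : 0 < Q) :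
    FF (Measure.dirac ()) ν (fun _ => 0) vs (cs n α 0) ≤
      FF (Measure.dirac ()) ν (fun _ => 0) vs (cs n 0 Q) + Q ^ 2 / (4 * α) := by
  have hw : L2 (Measure.dirac ()) (fun _ : Unit => (0 : KK n → ℝ)) :=
    ⟨measurable_const, fun k => by simp⟩
  set f : ℝ → ℝ := fun t => FF (Measure.dirac ()) ν (fun _ => 0) vs (cs n (0 + α * t) (Q + -Q * t)) with hf
  have hd : ∀ t ∈ Set.Ioo (0:ℝ) 1, ∃ D, HasDerivAt f D t ∧ D ≤ Q ^ 2 / (4 * α) := by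
    intro t ht
    have hp1 : 0 < 0 + α * t := by nlinarith [ht.1, mul_pos hα ht.1]
    have hp2 : 0 < Q + -Q * t := by nlinarith [mul_pos hQ (sub_pos.2 ht.2)]
    refine ⟨_, FF_cs_deriv hν hw 0 α Q (-Q) t (Or.inl hp1) (Or.inl hp2), ?_⟩
    set c := cs n (0 + α * t) (Q + -Q * t) with hc
    have hcp : ∀ k, 0 < c k := by
      rintro (k | k)
      · exact Real.sqrt_pos.2 hp1
      · exact Real.sqrt_pos.2 hp2
    have hi : ∀ k, Integrable (fun q => ((0 : KK n → ℝ) k - Ak ν vs (fun _ : Unit => (0 : KK n → ℝ)) c k q) ^ 2)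
        ((Measure.dirac ()).prod (GG (KK n))) := by
      intro k
      have := (Ak_memLp hν hw (fun k => (hcp k).le) k (hcp k)).integrable_sq
      simpa using this
    rw [← integral_finsetSum _ (fun p _ => hi (Sum.inl p)), ← integral_finsetSum _ (fun p _ => hi (Sum.inr p)),
      ← integral_const_mul, ← integral_const_mul, ← integral_add, ← integral_neg]
    · have : ∀ q : Unit × (KK n → ℝ), -(α / 2 * ∑ p, ((0 : KK n → ℝ) (Sum.inl p) - Ak ν vs (fun _ : Unit => (0 : KK n → ℝ)) c (Sum.inl p) q) ^ 2 +
          -Q / 2 * ∑ i, ((0 : KK n → ℝ) (Sum.inr i) - Ak ν vs (fun _ : Unit => (0 : KK n → ℝ)) c (Sum.inr i) q) ^ 2) ≤ Q ^ 2 / (4 * α) := by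
        intro q
        have h := sum_A_ge hν c (Yv c (0 : KK n → ℝ) q.2)
        simp only [Pi.zero_apply, zero_sub, neg_sq]
        change (1 / 2) * (∑ i, (Ak ν vs (fun _ : Unit => (0 : KK n → ℝ)) c (Sum.inr i) q) ^ 2) ^ 2 ≤
          ∑ p, (Ak ν vs (fun _ : Unit => (0 : KK n → ℝ)) c (Sum.inl p) q) ^ 2 at h
        set u := ∑ i, (Ak ν vs (fun _ : Unit => (0 : KK n → ℝ)) c (Sum.inr i) q) ^ 2
        set U := ∑ p, (Ak ν vs (fun _ : Unit => (0 : KK n → ℝ)) c (Sum.inl p) q) ^ 2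
        rw [le_div_iff₀ (by positivity)]
        nlinarith [sq_nonneg (α * u - Q), mul_le_mul_of_nonneg_left h (sq_nonneg α)]
      refine (integral_mono ?_ (integrable_const (Q ^ 2 / (4 * α))) this).trans_eq (by simp)
      exact (((integrable_finsetSum _ fun p _ => hi (Sum.inl p)).const_mul _).add
        ((integrable_finsetSum _ fun p _ => hi (Sum.inr p)).const_mul _)).neg
    · exact (integrable_finsetSum _ fun p _ => hi (Sum.inl p)).const_mul _
    · exact (integrable_finsetSum _ fun p _ => hi (Sum.inr p)).const_mul _
  have hcont : ContinuousOn f (Set.Icc 0 1) := by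
    refine FF_cont hν hw (c := fun t => cs n (0 + α * t) (Q + -Q * t)) (fun k => ?_) (fun t ht => cs_nonneg n _ _)
    rcases k with k | k <;> simp only [cs, Sum.elim_inl, Sum.elim_inr] <;> fun_prop
  obtain ⟨t, ht, hte⟩ := exists_deriv_eq_slope f (zero_lt_one) hcont (fun t ht =>
    (hd t ht).choose_spec.1.differentiableAt.differentiableWithinAt)
  obtain ⟨D, hD, hDle⟩ := hd t ht
  rw [hD.deriv] at hte
  have e1 : f 1 = FF (Measure.dirac ()) ν (fun _ => 0) vs (cs n α 0) := by
    simp [hf]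
  have e0 : f 0 = FF (Measure.dirac ()) ν (fun _ => 0) vs (cs n 0 Q) := by
    simp [hf]
  rw [← e1, ← e0]
  have : D = f 1 - f 0 := by rw [hte]; norm_num
  linarith

end

set_option linter.all false
set_option linter.deprecated false
noncomputable section

theorem vm_cont {n : ℕ} (p : Fin n × Fin n) : Continuous (fun x : Fin n → ℝ => vm x p) := by
  unfold vm
  split_ifs <;> fun_prop

theorem vs_cont {n : ℕ} (k : KK n) : Continuous (fun x : Fin n → ℝ => vs x k) := by
  rcases k with p | i
  · exact vm_cont p
  · exact continuous_apply i

theorem nq_cont {n : ℕ} : Continuous (nq : (Fin n → ℝ) → ℝ) := by unfold nq; fun_prop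
theorem dt_cont {n : ℕ} (s : Fin n → ℝ) : Continuous (fun x => dt s x) := by unfold dt; fun_prop

theorem dirac_int {κ : Type*} [Fintype κ] (f : (κ → ℝ) → ℝ) :
    ∫ q, f q.2 ∂((Measure.dirac ()).prod (GG κ)) = ∫ g, f g ∂(GG κ) := by
  rw [Measure.dirac_prod, (measurableEmbedding_prodMk_left ()).integral_map]

theorem dirac_integrable {κ : Type*} [Fintype κ] (f : (κ → ℝ) → ℝ) :
    Integrable (fun q => f q.2) ((Measure.dirac ()).prod (GG κ)) ↔ Integrable f (GG κ) := by
  rw [Measure.dirac_prod, (measurableEmbedding_prodMk_left ()).integrable_map_iff]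
  rfl

theorem L2_dirac {n : ℕ} (a : KK n → ℝ) : L2 (Measure.dirac ()) (fun _ : Unit => a) :=
    ⟨measurable_const, fun k => by simp⟩

theorem Yv_zero {κ : Type*} (c g : κ → ℝ) : Yv c 0 g = g := by
  ext k; simp [Yv]

theorem tilted_ub {n : ℕ} {B : Set (Fin n → ℝ)} (hB : IsCompact B) (hB0 : volume B ≠ 0)
    {h : (Fin n → ℝ) → ℝ} (hh : Continuous h) {α Q : ℝ} (hα : 0 < α) (hQ : 0 < Q) :
    Integrable (fun g => Real.log (∫ x in B, Real.exp (h x - En vs (cs n α 0) g x))) (GG (KK n)) ∧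
    Integrable (fun g => Real.log (∫ x in B, Real.exp (h x - En vs (cs n 0 Q) g x))) (GG (KK n)) ∧
    ∫ g, Real.log (∫ x in B, Real.exp (h x - En vs (cs n α 0) g x)) ∂(GG (KK n)) ≤
    ∫ g, Real.log (∫ x in B, Real.exp (h x - En vs (cs n 0 Q) g x)) ∂(GG (KK n)) + Q ^ 2 / (4 * α) := by
  have hfin : IsFiniteMeasure (volume.restrict B) := ⟨by simpa using hB.measure_lt_top⟩
  have hne : NeZero (volume.restrict B) := ⟨by simpa using hB0⟩
  have hei : Integrable (fun x => Real.exp (h x)) (volume.restrict B) :=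
    (hh.rexp.continuousOn).integrableOn_compact hB
  set ν := (volume.restrict B).tilted h with hν
  have hP : IsProbabilityMeasure ν := isProbabilityMeasure_tilted hei
  have hL : L2 ν (vs : (Fin n → ℝ) → KK n → ℝ) := by
    refine ⟨vs_meas, fun k => ?_⟩
    rw [hν, integrable_tilted_iff hei]
    have : Continuous (fun x : Fin n → ℝ => Real.exp (h x) • vs x k ^ 2) := by
      have := vs_cont k
      fun_prop
    exact this.continuousOn.integrableOn_compact hB
  set C := ∫ x in B, Real.exp (h x) with hC
  have hCp : 0 < C := integral_exp_pos hei
  have hpos : ∀ c g, 0 < ∫ x in B, Real.exp (h x - En vs c g x) := by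
    intro c g
    refine integral_exp_pos ?_
    have : Continuous (fun x : Fin n → ℝ => Real.exp (h x - En vs c g x)) := by
      have := fun k => vs_cont (n := n) k
      unfold En
      fun_prop
    exact this.continuousOn.integrableOn_compact hB
  have key : ∀ c g, Real.log (∫ x in B, Real.exp (h x - En vs c g x)) =
      Real.log (Zp ν vs c g) + Real.log C := by
    intro c g
    have : Zp ν vs c g = (∫ x in B, Real.exp (h x - En vs c g x)) / C := by
      rw [Zp, hν, integral_tilted, ← integral_div]
      congr 1; ext x
      rw [smul_eq_mul, sub_eq_add_neg, Real.exp_add]; ring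
    rw [this, Real.log_div (hpos c g).ne' hCp.ne']; ring
  have hw := L2_dirac (n := n) 0
  have hi : ∀ α β, Integrable (fun g => Real.log (Zp ν vs (cs n α β) g)) (GG (KK n)) := by
    intro α β
    rw [← dirac_integrable]
    have := logZp_int hL hw (cs_nonneg n α β)
    simpa only [Yv_zero] using this
  have hF : ∀ α β, FF (Measure.dirac ()) ν (fun _ => 0) vs (cs n α β) =
      ∫ g, Real.log (Zp ν vs (cs n α β) g) ∂(GG (KK n)) := by
    intro α β
    rw [← dirac_int]
    unfold FF
    simp only [Yv_zero]
  simp only [key]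
  refine ⟨(hi _ _).add (integrable_const _), (hi _ _).add (integrable_const _), ?_⟩
  rw [integral_add (hi _ _) (integrable_const _), integral_add (hi _ _) (integrable_const _), ← hF, ← hF]
  have := interp_ub hL hα hQ
  linarith

theorem lpm_Yv {n : ℕ} {α : ℝ} (hα : 0 ≤ α) (β : ℝ) (s x : Fin n → ℝ) (g : KK n → ℝ) :
    √α * lpm (Yv (cs n α β) (vs s) g) x = √α * lpm g x + α / 2 * dt s x ^ 2 := by
  have h := vm_mul s x
  unfold lpm
  have e : ∀ p, Yv (cs n α β) (vs s) g (Sum.inl p) * vm x p = g (Sum.inl p) * vm x p + √α * (vm s p * vm x p) := by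
    intro p; simp [Yv, cs, vs]; ring
  simp_rw [e]
  rw [Finset.sum_add_distrib, ← Finset.mul_sum, h]
  have := Real.mul_self_sqrt hα
  linear_combination (dt s x ^ 2 / 2) * this

theorem nq_yr_int (n : ℕ) : Integrable (fun g : KK n → ℝ => nq (yr g)) (GG (KK n)) ∧
    ∫ g, nq (yr g) ∂(GG (KK n)) = n := by
  have h : ∀ i : Fin n, Integrable (fun g : KK n → ℝ => yr g i ^ 2) (GG (KK n)) := by
    intro i
    have := GG_sq (κ := KK n) (Sum.inr i) (Sum.inr i)
    simpa [yr, sq] using this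
  refine ⟨integrable_finsetSum _ fun i _ => h i, ?_⟩
  unfold nq
  rw [integral_finsetSum _ fun i _ => h i]
  have : ∀ i : Fin n, ∫ g : KK n → ℝ, yr g i ^ 2 ∂(GG (KK n)) = 1 := by
    intro i
    have := GG_cov (κ := KK n) (Sum.inr i) (Sum.inr i)
    simpa [yr, sq] using this
  simp [this]

theorem dt_yr_int {n : ℕ} (s : Fin n → ℝ) : Integrable (fun g : KK n → ℝ => dt (yr g) s ^ 2) (GG (KK n)) ∧
    ∫ g, dt (yr g) s ^ 2 ∂(GG (KK n)) = nq s := by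
  have e : ∀ g : KK n → ℝ, dt (yr g) s ^ 2 = ∑ i, ∑ j, (s i * s j) * (g (Sum.inr i) * g (Sum.inr j)) := by
    intro g
    rw [dt, sq, Finset.sum_mul_sum]
    refine Finset.sum_congr rfl fun i _ => Finset.sum_congr rfl fun j _ => ?_
    simp only [yr]; ring
  have h : ∀ i j : Fin n, Integrable (fun g : KK n → ℝ => (s i * s j) * (g (Sum.inr i) * g (Sum.inr j))) (GG (KK n)) :=
    fun i j => (GG_sq (κ := KK n) (Sum.inr i) (Sum.inr j)).const_mul _
  simp_rw [e]
  refine ⟨integrable_finsetSum _ fun i _ => integrable_finsetSum _ fun j _ => h i j, ?_⟩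
  rw [integral_finsetSum _ fun i _ => integrable_finsetSum _ fun j _ => h i j]
  unfold nq
  refine Finset.sum_congr rfl fun i _ => ?_
  rw [integral_finsetSum _ fun j _ => h i j]
  simp_rw [integral_const_mul, GG_cov]
  simp [sq]

theorem ysq_GG_int (n : ℕ) : Integrable (fun g : KK n → ℝ => ysq g) (GG (KK n)) := by
  unfold ysq
  refine integrable_finsetSum _ fun k _ => ?_
  have := GG_sq k k
  simpa [sq] using this

/-- upper bound for a fixed signal -/
theorem ub_fixed {n : ℕ} (s : Fin n → ℝ) {γ α Q : ℝ} (hα : 0 < α) (hQ : 0 < Q) (ha : 0 < γ + Q)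
    (hκ : α * nq s / (γ + Q) < 1) :
    Integrable (fun g => Real.log (ZL γ α (Yv (cs n α 0) (vs s) g))) (GG (KK n)) ∧
    ∫ g, Real.log (ZL γ α (Yv (cs n α 0) (vs s) g)) ∂(GG (KK n)) ≤
      Q ^ 2 / (4 * α) + (n:ℝ) / 2 * Real.log (2 * Real.pi / (γ + Q)) + n * Q / (2 * (γ + Q))
      - (1 / 2) * Real.log (1 - α * nq s / (γ + Q)) +
      Q * (α * nq s / (γ + Q)) / (2 * (γ + Q) * (1 - α * nq s / (γ + Q))) := by
  have hZi : Integrable (fun g => Real.log (ZL γ α (Yv (cs n α 0) (vs s) g))) (GG (KK n)) := by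
    rw [← dirac_integrable]
    exact logZL_int (L2_dirac (vs s)) (cs n α 0) (cs_nonneg _ _ _) hα γ (fun p => rfl) (fun i => by simp [cs])
  refine ⟨hZi, ?_⟩
  set a := γ + Q with had
  set κ := α * nq s / a with hκd
  set h : (Fin n → ℝ) → ℝ := fun x => -γ * nq x / 2 + α / 2 * dt s x ^ 2 with hhd
  have hhc : Continuous h := by
    have := nq_cont (n := n)
    have := dt_cont s
    fun_prop
  set B : ℕ → Set (Fin n → ℝ) := fun m => Metric.closedBall 0 ((m:ℝ) + 1) with hBd
  have hBc : ∀ m, IsCompact (B m) := fun m => isCompact_closedBall _ _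
  have hB0 : ∀ m, volume (B m) ≠ 0 := fun m =>
    (Metric.measure_closedBall_pos volume 0 (by positivity : (0:ℝ) < (m:ℝ) + 1)).ne'
  have hT := fun m => tilted_ub (hBc m) (hB0 m) hhc hα hQ
  set y : (KK n → ℝ) → KK n → ℝ := fun g => Yv (cs n α 0) (vs s) g with hy
  set J : ℕ → (KK n → ℝ) → ℝ := fun m g => ∫ x in B m, Real.exp (ham γ α (y g) x) with hJ
  have hJpos : ∀ m g, 0 < J m g := by
    intro m g
    have : NeZero (volume.restrict (B m)) := ⟨by simpa using hB0 m⟩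
    exact integral_exp_pos (exp_ham_int hα γ (y g)).integrableOn
  have e1 : ∀ m g, Real.log (∫ x in B m, Real.exp (h x - En vs (cs n α 0) g x)) =
      -(1 / 2) * ysq g + Real.log (J m g) := by
    intro m g
    rw [← Real.log_exp (-(1 / 2) * ysq g), ← Real.log_mul (Real.exp_pos _).ne' (hJpos m g).ne', hJ,
      ← integral_const_mul]
    congr 2; ext x
    rw [← Real.exp_add]
    congr 1
    have h1 := neg_En hα.le le_rfl g x
    have h2 := lpm_Yv hα.le 0 s x g
    simp only [hhd, ham, hy]
    rw [sub_eq_add_neg, h1, h2]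
    simp; ring
  have hG : ∀ g : KK n → ℝ, _ := fun g => gauss_spike ha hα.le s (fun i => √Q * yr g i) hκ
  have enq : ∀ g : KK n → ℝ, nq (fun i => √Q * yr g i) = Q * nq (yr g) := by
    intro g; simp only [nq, mul_pow, Real.sq_sqrt hQ.le, Finset.mul_sum]
  have edt : ∀ (g : KK n → ℝ) z, dt (fun i => √Q * yr g i) z = √Q * dt (yr g) z := by
    intro g z; simp only [dt, Finset.mul_sum, mul_assoc]
  simp only [enq, edt, mul_pow, Real.sq_sqrt hQ.le] at hG
  have h1κ : 0 < 1 - κ := by linarith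
  have hκ0 : 0 ≤ κ := div_nonneg (mul_nonneg hα.le (nq_nonneg s)) ha.le
  have e2 : ∀ m g, Real.log (∫ x in B m, Real.exp (h x - En vs (cs n 0 Q) g x)) ≤
      -(1 / 2) * ysq g + (Q / (2 * a) * nq (yr g) + α * Q / (2 * a ^ 2 * (1 - κ)) * dt (yr g) s ^ 2 +
        ((n:ℝ) / 2 * Real.log (2 * Real.pi / a) - (1 / 2) * Real.log (1 - κ))) := by
    intro m g
    have e : ∀ x, h x - En vs (cs n 0 Q) g x = -(1 / 2) * ysq g +
        (-a * nq x / 2 + α / 2 * dt s x ^ 2 + √Q * dt (yr g) x) := by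
      intro x
      have h1 := neg_En le_rfl hQ.le g x
      simp only [hhd]
      rw [sub_eq_add_neg, h1, had]
      simp; ring
    simp_rw [e, Real.exp_add (-(1 / 2) * ysq g)]
    rw [integral_const_mul]
    have hp : 0 < ∫ x in B m, Real.exp (-a * nq x / 2 + α / 2 * dt s x ^ 2 + √Q * dt (yr g) x) := by
      have : NeZero (volume.restrict (B m)) := ⟨by simpa using hB0 m⟩
      exact integral_exp_pos (hG g).1.integrableOn
    rw [Real.log_mul (Real.exp_pos _).ne' hp.ne', Real.log_exp]
    have hle : ∫ x in B m, Real.exp (-a * nq x / 2 + α / 2 * dt s x ^ 2 + √Q * dt (yr g) x) ≤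
        ∫ x, Real.exp (-a * nq x / 2 + α / 2 * dt s x ^ 2 + √Q * dt (yr g) x) :=
      setIntegral_le_integral (hG g).1 (ae_of_all _ fun x => (Real.exp_pos _).le)
    have hlog := Real.log_le_log hp hle
    rw [(hG g).2, Real.log_mul (by positivity) (by positivity), Real.log_mul (by positivity) (by positivity),
      Real.log_mul (by positivity) (by positivity), Real.log_exp, Real.log_exp, Real.log_rpow (by positivity),
      Real.log_sqrt (by positivity), one_div, Real.log_inv] at hlog
    refine (add_le_add_right hlog _).trans_eq ?_
    ring
  have iy := ysq_GG_int n
  have hJi : ∀ m, Integrable (fun g => Real.log (J m g)) (GG (KK n)) := by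
    intro m
    have := ((hT m).1).add (iy.const_mul (1 / 2))
    refine this.congr (ae_of_all _ fun g => ?_)
    simp only [Pi.add_apply, e1]; ring
  have hbd : ∀ m, ∫ g, Real.log (J m g) ∂(GG (KK n)) ≤ Q ^ 2 / (4 * α) + (n:ℝ) / 2 * Real.log (2 * Real.pi / a) + n * Q / (2 * a)
      - (1 / 2) * Real.log (1 - κ) + Q * κ / (2 * a * (1 - κ)) := by
    intro m
    have l1 := lin3 (nq_yr_int n).1 (dt_yr_int s).1 iy (Q / (2 * a)) (α * Q / (2 * a ^ 2 * (1 - κ))) (-(1/2))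
        ((n:ℝ) / 2 * Real.log (2 * Real.pi / a) - (1 / 2) * Real.log (1 - κ))
    have h2 := integral_mono (hT m).2.1 l1.1 (fun g => by have := e2 m g; simp only; linarith)
    rw [l1.2, (nq_yr_int n).2, (dt_yr_int s).2] at h2
    have h3 := (hT m).2.2
    simp_rw [e1 m] at h3
    rw [integral_add (iy.const_mul _) (hJi m), integral_const_mul] at h3
    have e : α * Q / (2 * a ^ 2 * (1 - κ)) * nq s = Q * κ / (2 * a * (1 - κ)) := by
      rw [show α * Q / (2 * a ^ 2 * (1 - κ)) * nq s = Q * (α * nq s / a) / (2 * a * (1 - κ)) by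
        field_simp]
    have e' : Q / (2 * a) * (n:ℝ) = n * Q / (2 * a) := by ring
    linarith
  have hlim : Tendsto (fun m => ∫ g, Real.log (J m g) ∂(GG (KK n))) atTop
      (nhds (∫ g, Real.log (ZL γ α (y g)) ∂(GG (KK n)))) := by
    refine tendsto_integral_of_dominated_convergence
      (fun g => |Real.log (J 0 g)| + |Real.log (ZL γ α (y g))|) (fun m => (hJi m).aestronglyMeasurable)
      ((hJi 0).abs.add hZi.abs) (fun m => ae_of_all _ fun g => ?_) (ae_of_all _ fun g => ?_)
    · have hi := exp_ham_int hα γ (y g)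
      have h1 : J 0 g ≤ J m g := by
        refine setIntegral_mono_set hi.integrableOn (ae_of_all _ fun x => (Real.exp_pos _).le) ?_
        exact (Metric.closedBall_subset_closedBall (by simp)).eventuallyLE
      have h2 : J m g ≤ ZL γ α (y g) := setIntegral_le_integral hi (ae_of_all _ fun x => (Real.exp_pos _).le)
      have h3 := Real.log_le_log (hJpos 0 g) h1
      have h4 := Real.log_le_log (hJpos m g) h2
      rw [Real.norm_eq_abs, abs_le]
      constructor
      · linarith [neg_abs_le (Real.log (J 0 g)), abs_nonneg (Real.log (ZL γ α (y g)))]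
      · linarith [le_abs_self (Real.log (ZL γ α (y g))), abs_nonneg (Real.log (J 0 g))]
    · have hi := exp_ham_int hα γ (y g)
      have hU : (⋃ m, B m) = Set.univ := by
        ext x
        simp only [Set.mem_iUnion, Set.mem_univ, iff_true, hBd, mem_closedBall_zero_iff]
        obtain ⟨m, hm⟩ := exists_nat_ge ‖x‖
        exact ⟨m, by linarith⟩
      have := tendsto_setIntegral_of_monotone (μ := volume) (f := fun x => Real.exp (ham γ α (y g) x)) (s := B)
        (fun m => Metric.isClosed_closedBall.measurableSet) (fun i j hij =>
          Metric.closedBall_subset_closedBall (by simpa using hij)) (by rw [hU]; exact hi.integrableOn)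
      rw [hU, setIntegral_univ] at this
      exact (Real.continuousAt_log (ZL_pos hα γ (y g)).ne').tendsto.comp this
  exact le_of_tendsto' hlim hbd

end

set_option linter.all false
set_option linter.deprecated false
noncomputable section

instance gaussPrior_prob (n : ℕ) (v : ℝ) : IsProbabilityMeasure (gaussPrior n v) := by
  unfold gaussPrior; infer_instance

theorem prior_sq {n : ℕ} (sig : ℝ) (i : Fin n) : ∫ s, s i ^ 2 ∂(gaussPrior n (sig ^ 2)) = sig ^ 2 := by
  have h2 := (measurePreserving_eval (fun _ : Fin n => gaussianReal 0 (Real.toNNReal (sig ^ 2))) i)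
  have h3 := integral_map (μ := gaussPrior n (sig ^ 2)) (φ := fun s : Fin n → ℝ => s i) (f := fun t : ℝ => t ^ 2)
    (measurable_pi_apply i).aemeasurable (by fun_prop)
  rw [← h3]
  have e : (gaussPrior n (sig ^ 2)).map (fun s : Fin n → ℝ => s i) = gaussianReal 0 (Real.toNNReal (sig ^ 2)) := h2.map_eq
  rw [e]
  have hv := variance_id_gaussianReal (μ := 0) (v := Real.toNNReal (sig ^ 2))
  rw [variance_eq_integral (by fun_prop)] at hv
  simpa [integral_id_gaussianReal, sq_nonneg] using hv

theorem nqT_memLp (n : ℕ) (sig : ℝ) : MemLp (fun s : Fin n → ℝ => nq s / n) 2 (gaussPrior n (sig ^ 2)) := by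
  have : MemLp (fun s : Fin n → ℝ => nq s) 2 (gaussPrior n (sig ^ 2)) := by
    unfold nq
    refine memLp_finsetSum _ fun i _ => ?_
    have := prior_mul_memLp (sig ^ 2) i i
    simpa only [← sq] using this
  simpa [div_eq_inv_mul] using this.const_mul ((n:ℝ)⁻¹)

theorem integral_nq (n : ℕ) (sig : ℝ) : Integrable (fun s : Fin n → ℝ => nq s) (gaussPrior n (sig ^ 2)) ∧
    ∫ s, nq s ∂(gaussPrior n (sig ^ 2)) = n * sig ^ 2 := by
  have h : ∀ i : Fin n, Integrable (fun s : Fin n → ℝ => s i ^ 2) (gaussPrior n (sig ^ 2)) :=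
    fun i => (prior_memLp (sig ^ 2) i 2 (by simp)).integrable_sq
  refine ⟨integrable_finsetSum _ fun i _ => h i, ?_⟩
  unfold nq
  rw [integral_finsetSum _ fun i _ => h i]
  simp [prior_sq]

theorem integral_T {n : ℕ} (hn : 0 < n) (sig : ℝ) :
    ∫ s, nq s / n ∂(gaussPrior n (sig ^ 2)) = sig ^ 2 := by
  have hn' : (0:ℝ) < n := by exact_mod_cast hn
  rw [integral_div, (integral_nq n sig).2]; field_simp

/-- variance of the normalised squared norm -/
def VT (n : ℕ) (sig : ℝ) : ℝ := ∫ s, (nq s / n - sig ^ 2) ^ 2 ∂(gaussPrior n (sig ^ 2))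

theorem VT_int (n : ℕ) (sig : ℝ) :
    Integrable (fun s : Fin n → ℝ => (nq s / n - sig ^ 2) ^ 2) (gaussPrior n (sig ^ 2)) :=
  ((nqT_memLp n sig).sub (memLp_const _)).integrable_sq

theorem VT_le (sig : ℝ) : ∃ C, 0 ≤ C ∧ ∀ n : ℕ, 0 < n → VT n sig ≤ C / n := by
  set C := Var[fun t : ℝ => t ^ 2; gaussianReal 0 (Real.toNNReal (sig ^ 2))] with hC
  refine ⟨C, variance_nonneg _ _, fun n hn => ?_⟩
  have hn' : (0:ℝ) < n := by exact_mod_cast hn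
  have hm : MemLp (fun t : ℝ => t ^ 2) 2 (gaussianReal 0 (Real.toNNReal (sig ^ 2))) := by
    have : ENNReal.HolderTriple 4 4 2 := by
      constructor
      rw [← two_mul, show (4 : ENNReal) = 2 * 2 by norm_num, ENNReal.mul_inv (by simp) (by simp), ← mul_assoc,
        ENNReal.mul_inv_cancel (by simp) (by simp), one_mul]
    have h4 := memLp_id_gaussianReal' (μ := 0) (v := Real.toNNReal (sig ^ 2)) 4 (by simp)
    have := h4.mul (r := 2) h4
    simpa [sq, Pi.mul_def] using this
  have hv := variance_sum_pi (ι := Fin n) (μ := fun _ => gaussianReal 0 (Real.toNNReal (sig ^ 2)))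
    (X := fun _ t => t ^ 2) (fun i => hm)
  have e : VT n sig = Var[fun s : Fin n → ℝ => nq s / n; gaussPrior n (sig ^ 2)] := by
    rw [variance_eq_integral (nqT_memLp n sig).aestronglyMeasurable.aemeasurable, integral_T hn]
    rfl
  have e2 : Var[fun s : Fin n → ℝ => nq s / n; gaussPrior n (sig ^ 2)] = ((n:ℝ)⁻¹) ^ 2 * (n * C) := by
    simp_rw [div_eq_inv_mul]
    rw [variance_const_mul]
    congr 1
    have : (nq : (Fin n → ℝ) → ℝ) = ∑ i, fun s : Fin n → ℝ => s i ^ 2 := by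
      ext s; simp [nq]
    rw [this]
    refine hv.trans ?_
    simp [hC]
  rw [e, e2]
  refine le_of_eq ?_
  field_simp

theorem Sn_eq {n : ℕ} (hn : 0 < n) (sig : ℝ) : Sn n sig = VT n sig + sig ^ 4 := by
  have h1 := (nqT_memLp n sig).integrable (by norm_num)
  have h2 := (nqT_memLp n sig).integrable_sq
  have h := lin2 h2 h1 1 (-2 * sig ^ 2) (sig ^ 4)
  have e : VT n sig = ∫ s : Fin n → ℝ, (1 * (nq s / n) ^ 2 + -2 * sig ^ 2 * (nq s / n) + sig ^ 4) ∂(gaussPrior n (sig ^ 2)) := by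
    unfold VT
    congr 1; ext s; ring
  rw [e, h.2, integral_T hn, Sn]; ring

theorem VT_nonneg (n : ℕ) (sig : ℝ) : 0 ≤ VT n sig := integral_nonneg fun s => sq_nonneg _

theorem VT_tendsto (sig : ℝ) : Tendsto (fun n => VT n sig) atTop (nhds 0) := by
  obtain ⟨C, hC, h⟩ := VT_le sig
  refine tendsto_of_tendsto_of_tendsto_of_le_of_le' tendsto_const_nhds
    (tendsto_const_div_atTop_nhds_zero_nat C) (Eventually.of_forall fun n => VT_nonneg n sig) ?_
  filter_upwards [eventually_gt_atTop 0] with n hn using h n hn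

theorem Sn_tendsto (sig : ℝ) : Tendsto (fun n => Sn n sig) atTop (nhds (sig ^ 4)) := by
  have := (VT_tendsto sig).add_const (sig ^ 4)
  rw [zero_add] at this
  refine this.congr' ?_
  filter_upwards [eventually_gt_atTop 0] with n hn using (Sn_eq hn sig).symm

/-- the variational value -/
def Uf (γ lam ε T : ℝ) : ℝ := ((max γ ((lam + ε) * T) + ε) - γ) ^ 2 / (4 * lam) +
  (1 / 2) * Real.log (2 * Real.pi / (max γ ((lam + ε) * T) + ε)) +
  ((max γ ((lam + ε) * T) + ε) - γ) / (2 * (max γ ((lam + ε) * T) + ε))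

theorem quad_dom {f : ℝ → ℝ} {x0 A B : ℝ} (hc : ContinuousWithinAt f (Set.Ici 0) x0) (hB : 0 ≤ B)
    (hf : ∀ T, 0 ≤ T → f T ≤ A + B * T ^ 2) {η : ℝ} (hη : 0 < η) :
    ∃ C, 0 ≤ C ∧ ∀ T, 0 ≤ T → f T ≤ f x0 + η + C * (T - x0) ^ 2 := by
  obtain ⟨δ, hδ, h⟩ := Metric.continuousWithinAt_iff.1 hc η hη
  refine ⟨2 * B + (|A| + |f x0| + 2 * B * x0 ^ 2) / δ ^ 2, by positivity, fun T hT => ?_⟩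
  by_cases hd : dist T x0 < δ
  · have := h hT hd
    rw [Real.dist_eq] at this
    have h2 := (abs_lt.1 this).2
    have : 0 ≤ (2 * B + (|A| + |f x0| + 2 * B * x0 ^ 2) / δ ^ 2) * (T - x0) ^ 2 := by positivity
    linarith
  · rw [not_lt, Real.dist_eq] at hd
    have h1 : δ ^ 2 ≤ (T - x0) ^ 2 := by
      rw [← sq_abs (T - x0)]; exact pow_le_pow_left₀ hδ.le hd 2
    have h2 : |A| + |f x0| + 2 * B * x0 ^ 2 ≤ (|A| + |f x0| + 2 * B * x0 ^ 2) / δ ^ 2 * (T - x0) ^ 2 := by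
      rw [div_mul_eq_mul_div, le_div_iff₀ (by positivity)]
      exact mul_le_mul_of_nonneg_left h1 (by positivity)
    have h3 := hf T hT
    have h4 : B * T ^ 2 ≤ 2 * B * (T - x0) ^ 2 + 2 * B * x0 ^ 2 := by
      nlinarith [mul_nonneg hB (sq_nonneg (T - 2 * x0))]
    nlinarith [le_abs_self A, neg_abs_le (f x0)]

theorem ub_T {n : ℕ} (hn : 0 < n) (s : Fin n → ℝ) {γ lam ε lh : ℝ} (hl : 0 < lam) (hε : 0 < ε)
    (h1 : lam ≤ lh) (h2 : lh ≤ lam + ε) :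
    (1 / (n:ℝ)) * ∫ g, Real.log (ZL γ (lh / n) (Yv (cs n (lh / n) 0) (vs s) g)) ∂(GG (KK n)) ≤
      Uf γ lam ε (nq s / n) + (1 / (n:ℝ)) * (2 / ε * (|γ| + ε + (lam + ε) * (nq s / n))) := by
  have hn' : (0:ℝ) < n := by exact_mod_cast hn
  set T := nq s / n with hT
  have hT0 : 0 ≤ T := div_nonneg (nq_nonneg s) hn'.le
  set a := max γ ((lam + ε) * T) + ε with ha
  have ha1 : (lam + ε) * T + ε ≤ a := by rw [ha]; linarith [le_max_right γ ((lam + ε) * T)]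
  have ha2 : γ + ε ≤ a := by rw [ha]; linarith [le_max_left γ ((lam + ε) * T)]
  have hpp : 0 ≤ (lam + ε) * T := by positivity
  have ha3 : a ≤ |γ| + (lam + ε) * T + ε := by
    rw [ha]; have := max_le (show γ ≤ |γ| + (lam + ε) * T by linarith [le_abs_self γ])
      (show (lam + ε) * T ≤ |γ| + (lam + ε) * T by linarith [abs_nonneg γ]); linarith
  have ha0 : 0 < a := by linarith
  have hlh : 0 < lh := by linarith
  have hα : 0 < lh / n := by positivity
  have eκ : lh / n * nq s / a = lh * T / a := by rw [hT]; ring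
  have hlT : lh * T ≤ (lam + ε) * T := mul_le_mul_of_nonneg_right h2 hT0
  have hlT0 : 0 ≤ lh * T := by positivity
  have hκ : lh / n * nq s / (γ + (a - γ)) < 1 := by
    rw [add_sub_cancel, eκ, div_lt_one ha0]; linarith
  have hu := (ub_fixed s hα (show 0 < a - γ by linarith) (by rw [add_sub_cancel]; exact ha0) hκ).2
  rw [add_sub_cancel, eκ] at hu
  set κ := lh * T / a with hκd
  have hκ0 : 0 ≤ κ := by positivity
  have hκ1 : ε / a ≤ 1 - κ := by
    rw [hκd, one_sub_div ha0.ne']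
    exact (div_le_div_iff_of_pos_right ha0).2 (by linarith)
  have hεa : 0 < ε / a := by positivity
  have hk2 : 0 < 1 - κ := by linarith
  have b1 : -(1 / 2) * Real.log (1 - κ) ≤ a / (2 * ε) := by
    have h3 := Real.log_le_log hεa hκ1
    have h4 := Real.one_sub_inv_le_log_of_pos hεa
    rw [inv_div] at h4
    have : a / (2 * ε) = (1 / 2) * (a / ε) := by field_simp
    rw [this]; linarith
  have b2 : (a - γ) * κ / (2 * a * (1 - κ)) ≤ (a - γ) / (2 * ε) := by
    rw [div_le_div_iff₀ (by positivity) (by positivity)]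
    have : ε ≤ a * (1 - κ) := by
      have := mul_le_mul_of_nonneg_left hκ1 ha0.le
      rwa [mul_div_cancel₀ _ ha0.ne'] at this
    have h5 : κ * ε ≤ 1 * (a * (1 - κ)) := mul_le_mul (by linarith) this hε.le (by norm_num)
    have h6 := mul_le_mul_of_nonneg_left h5 (show 0 ≤ (a - γ) by linarith)
    nlinarith
  have b3 : (a - γ) ^ 2 / (4 * (lh / n)) ≤ n * ((a - γ) ^ 2 / (4 * lam)) := by
    have : (a - γ) ^ 2 / (4 * (lh / n)) = n * ((a - γ) ^ 2 / (4 * lh)) := by field_simp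
    rw [this]
    gcongr
  have b4 : a / (2 * ε) + (a - γ) / (2 * ε) ≤ 2 / ε * (|γ| + ε + (lam + ε) * T) := by
    rw [← add_div, div_mul_eq_mul_div, div_le_div_iff₀ (by positivity) hε]
    have : a + (a - γ) ≤ 4 * (|γ| + ε + (lam + ε) * T) := by linarith [neg_abs_le γ, abs_nonneg γ]
    nlinarith [mul_le_mul_of_nonneg_right this hε.le]
  have fin : ∫ g, Real.log (ZL γ (lh / n) (Yv (cs n (lh / n) 0) (vs s) g)) ∂(GG (KK n)) ≤
      n * Uf γ lam ε T + 2 / ε * (|γ| + ε + (lam + ε) * T) := by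
    have e : n * Uf γ lam ε T = n * ((a - γ) ^ 2 / (4 * lam)) + n / 2 * Real.log (2 * Real.pi / a) + n * (a - γ) / (2 * a) := by
      rw [Uf, ← ha]; ring
    rw [e]; linarith
  calc _ ≤ (1 / (n:ℝ)) * (n * Uf γ lam ε T + 2 / ε * (|γ| + ε + (lam + ε) * T)) :=
        mul_le_mul_of_nonneg_left fin (by positivity)
    _ = _ := by field_simp

theorem Uf_quad {γ lam ε : ℝ} (hl : 0 < lam) (hε : 0 < ε) : ∃ A B, 0 ≤ B ∧ ∀ T, 0 ≤ T → Uf γ lam ε T ≤ A + B * T ^ 2 := by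
  refine ⟨(2 * |γ| + ε) ^ 2 / (2 * lam) + (1 / 2) * Real.log (2 * Real.pi / ε) + (1 / 2 + |γ| / (2 * ε)), (lam + ε) ^ 2 / (2 * lam),
    by positivity, fun T hT => ?_⟩
  unfold Uf
  have hpp : 0 ≤ (lam + ε) * T := by positivity
  set a := max γ ((lam + ε) * T) + ε with ha
  have ha1 : (lam + ε) * T + ε ≤ a := by rw [ha]; linarith [le_max_right γ ((lam + ε) * T)]
  have ha2 : γ + ε ≤ a := by rw [ha]; linarith [le_max_left γ ((lam + ε) * T)]
  have ha3 : a ≤ |γ| + (lam + ε) * T + ε := by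
    rw [ha]; have := max_le (show γ ≤ |γ| + (lam + ε) * T by linarith [le_abs_self γ])
      (show (lam + ε) * T ≤ |γ| + (lam + ε) * T by linarith [abs_nonneg γ]); linarith
  have ha0 : 0 < a := by linarith
  have c1 : (a - γ) ^ 2 / (4 * lam) ≤ (2 * |γ| + ε) ^ 2 / (2 * lam) + (lam + ε) ^ 2 / (2 * lam) * T ^ 2 := by
    have h0 : 0 ≤ a - γ := by linarith
    have h1 : a - γ ≤ (2 * |γ| + ε) + (lam + ε) * T := by linarith [neg_abs_le γ]
    have h2 : (a - γ) ^ 2 ≤ ((2 * |γ| + ε) + (lam + ε) * T) ^ 2 := pow_le_pow_left₀ h0 h1 2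
    have h3 : (a - γ) ^ 2 ≤ 2 * (2 * |γ| + ε) ^ 2 + 2 * ((lam + ε) ^ 2 * T ^ 2) := by
      nlinarith [sq_nonneg ((2 * |γ| + ε) - (lam + ε) * T)]
    have e : (2 * |γ| + ε) ^ 2 / (2 * lam) + (lam + ε) ^ 2 / (2 * lam) * T ^ 2 =
      (2 * (2 * |γ| + ε) ^ 2 + 2 * ((lam + ε) ^ 2 * T ^ 2)) / (4 * lam) := by field_simp; ring
    rw [e]
    exact (div_le_div_iff_of_pos_right (by positivity)).2 h3
  have c2 : Real.log (2 * Real.pi / a) ≤ Real.log (2 * Real.pi / ε) := by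
    refine Real.log_le_log (by positivity) ?_
    exact div_le_div_of_nonneg_left (by positivity) hε (by linarith)
  have c3 : (a - γ) / (2 * a) ≤ 1 / 2 + |γ| / (2 * ε) := by
    have : (a - γ) / (2 * a) = 1 / 2 + (-γ) / (2 * a) := by field_simp; ring
    rw [this]
    have : (-γ) / (2 * a) ≤ |γ| / (2 * ε) := by
      refine (div_le_div_of_nonneg_right (neg_le_abs γ) (by positivity)).trans ?_
      exact div_le_div_of_nonneg_left (abs_nonneg _) (by positivity) (by linarith)
    linarith
  linarith

theorem Uf_cont {γ lam ε T : ℝ} (hl : 0 < lam) (hm : 0 < max γ ((lam + ε) * T) + ε) :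
    ContinuousAt (fun p : ℝ × ℝ => Uf γ lam p.1 p.2) (ε, T) := by
  unfold Uf
  have h1 : ContinuousAt (fun p : ℝ × ℝ => max γ ((lam + p.1) * p.2) + p.1) (ε, T) := by fun_prop
  have h2 : (max γ ((lam + (ε, T).1) * (ε, T).2) + (ε, T).1) ≠ 0 := hm.ne'
  refine ContinuousAt.add (ContinuousAt.add ?_ ?_) ?_
  · exact ((h1.sub continuousAt_const).pow 2).div_const _
  · refine continuousAt_const.mul (ContinuousAt.log (continuousAt_const.div h1 h2) ?_)
    have := hm
    simp only; positivity
  · exact (h1.sub continuousAt_const).div (continuousAt_const.mul h1) (mul_ne_zero two_ne_zero h2)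

theorem XX_ub {sig lam : ℝ} (hs : 0 < sig) (hl : 0 < lam) (γ : ℝ) {η : ℝ} (hη : 0 < η) :
    ∃ δ, 0 < δ ∧ ∀ᶠ n : ℕ in atTop, ∀ lh, lam ≤ lh → lh ≤ lam + δ →
      XX n sig γ lh ≤ Uf γ lam 0 (sig ^ 2) + η := by
  have hs2 : 0 < sig ^ 2 := by positivity
  have hM : 0 < max γ ((lam + 0) * sig ^ 2) + 0 := by
    have := le_max_right γ ((lam + 0) * sig ^ 2)
    have : 0 < (lam + 0) * sig ^ 2 := by positivity
    linarith
  have hc0 : ContinuousAt (fun ε => Uf γ lam ε (sig ^ 2)) 0 :=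
    (Uf_cont hl hM).comp (f := fun ε : ℝ => (ε, sig ^ 2)) (x := 0) (by fun_prop)
  have hev : ∀ᶠ ε in nhds (0:ℝ), Uf γ lam ε (sig ^ 2) < Uf γ lam 0 (sig ^ 2) + η / 4 :=
    hc0.eventually_lt continuousAt_const (by linarith)
  obtain ⟨ε0, hε0, hb⟩ := Metric.eventually_nhds_iff.1 hev
  set ε := ε0 / 2 with hε
  have hεp : 0 < ε := by positivity
  have hU : Uf γ lam ε (sig ^ 2) < Uf γ lam 0 (sig ^ 2) + η / 4 := hb (by
    rw [Real.dist_eq, sub_zero, abs_of_pos hεp]; linarith)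
  obtain ⟨A, B, hB, hq⟩ := Uf_quad (γ := γ) hl hεp
  have hM2 : 0 < max γ ((lam + ε) * sig ^ 2) + ε := by
    have := le_max_right γ ((lam + ε) * sig ^ 2)
    have : 0 < (lam + ε) * sig ^ 2 := by positivity
    linarith
  have hcT : ContinuousAt (fun T => Uf γ lam ε T) (sig ^ 2) :=
    (Uf_cont hl hM2).comp (f := fun T : ℝ => (ε, T)) (x := sig ^ 2) (by fun_prop)
  obtain ⟨C, hC, hd⟩ := quad_dom hcT.continuousWithinAt hB hq (show 0 < η / 4 by linarith)
  refine ⟨ε, hεp, ?_⟩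
  have t1 : Tendsto (fun n => C * VT n sig) atTop (nhds (C * 0)) := (VT_tendsto sig).const_mul C
  have t2 : Tendsto (fun n : ℕ => (2 / ε * (|γ| + ε + (lam + ε) * sig ^ 2)) / (n:ℝ)) atTop (nhds 0) :=
    tendsto_const_div_atTop_nhds_zero_nat _
  rw [mul_zero] at t1
  filter_upwards [t1.eventually (gt_mem_nhds (show 0 < η / 4 by linarith)),
    t2.eventually (gt_mem_nhds (show 0 < η / 4 by linarith)), eventually_gt_atTop 0] with n h1 h2 hn lh hl1 hl2
  have hn' : (0:ℝ) < n := by exact_mod_cast hn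
  have hlh : 0 < lh := by linarith
  have hI := logZL_int (vs_L2 n (sig ^ 2)) (cs n (lh / n) 0) (cs_nonneg _ _ _) (show 0 < lh / n by positivity) γ
    (fun p => rfl) (fun i => by simp [cs])
  unfold XX
  rw [integral_prod _ hI, ← integral_const_mul]
  have l := lin2 (VT_int n sig) ((nqT_memLp n sig).integrable (by norm_num)) C (2 / ε * (lam + ε) / n)
    (Uf γ lam ε (sig ^ 2) + η / 4 + 2 / ε * (|γ| + ε) / n)
  have hm := integral_mono (hI.integral_prod_left.const_mul (1 / (n:ℝ))) l.1 (fun s => by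
    have u := ub_T (γ := γ) hn s hl hεp hl1 hl2
    have v := hd (nq s / n) (div_nonneg (nq_nonneg s) hn'.le)
    refine u.trans ?_
    refine (add_le_add_left v _).trans (le_of_eq ?_)
    ring)
  refine hm.trans ?_
  rw [l.2, integral_T hn]
  change C * VT n sig + _ + _ ≤ _
  have e : (2 / ε * (|γ| + ε + (lam + ε) * sig ^ 2)) / (n:ℝ) = 2 / ε * (lam + ε) / n * sig ^ 2 + 2 / ε * (|γ| + ε) / n := by ring
  linarith

end

set_option linter.all false
set_option linter.deprecated false
noncomputable section

theorem prior_scale (n : ℕ) {sig sig' : ℝ} (hs' : 0 < sig') :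
    MeasurePreserving (fun (s : Fin n → ℝ) i => (sig / sig') * s i) (gaussPrior n (sig' ^ 2)) (gaussPrior n (sig ^ 2)) := by
  refine ⟨by fun_prop, ?_⟩
  have h : (gaussianReal 0 (Real.toNNReal (sig' ^ 2))).map (fun t => (sig / sig') * t) = gaussianReal 0 (Real.toNNReal (sig ^ 2)) := by
    rw [gaussianReal_map_const_mul, mul_zero]
    congr 1
    ext
    simp [sq_nonneg]
    field_simp
  unfold gaussPrior
  have := Measure.pi_map_pi (μ := fun _ : Fin n => gaussianReal 0 (Real.toNNReal (sig' ^ 2)))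
    (f := fun _ t => (sig / sig') * t) (fun i => by fun_prop)
  rw [this]
  simp only [h]

theorem Bayes_lb {n : ℕ} (hn : 0 < n) {sig lam : ℝ} (hs : 0 < sig) (hl : 0 < lam) :
    (1 / 2) * Real.log (2 * Real.pi * sig ^ 2) ≤ XX n sig (1 / sig ^ 2) lam := by
  have hn' : (0:ℝ) < n := by exact_mod_cast hn
  have hα : 0 < lam / n := by positivity
  have h := loglik_nonneg (vs_L2 n (sig ^ 2)) (cs_nonneg n (lam / n) 0)
  have i1 := logZp_int (vs_L2 n (sig ^ 2)) (vs_L2 n (sig ^ 2)) (cs_nonneg n (lam / n) 0)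
  have i2 := ysq_int (vs_L2 n (sig ^ 2)) (cs n (lam / n) 0)
  have l := lin2 i1 i2 1 (1 / 2) ((n:ℝ) / 2 * Real.log (2 * Real.pi * sig ^ 2))
  have l' := lin2 i1 i2 1 (1 / 2) 0
  have e : XX n sig (1 / sig ^ 2) lam = (1 / (n:ℝ)) * ((∫ q : (Fin n → ℝ) × (KK n → ℝ), (Real.log (Zp (gaussPrior n (sig ^ 2)) vs (cs n (lam / n) 0) (Yv (cs n (lam / n) 0) (vs q.1) q.2)) +
      (1 / 2) * ysq (Yv (cs n (lam / n) 0) (vs q.1) q.2)) ∂((gaussPrior n (sig ^ 2)).prod (GG (KK n)))) + (n:ℝ) / 2 * Real.log (2 * Real.pi * sig ^ 2)) := by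
    unfold XX
    congr 1
    simp_rw [Zp_ZL hα (show 0 < sig ^ 2 by positivity)]
    have e1 := l.2
    have e2 := l'.2
    simp only [one_mul, add_zero] at e1 e2
    rw [e2, ← e1]
    congr 1; ext q; ring
  rw [e]
  have h' : 0 ≤ (∫ q : (Fin n → ℝ) × (KK n → ℝ), (Real.log (Zp (gaussPrior n (sig ^ 2)) vs (cs n (lam / n) 0) (Yv (cs n (lam / n) 0) (vs q.1) q.2)) +
      (1 / 2) * ysq (Yv (cs n (lam / n) 0) (vs q.1) q.2)) ∂((gaussPrior n (sig ^ 2)).prod (GG (KK n)))) := h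
  rw [mul_add, show (1 / (n:ℝ)) * ((n:ℝ) / 2 * Real.log (2 * Real.pi * sig ^ 2)) = (1 / 2) * Real.log (2 * Real.pi * sig ^ 2) by field_simp]
  have := mul_nonneg (show 0 ≤ 1 / (n:ℝ) by positivity) h'
  linarith

theorem dt_smul {n : ℕ} (k : ℝ) (s x : Fin n → ℝ) : dt (fun i => k * s i) x = k * dt s x := by
  simp only [dt, Finset.mul_sum, mul_assoc]

theorem XX_mono_sig {n : ℕ} (hn : 0 < n) {sig sig' lam : ℝ} (hs' : 0 < sig') (hle : sig' ≤ sig) (hl : 0 < lam) (γ : ℝ) :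
    XX n sig' γ lam ≤ XX n sig γ lam := by
  have hn' : (0:ℝ) < n := by exact_mod_cast hn
  have hα : 0 < lam / n := by positivity
  have hI := logZL_int (vs_L2 n (sig ^ 2)) (cs n (lam / n) 0) (cs_nonneg _ _ _) hα γ
    (fun p => rfl) (fun i => by simp [cs])
  have hI' := logZL_int (vs_L2 n (sig' ^ 2)) (cs n (lam / n) 0) (cs_nonneg _ _ _) hα γ
    (fun p => rfl) (fun i => by simp [cs])
  unfold XX
  refine mul_le_mul_of_nonneg_left ?_ (by positivity)
  have hmp := (prior_scale n (sig := sig) hs').prod (MeasurePreserving.id (GG (KK n)))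
  have hIc := hmp.integrable_comp_of_integrable hI
  rw [← hmp.map_eq, integral_map hmp.measurable.aemeasurable (by rw [hmp.map_eq]; exact hI.aestronglyMeasurable)]
  refine integral_mono hI' hIc fun q => ?_
  simp only [Function.comp, Prod.map, id]
  refine Real.log_le_log (ZL_pos hα _ _) ?_
  refine integral_mono (exp_ham_int hα _ _) (exp_ham_int hα _ _) fun x => Real.exp_le_exp.2 ?_
  unfold ham
  rw [lpm_Yv hα.le, lpm_Yv hα.le, dt_smul]
  have hk : 1 ≤ sig / sig' := (one_le_div hs').2 hle
  have : dt q.1 x ^ 2 ≤ (sig / sig' * dt q.1 x) ^ 2 := by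
    rw [mul_pow]
    nlinarith [sq_nonneg (dt q.1 x), mul_nonneg (sq_nonneg (dt q.1 x)) (show 0 ≤ (sig / sig') ^ 2 - 1 by nlinarith)]
  nlinarith

theorem XX_lb_high {n : ℕ} (hn : 0 < n) {sig sig' lam : ℝ} (hs' : 0 < sig') (hle : sig' ≤ sig) (hl : 0 < lam) :
    (1 / 2) * Real.log (2 * Real.pi * sig' ^ 2) ≤ XX n sig (1 / sig' ^ 2) lam :=
  (Bayes_lb hn hs' hl).trans (XX_mono_sig hn hs' hle hl _)

end

set_option linter.all false
set_option linter.deprecated false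
noncomputable section

theorem pair_R {n : ℕ} {P : Measure (Fin n → ℝ)} [IsProbabilityMeasure P]
    (h : ∀ k, Integrable (fun x : Fin n → ℝ => vs x k) P) (q1 : ℝ) :
    Integrable (fun z : (Fin n → ℝ) × (Fin n → ℝ) => (dt z.1 z.2 / n - q1) ^ 2) (P.prod P) ∧
    ∫ z, (dt z.1 z.2 / n - q1) ^ 2 ∂(P.prod P) =
      2 / (n:ℝ) ^ 2 * ∑ p, (∫ x, vs x (Sum.inl p) ∂P) ^ 2 +
      -(2 * q1 / n) * ∑ i, (∫ x, vs x (Sum.inr i) ∂P) ^ 2 + q1 ^ 2 := by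
  have hi : ∀ k, Integrable (fun z : (Fin n → ℝ) × (Fin n → ℝ) => vs z.1 k * vs z.2 k) (P.prod P) :=
    fun k => (h k).mul_prod (h k)
  have he : ∀ k, ∫ z, vs z.1 k * vs z.2 k ∂(P.prod P) = (∫ x, vs x k ∂P) ^ 2 := by
    intro k
    rw [sq]
    exact integral_prod_mul (fun x : Fin n → ℝ => vs x k) (fun x : Fin n → ℝ => vs x k)
  have i1 : Integrable (fun z : (Fin n → ℝ) × (Fin n → ℝ) => ∑ p, vs z.1 (Sum.inl p) * vs z.2 (Sum.inl p)) (P.prod P) :=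
    integrable_finsetSum _ fun p _ => hi (Sum.inl p)
  have i2 : Integrable (fun z : (Fin n → ℝ) × (Fin n → ℝ) => ∑ i, vs z.1 (Sum.inr i) * vs z.2 (Sum.inr i)) (P.prod P) :=
    integrable_finsetSum _ fun i _ => hi (Sum.inr i)
  have l := lin2 i1 i2 (2 / (n:ℝ) ^ 2) (-(2 * q1 / n)) (q1 ^ 2)
  have e : (fun z : (Fin n → ℝ) × (Fin n → ℝ) => (dt z.1 z.2 / n - q1) ^ 2) = fun z =>
      2 / (n:ℝ) ^ 2 * ∑ p, vs z.1 (Sum.inl p) * vs z.2 (Sum.inl p) +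
      -(2 * q1 / n) * ∑ i, vs z.1 (Sum.inr i) * vs z.2 (Sum.inr i) + q1 ^ 2 := by
    ext z
    have h1 : ∑ p, vs z.1 (Sum.inl p) * vs z.2 (Sum.inl p) = (1 / 2) * dt z.1 z.2 ^ 2 := vm_mul z.1 z.2
    have h2 : ∑ i, vs z.1 (Sum.inr i) * vs z.2 (Sum.inr i) = dt z.1 z.2 := rfl
    rw [h1, h2]; ring
  rw [e]
  refine ⟨l.1, l.2.trans ?_⟩
  rw [integral_finsetSum _ fun p _ => hi (Sum.inl p), integral_finsetSum _ fun i _ => hi (Sum.inr i)]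
  simp only [he]

/-- the Bayes posterior -/
def PP (n : ℕ) (sig α β : ℝ) (q : (Fin n → ℝ) × (KK n → ℝ)) : Measure (Fin n → ℝ) :=
  post (gaussPrior n (sig ^ 2)) vs (cs n α β) (Yv (cs n α β) (vs q.1) q.2)

instance PP_prob (n : ℕ) (sig α β : ℝ) (q : (Fin n → ℝ) × (KK n → ℝ)) : IsProbabilityMeasure (PP n sig α β q) :=
  post_prob vs_meas _ _

theorem PP_int {n : ℕ} {sig α β : ℝ} {q : (Fin n → ℝ) × (KK n → ℝ)} {f : (Fin n → ℝ) → ℝ}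
    (hf : Integrable f (gaussPrior n (sig ^ 2))) : Integrable f (PP n sig α β q) :=
  post_int vs_meas _ _ hf

/-- overlap fluctuation -/
def Vn (n : ℕ) (sig α β q1 : ℝ) : ℝ :=
  ∫ q, (∫ z, (dt z.1 z.2 / n - q1) ^ 2 ∂((PP n sig α β q).prod (PP n sig α β q)))
    ∂((gaussPrior n (sig ^ 2)).prod (GG (KK n)))

theorem Vn_nonneg (n : ℕ) (sig α β q1 : ℝ) : 0 ≤ Vn n sig α β q1 :=
  integral_nonneg fun q => integral_nonneg fun z => sq_nonneg _

theorem Vn_eq {n : ℕ} {sig α β : ℝ} (q1 : ℝ) (hα : 0 < α) (hβ : 0 < β) :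
    Integrable (fun q => ∫ z, (dt z.1 z.2 / n - q1) ^ 2 ∂((PP n sig α β q).prod (PP n sig α β q)))
      ((gaussPrior n (sig ^ 2)).prod (GG (KK n))) ∧
    Vn n sig α β q1 =
      2 / (n:ℝ) ^ 2 * ∑ p, ∫ q, Ak (gaussPrior n (sig ^ 2)) vs vs (cs n α β) (Sum.inl p) q ^ 2
        ∂((gaussPrior n (sig ^ 2)).prod (GG (KK n))) +
      -(2 * q1 / n) * ∑ i, ∫ q, Ak (gaussPrior n (sig ^ 2)) vs vs (cs n α β) (Sum.inr i) q ^ 2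
        ∂((gaussPrior n (sig ^ 2)).prod (GG (KK n))) + q1 ^ 2 := by
  have hL := vs_L2 n (sig ^ 2)
  have hcp : ∀ k, 0 < cs n α β k := by
    rintro (k | k)
    · exact Real.sqrt_pos.2 hα
    · exact Real.sqrt_pos.2 hβ
  have hi : ∀ k, Integrable (fun q => Ak (gaussPrior n (sig ^ 2)) vs vs (cs n α β) k q ^ 2)
      ((gaussPrior n (sig ^ 2)).prod (GG (KK n))) := fun k =>
    (Ak_memLp hL hL (fun k => (hcp k).le) k (hcp k)).integrable_sq
  have e : (fun q => ∫ z, (dt z.1 z.2 / n - q1) ^ 2 ∂((PP n sig α β q).prod (PP n sig α β q))) = fun q =>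
      2 / (n:ℝ) ^ 2 * ∑ p, Ak (gaussPrior n (sig ^ 2)) vs vs (cs n α β) (Sum.inl p) q ^ 2 +
      -(2 * q1 / n) * ∑ i, Ak (gaussPrior n (sig ^ 2)) vs vs (cs n α β) (Sum.inr i) q ^ 2 + q1 ^ 2 := by
    ext q
    exact (pair_R (fun k => PP_int (hL.int k)) q1).2
  have l := lin2 (integrable_finsetSum Finset.univ fun p _ => hi (Sum.inl p)) (integrable_finsetSum Finset.univ fun i _ => hi (Sum.inr i))
    (2 / (n:ℝ) ^ 2) (-(2 * q1 / n)) (q1 ^ 2)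
  unfold Vn
  rw [e]
  refine ⟨l.1, l.2.trans ?_⟩
  rw [integral_finsetSum _ fun p _ => hi (Sum.inl p), integral_finsetSum _ fun i _ => hi (Sum.inr i)]

/-- the interpolating free energy in the Bayes-optimal model -/
def FB (n : ℕ) (sig lam1 q1 t : ℝ) : ℝ :=
  FF (gaussPrior n (sig ^ 2)) (gaussPrior n (sig ^ 2)) vs vs
    (cs n (0 + lam1 / n * t) (lam1 * q1 + -(lam1 * q1) * t))

def Kn (n : ℕ) (sig q1 : ℝ) : ℝ := -q1 ^ 2 - Sn n sig + 2 * q1 * sig ^ 2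

theorem FB_deriv {n : ℕ} (hn : 0 < n) {sig lam1 q1 t : ℝ} (hl : 0 < lam1) (hq : 0 < q1) (h0 : 0 < t) (h1 : t < 1) :
    HasDerivAt (FB n sig lam1 q1) (n * lam1 / 4 * (Vn n sig (0 + lam1 / n * t) (lam1 * q1 + -(lam1 * q1) * t) q1 + Kn n sig q1)) t := by
  have hn' : (0:ℝ) < n := by exact_mod_cast hn
  have hL := vs_L2 n (sig ^ 2)
  have p1 : 0 < 0 + lam1 / n * t := by rw [zero_add]; positivity
  have p2 : 0 < lam1 * q1 + -(lam1 * q1) * t := by nlinarith [mul_pos (mul_pos hl hq) (sub_pos.2 h1)]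
  have hd := FF_cs_deriv hL hL 0 (lam1 / n) (lam1 * q1) (-(lam1 * q1)) t (Or.inl p1) (Or.inl p2)
  refine hd.congr_deriv ?_
  rw [(Vn_eq q1 p1 p2).2]
  have hcp : ∀ k, 0 < cs n (0 + lam1 / n * t) (lam1 * q1 + -(lam1 * q1) * t) k := by
    rintro (k | k)
    · exact Real.sqrt_pos.2 p1
    · exact Real.sqrt_pos.2 p2
  simp_rw [fun k => nish_sq hL (fun k => (hcp k).le) k (hcp k)]
  rw [Finset.sum_sub_distrib, Finset.sum_sub_distrib, sum_vm_sq_int]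
  have e : ∑ i : Fin n, ∫ x, vs x (Sum.inr i) ^ 2 ∂(gaussPrior n (sig ^ 2)) = n * sig ^ 2 := by
    have : ∀ i : Fin n, ∫ x, vs x (Sum.inr i) ^ 2 ∂(gaussPrior n (sig ^ 2)) = sig ^ 2 := fun i => prior_sq sig i
    simp [this]
  rw [e, Kn]
  field_simp
  ring

theorem FB_cont (n : ℕ) (sig lam1 q1 : ℝ) : ContinuousOn (FB n sig lam1 q1) (Set.Icc 0 1) := by
  refine FF_cont (vs_L2 n (sig ^ 2)) (vs_L2 n (sig ^ 2)) (c := fun t => cs n (0 + lam1 / n * t) (lam1 * q1 + -(lam1 * q1) * t))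
    (fun k => ?_) (fun t ht => cs_nonneg n _ _)
  rcases k with k | k <;> simp only [cs, Sum.elim_inl, Sum.elim_inr] <;> fun_prop

theorem integral_nq_yr (n : ℕ) (sig : ℝ) {β : ℝ} (hβ : 0 ≤ β) (α : ℝ) :
    Integrable (fun q : (Fin n → ℝ) × (KK n → ℝ) => nq (yr (Yv (cs n α β) (vs q.1) q.2))) ((gaussPrior n (sig ^ 2)).prod (GG (KK n))) ∧
    ∫ q : (Fin n → ℝ) × (KK n → ℝ), nq (yr (Yv (cs n α β) (vs q.1) q.2)) ∂((gaussPrior n (sig ^ 2)).prod (GG (KK n))) = n * (1 + β * sig ^ 2) := by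
  have hL := vs_L2 n (sig ^ 2)
  have h : ∀ i : Fin n, Integrable (fun q : (Fin n → ℝ) × (KK n → ℝ) => yr (Yv (cs n α β) (vs q.1) q.2) i ^ 2) ((gaussPrior n (sig ^ 2)).prod (GG (KK n))) ∧
      ∫ q : (Fin n → ℝ) × (KK n → ℝ), yr (Yv (cs n α β) (vs q.1) q.2) i ^ 2 ∂((gaussPrior n (sig ^ 2)).prod (GG (KK n))) = 1 + β * sig ^ 2 := by
    intro i
    have ig : Integrable (fun q : (Fin n → ℝ) × (KK n → ℝ) => q.2 (Sum.inr i) ^ 2) ((gaussPrior n (sig ^ 2)).prod (GG (KK n))) :=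
      (g_memLp (Sum.inr i)).integrable_sq
    have is : Integrable (fun q : (Fin n → ℝ) × (KK n → ℝ) => q.1 i ^ 2) ((gaussPrior n (sig ^ 2)).prod (GG (KK n))) :=
      (w_memLp hL (Sum.inr i)).integrable_sq
    have ix : Integrable (fun q : (Fin n → ℝ) × (KK n → ℝ) => q.1 i * q.2 (Sum.inr i)) ((gaussPrior n (sig ^ 2)).prod (GG (KK n))) :=
      (w_memLp hL (Sum.inr i)).integrable_mul (g_memLp (Sum.inr i))
    have l := lin3 ig is ix 1 β (2 * √β) 0
    have e : (fun q : (Fin n → ℝ) × (KK n → ℝ) => yr (Yv (cs n α β) (vs q.1) q.2) i ^ 2) = fun q =>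
        1 * q.2 (Sum.inr i) ^ 2 + β * q.1 i ^ 2 + (2 * √β) * (q.1 i * q.2 (Sum.inr i)) + 0 := by
      ext q
      simp only [yr, Yv, cs, vs, Sum.elim_inr]
      have := Real.sq_sqrt hβ
      linear_combination (q.1 i ^ 2) * this
    rw [e]
    refine ⟨l.1, l.2.trans ?_⟩
    have e1 : ∫ q : (Fin n → ℝ) × (KK n → ℝ), q.2 (Sum.inr i) ^ 2 ∂((gaussPrior n (sig ^ 2)).prod (GG (KK n))) = 1 := by
      rw [integral_fun_snd (f := fun g : KK n → ℝ => g (Sum.inr i) ^ 2)]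
      have := GG_cov (κ := KK n) (Sum.inr i) (Sum.inr i)
      simpa [sq] using this
    have e2 : ∫ q : (Fin n → ℝ) × (KK n → ℝ), q.1 i ^ 2 ∂((gaussPrior n (sig ^ 2)).prod (GG (KK n))) = sig ^ 2 := by
      rw [integral_fun_fst (f := fun s : Fin n → ℝ => s i ^ 2), prior_sq]; simp
    have e3 : ∫ q : (Fin n → ℝ) × (KK n → ℝ), q.1 i * q.2 (Sum.inr i) ∂((gaussPrior n (sig ^ 2)).prod (GG (KK n))) = 0 := by
      rw [integral_prod_mul (fun s : Fin n → ℝ => s i) (fun g : KK n → ℝ => g (Sum.inr i)), GG_mean]; simp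
    rw [e1, e2, e3]; ring
  refine ⟨integrable_finsetSum _ fun i _ => (h i).1, ?_⟩
  unfold nq
  rw [integral_finsetSum _ fun i _ => (h i).1]
  simp [(h _).2]
  ring

theorem FB_zero {n : ℕ} {sig lam1 q1 : ℝ} (hs : 0 < sig) (hl : 0 < lam1) (hq : 0 < q1) :
    FB n sig lam1 q1 0 = -(n:ℝ) ^ 2 / 2 - n / 2 - n / 2 * Real.log (1 + lam1 * q1 * sig ^ 2) := by
  have hL := vs_L2 n (sig ^ 2)
  have hv : 0 < sig ^ 2 := by positivity
  unfold FB
  simp only [mul_zero, add_zero]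
  set β := lam1 * q1 with hβd
  have hβ : 0 < β := mul_pos hl hq
  have key : ∀ y : KK n → ℝ, Real.log (Zp (gaussPrior n (sig ^ 2)) vs (cs n 0 β) y) =
      -(1 / 2) * ysq y + (β * sig ^ 2 / (2 * (1 + β * sig ^ 2))) * nq (yr y) + (-(n / 2 * Real.log (1 + β * sig ^ 2))) := by
    intro y
    have h := Zp_prior (n := n) le_rfl hβ.le hv y
    have ha : 0 < 1 / sig ^ 2 + β := by positivity
    have hg := gaussian_nd n (1 / sig ^ 2 + β) (fun i => √β * yr y i) ha
    have e : ∀ x : Fin n → ℝ, ham (1 / sig ^ 2) 0 y x + (√β * dt (yr y) x - β * nq x / 2) =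
        -(1 / sig ^ 2 + β) * (∑ i, x i ^ 2) / 2 + ∑ i, √β * yr y i * x i := by
      intro x
      have : ∑ i, √β * yr y i * x i = √β * dt (yr y) x := by simp only [dt, Finset.mul_sum, mul_assoc]
      rw [this]; unfold ham; simp [nq]; ring
    simp_rw [e] at h
    rw [hg.2] at h
    have hZ := Zp_pos (ν := gaussPrior n (sig ^ 2)) vs_meas (cs n 0 β) y
    have h2 := congrArg Real.log h
    rw [Real.log_mul (by positivity) (by positivity), Real.log_exp, Real.log_rpow (by positivity),
      Real.log_mul (by positivity) (mul_pos (Real.exp_pos _) hZ).ne', Real.log_mul (Real.exp_pos _).ne' hZ.ne', Real.log_exp,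
      Real.log_rpow (by positivity)] at h2
    have e3 : ∑ i, (√β * yr y i) ^ 2 = β * nq (yr y) := by
      simp only [mul_pow, Real.sq_sqrt hβ.le, nq, Finset.mul_sum]
    rw [e3] at h2
    have e4 : β * nq (yr y) / (2 * (1 / sig ^ 2 + β)) = (β * sig ^ 2 / (2 * (1 + β * sig ^ 2))) * nq (yr y) := by
      field_simp
    have e5 : 2 * Real.pi / (1 / sig ^ 2 + β) = 2 * Real.pi * sig ^ 2 / (1 + β * sig ^ 2) := by field_simp
    rw [e4, e5, Real.log_div (by positivity) (by positivity)] at h2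
    linarith
  unfold FF
  simp_rw [key]
  have l := lin2 (ysq_int hL (cs n 0 β)) (integral_nq_yr n sig hβ.le 0).1 (-(1 / 2)) (β * sig ^ 2 / (2 * (1 + β * sig ^ 2)))
    (-(n / 2 * Real.log (1 + β * sig ^ 2)))
  refine l.2.trans ?_
  rw [integral_ysq hL, (integral_nq_yr n sig hβ.le 0).2, Fintype.sum_sum_type]
  have e : ∀ i : Fin n, ∫ x, vs x (Sum.inr i) ^ 2 ∂(gaussPrior n (sig ^ 2)) = sig ^ 2 := fun i => prior_sq sig i
  simp only [cs, Sum.elim_inl, Sum.elim_inr, Real.sqrt_zero, Real.sq_sqrt hβ.le, e]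
  simp
  field_simp
  ring

theorem FB_one {n : ℕ} (hn : 0 < n) {sig lam1 q1 : ℝ} (hs : 0 < sig) (hl : 0 < lam1) :
    FB n sig lam1 q1 1 = n * (XX n sig (1 / sig ^ 2) lam1 - (1 / 2) * Real.log (2 * Real.pi * sig ^ 2)
      - ((n:ℝ) + 1) / 2 - lam1 * Sn n sig / 4) := by
  have hn' : (0:ℝ) < n := by exact_mod_cast hn
  rw [← Phi_XX hn sig hs hl, FB, Phi]
  simp
  field_simp

end

set_option linter.all false
set_option linter.deprecated false
noncomputable section

theorem Uf_bayes {sig lam1 : ℝ} (hs : 0 < sig) (hl : 1 < lam1 * sig ^ 4) :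
    Uf (1 / sig ^ 2) lam1 0 (sig ^ 2) - (1 / 2) * Real.log (2 * Real.pi * sig ^ 2) + (1 / 2) * Real.log (lam1 * sig ^ 4) +
      lam1 * (sig ^ 2 - 1 / (lam1 * sig ^ 2)) ^ 2 / 4 - lam1 * (sig ^ 2 - 1 / (lam1 * sig ^ 2)) * sig ^ 2 / 2 = 0 := by
  have hl0 : 0 < lam1 := by
    by_contra h
    have : lam1 * sig ^ 4 ≤ 0 := mul_nonpos_of_nonpos_of_nonneg (not_lt.1 h) (by positivity)
    linarith
  have hm : max (1 / sig ^ 2) ((lam1 + 0) * sig ^ 2) = lam1 * sig ^ 2 := by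
    rw [add_zero]
    refine max_eq_right ?_
    rw [div_le_iff₀ (by positivity)]; nlinarith
  rw [Uf, hm, add_zero, Real.log_div (by positivity) (by positivity), Real.log_mul (by positivity) (by positivity),
    Real.log_mul (by positivity) (by positivity), Real.log_mul (by positivity) (by positivity),
    Real.log_mul (by positivity) (by positivity),
    Real.log_mul (by positivity) (by positivity), Real.log_pow, Real.log_pow]
  push_cast
  field_simp
  ring

theorem Bayes_overlap {sig lam lam1 : ℝ} (hs : 0 < sig) (hl : 0 < lam) (hl1 : lam < lam1) (h1 : 1 < lam1 * sig ^ 4)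
    {η : ℝ} (hη : 0 < η) : ∀ᶠ n : ℕ in atTop, ∃ t, lam / lam1 < t ∧ t < 1 ∧
      Vn n sig (0 + lam1 / n * t) (lam1 * (sig ^ 2 - 1 / (lam1 * sig ^ 2)) + -(lam1 * (sig ^ 2 - 1 / (lam1 * sig ^ 2))) * t)
        (sig ^ 2 - 1 / (lam1 * sig ^ 2)) ≤ η ∧
      -(n:ℝ) ^ 2 / 2 - n / 2 - n / 2 * Real.log (lam1 * sig ^ 4) +
        n * lam1 / 4 * t * Kn n sig (sig ^ 2 - 1 / (lam1 * sig ^ 2)) ≤ FB n sig lam1 (sig ^ 2 - 1 / (lam1 * sig ^ 2)) t := by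
  have hl10 : 0 < lam1 := hl.trans hl1
  set q1 := sig ^ 2 - 1 / (lam1 * sig ^ 2) with hq1
  have hq : 0 < q1 := by
    rw [hq1, sub_pos, div_lt_iff₀ (by positivity)]
    nlinarith
  have hlq : 1 + lam1 * q1 * sig ^ 2 = lam1 * sig ^ 4 := by
    rw [hq1]; field_simp; ring
  set t0 := lam / lam1 with ht0
  have ht0p : 0 < t0 := by positivity
  have ht01 : t0 < 1 := (div_lt_one hl10).2 hl1
  set η' := η * (1 - t0) * lam1 / 4 with hη'
  have hη'p : 0 < η' := by
    have : 0 < 1 - t0 := by linarith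
    positivity
  obtain ⟨δ, hδ, hub⟩ := XX_ub hs hl10 (1 / sig ^ 2) hη'p
  filter_upwards [hub, eventually_gt_atTop 0] with n hn1 hn
  have hn' : (0:ℝ) < n := by exact_mod_cast hn
  have hX := hn1 lam1 le_rfl (by linarith)
  have hU := Uf_bayes hs h1
  rw [← hq1] at hU
  set f := FB n sig lam1 q1 with hf
  have hcont : ContinuousOn f (Set.Icc 0 1) := FB_cont n sig lam1 q1
  have hd : ∀ t, 0 < t → t < 1 → HasDerivAt f (n * lam1 / 4 * (Vn n sig (0 + lam1 / n * t) (lam1 * q1 + -(lam1 * q1) * t) q1 + Kn n sig q1)) t :=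
    fun t h0 h1 => FB_deriv hn hl10 hq h0 h1
  have hlow : ∀ t, 0 < t → t < 1 → f 0 + n * lam1 / 4 * t * Kn n sig q1 ≤ f t := by
    intro t h0 h1
    obtain ⟨u, hu, hue⟩ := exists_deriv_eq_slope f h0 (hcont.mono (Set.Icc_subset_Icc le_rfl h1.le))
      (fun u hu => (hd u hu.1 (hu.2.trans h1)).differentiableAt.differentiableWithinAt)
    rw [(hd u hu.1 (hu.2.trans h1)).deriv, eq_div_iff (by linarith), sub_zero] at hue
    have := Vn_nonneg n sig (0 + lam1 / n * u) (lam1 * q1 + -(lam1 * q1) * u) q1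
    have h3 : 0 ≤ n * lam1 / 4 * Vn n sig (0 + lam1 / n * u) (lam1 * q1 + -(lam1 * q1) * u) q1 * t := by positivity
    nlinarith
  obtain ⟨u, hu, hue⟩ := exists_deriv_eq_slope f ht01 (hcont.mono (Set.Icc_subset_Icc ht0p.le le_rfl))
      (fun u hu => (hd u (ht0p.trans hu.1) hu.2).differentiableAt.differentiableWithinAt)
  have hu0 : 0 < u := ht0p.trans hu.1
  have h0e : f 0 = -(n:ℝ) ^ 2 / 2 - n / 2 - n / 2 * Real.log (lam1 * sig ^ 4) := by
    rw [← hlq]; exact FB_zero hs hl10 hq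
  refine ⟨u, hu.1, hu.2, ?_, ?_⟩
  · rw [(hd u hu0 hu.2).deriv, eq_div_iff (by linarith)] at hue
    have h1e := FB_one (q1 := q1) hn hs hl10
    have hl0 := hlow t0 ht0p ht01
    rw [← hf] at h1e
    have e : f 1 - f 0 - n * lam1 / 4 * Kn n sig q1 ≤ n * η' := by
      rw [h1e, h0e, Kn]
      have : (n:ℝ) * (XX n sig (1 / sig ^ 2) lam1) ≤ n * (Uf (1 / sig ^ 2) lam1 0 (sig ^ 2) + η') :=
        mul_le_mul_of_nonneg_left hX hn'.le
      have h2 := congrArg (fun z => (n:ℝ) * z) hU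
      simp only [mul_zero] at h2
      nlinarith
    set V := Vn n sig (0 + lam1 / n * u) (lam1 * q1 + -(lam1 * q1) * u) q1
    have h4 : (n * lam1 / 4 * (1 - t0)) * V ≤ (n * lam1 / 4 * (1 - t0)) * η := by
      rw [hη'] at e
      nlinarith
    have h5 : 0 < n * lam1 / 4 * (1 - t0) := by
      have : 0 < 1 - t0 := by linarith
      positivity
    exact le_of_mul_le_mul_left h4 h5
  · rw [← h0e]; exact hlow u hu0 hu.2

end

set_option linter.all false
set_option linter.deprecated false
noncomputable section

/-- rotation of a pair -/
def rot (n : ℕ) (c s : ℝ) : ((Fin n → ℝ) × (Fin n → ℝ)) →ₗ[ℝ] ((Fin n → ℝ) × (Fin n → ℝ)) :=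
  LinearMap.prod (c • LinearMap.fst ℝ _ _ + s • LinearMap.snd ℝ _ _)
    ((-s) • LinearMap.fst ℝ _ _ + c • LinearMap.snd ℝ _ _)

def flipJ (n : ℕ) : ((Fin n → ℝ) × (Fin n → ℝ)) →ₗ[ℝ] ((Fin n → ℝ) × (Fin n → ℝ)) :=
  LinearMap.prod (-LinearMap.fst ℝ _ _) (LinearMap.snd ℝ _ _)

theorem rot_det (n : ℕ) {c s : ℝ} (h : c ^ 2 + s ^ 2 = 1) : |LinearMap.det (rot n c s)| = 1 := by
  have e1 : rot n c s ∘ₗ rot n c (-s) = LinearMap.id := by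
    apply LinearMap.ext
    rintro ⟨a, b⟩
    ext i
    · simp [rot]
      linear_combination (a i) * h
    · simp [rot]
      linear_combination (b i) * h
  have e2 : flipJ n ∘ₗ flipJ n = LinearMap.id := by
    apply LinearMap.ext
    rintro ⟨a, b⟩
    ext i <;> simp [flipJ]
  have e3 : rot n c (-s) = flipJ n ∘ₗ (rot n c s ∘ₗ flipJ n) := by
    apply LinearMap.ext
    rintro ⟨a, b⟩
    ext i
    · simp [flipJ, rot]
      ring
    · simp [flipJ, rot]
  have d1 := congrArg LinearMap.det e1
  have d2 := congrArg LinearMap.det e2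
  have d3 := congrArg LinearMap.det e3
  rw [LinearMap.det_comp, LinearMap.det_id] at d1 d2
  rw [LinearMap.det_comp, LinearMap.det_comp] at d3
  rw [d3] at d1
  have : LinearMap.det (rot n c s) ^ 2 = 1 := by
    linear_combination d1 - LinearMap.det (rot n c s) ^ 2 * d2
  have h2 : (LinearMap.det (rot n c s) - 1) * (LinearMap.det (rot n c s) + 1) = 0 := by
    linear_combination this
  rcases mul_eq_zero.1 h2 with h | h
  · rw [sub_eq_zero.1 h, abs_one]
  · rw [eq_neg_of_add_eq_zero_left h, abs_neg, abs_one]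

theorem rot_mp (n : ℕ) {c s : ℝ} (h : c ^ 2 + s ^ 2 = 1) :
    MeasurePreserving (rot n c s) ((volume : Measure (Fin n → ℝ)).prod (volume : Measure (Fin n → ℝ)))
      ((volume : Measure (Fin n → ℝ)).prod (volume : Measure (Fin n → ℝ))) := by
  haveI : Measure.IsAddHaarMeasure ((volume : Measure (Fin n → ℝ)).prod (volume : Measure (Fin n → ℝ))) :=
    Measure.prod.instIsAddHaarMeasure _ _
  have hd := rot_det n h
  have h0 : LinearMap.det (rot n c s) ≠ 0 := by
    intro h1; rw [h1] at hd; simp at hd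
  refine ⟨(LinearMap.continuous_of_finiteDimensional _).measurable, ?_⟩
  rw [Measure.map_linearMap_addHaar_eq_smul_addHaar _ h0, abs_inv, hd]
  simp

/-- Lebesgue form of posterior -/
theorem post_vol {n : ℕ} {α β v : ℝ} (hα : 0 ≤ α) (hβ : 0 ≤ β) (hv : 0 < v) (y : KK n → ℝ) :
    post (gaussPrior n v) vs (cs n α β) y = (volume : Measure (Fin n → ℝ)).tilted
      (fun x => ham (1 / v) α y x + (√β * dt (yr y) x - β * nq x / 2)) := by
  have hZ := Zp_prior hα hβ hv y
  have hm : Measurable (fun x : Fin n → ℝ => ham (1 / v) α y x + (√β * dt (yr y) x - β * nq x / 2)) := by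
    have h1 := ham_meas (1 / v) α y
    have h2 : Measurable (fun x : Fin n → ℝ => dt (yr y) x) := by unfold dt; fun_prop
    have h3 : Measurable (fun x : Fin n → ℝ => nq x) := nq_meas
    fun_prop
  unfold Measure.tilted
  rw [hZ, volume_eq_prior n v hv, ← withDensity_mul _ (by fun_prop) (by fun_prop)]
  unfold post Measure.tilted
  congr 1
  ext x
  rw [Pi.mul_apply, ← ENNReal.ofReal_mul (by positivity)]
  congr 1
  have hzp : 0 < Zp (gaussPrior n v) vs (cs n α β) y := Zp_pos vs_meas _ _
  change _ / Zp (gaussPrior n v) vs (cs n α β) y = _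
  dsimp only
  rw [neg_En hα hβ]
  have hC : (2 * Real.pi * v) ^ ((n : ℝ) / 2) ≠ 0 := by positivity
  have e : ∀ C E A Z B N : ℝ, C ≠ 0 → Z ≠ 0 → C * E * (A / (C * (B * Z))) = (E * A / B) / Z := by
    intro C E A Z B N hC hZ
    field_simp
  rw [e _ _ _ _ _ 0 hC hzp.ne', ← Real.exp_add, ← Real.exp_sub]
  congr 2
  unfold ham nq
  field_simp
  ring

theorem jensen_pair {X : Type*} [MeasurableSpace X] {μ : Measure X} [SigmaFinite μ] [NeZero μ] {h : X → ℝ}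
    (hm : Measurable h) (hi : Integrable (fun x => Real.exp (h x)) μ) {f : X × X → ℝ}
    (hf : Integrable f ((μ.tilted h).prod (μ.tilted h)))
    (he : Integrable (fun z : X × X => Real.exp (h z.1 + h z.2 + f z)) (μ.prod μ)) :
    2 * Real.log (∫ x, Real.exp (h x) ∂μ) + ∫ z, f z ∂((μ.tilted h).prod (μ.tilted h)) ≤
      Real.log (∫ z, Real.exp (h z.1 + h z.2 + f z) ∂(μ.prod μ)) := by
  have hZ : 0 < ∫ x, Real.exp (h x) ∂μ := integral_exp_pos hi
  haveI : IsProbabilityMeasure (μ.tilted h) := isProbabilityMeasure_tilted hi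
  have e2 : ∫ z : X × X, Real.exp (h z.1 + h z.2) ∂(μ.prod μ) = (∫ x, Real.exp (h x) ∂μ) ^ 2 := by
    simp_rw [Real.exp_add]
    rw [integral_prod_mul (fun x => Real.exp (h x)) (fun x => Real.exp (h x)), sq]
  have hP : (μ.tilted h).prod (μ.tilted h) = (μ.prod μ).tilted (fun z => h z.1 + h z.2) := by
    unfold Measure.tilted
    rw [prod_withDensity (by fun_prop) (by fun_prop), e2]
    congr 1
    ext z
    rw [← ENNReal.ofReal_mul (by positivity)]
    congr 1
    rw [Real.exp_add]
    field_simp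
  have hpr : IsProbabilityMeasure ((μ.tilted h).prod (μ.tilted h)) := inferInstance
  have hie : Integrable (fun z => Real.exp (f z)) ((μ.prod μ).tilted (fun z => h z.1 + h z.2)) := by
    have i2 : Integrable (fun z : X × X => Real.exp (h z.1 + h z.2)) (μ.prod μ) := by
      simp_rw [Real.exp_add]; exact hi.mul_prod hi
    rw [integrable_tilted_iff i2]
    simpa only [smul_eq_mul, ← Real.exp_add] using he
  rw [hP] at hf hpr ⊢
  have hj := convexOn_exp.map_integral_le (μ := (μ.prod μ).tilted (fun z => h z.1 + h z.2)) (f := f)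
    Real.continuous_exp.continuousOn isClosed_univ (by simp) hf hie
  rw [integral_tilted (fun z : X × X => h z.1 + h z.2) (fun z => Real.exp (f z)), e2] at hj
  have e4 : ∫ z, (Real.exp (h z.1 + h z.2) / (∫ x, Real.exp (h x) ∂μ) ^ 2) • Real.exp (f z) ∂(μ.prod μ) =
      (∫ z, Real.exp (h z.1 + h z.2 + f z) ∂(μ.prod μ)) / (∫ x, Real.exp (h x) ∂μ) ^ 2 := by
    rw [← integral_div]
    congr 1
    ext z
    rw [Real.exp_add (h z.1 + h z.2), smul_eq_mul]; ring
  rw [e4, le_div_iff₀ (by positivity)] at hj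
  have hl := Real.log_le_log (by positivity) hj
  rw [Real.log_mul (by positivity) (by positivity), Real.log_exp, Real.log_pow] at hl
  push_cast at hl
  linarith
end

set_option linter.all false
set_option linter.deprecated false
noncomputable section

theorem rot_fst (n : ℕ) (c s : ℝ) (z : (Fin n → ℝ) × (Fin n → ℝ)) (i : Fin n) :
    (rot n c s z).1 i = c * z.1 i + s * z.2 i := by simp [rot]
theorem rot_snd (n : ℕ) (c s : ℝ) (z : (Fin n → ℝ) × (Fin n → ℝ)) (i : Fin n) :
    (rot n c s z).2 i = -s * z.1 i + c * z.2 i := by simp [rot]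

theorem lpm_rot {n : ℕ} {c s : ℝ} (h : c ^ 2 + s ^ 2 = 1) (y : KK n → ℝ) (z : (Fin n → ℝ) × (Fin n → ℝ)) :
    lpm y (rot n c s z).1 + lpm y (rot n c s z).2 = lpm y z.1 + lpm y z.2 := by
  unfold lpm
  rw [← Finset.sum_add_distrib, ← Finset.sum_add_distrib]
  refine Finset.sum_congr rfl fun p _ => ?_
  have key : ∀ A B C D : ℝ, (c * A + s * B) * (c * C + s * D) + (-s * A + c * B) * (-s * C + c * D) = A * C + B * D := by
    intro A B C D
    linear_combination (A * C + B * D) * h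
  have k := key (z.1 p.1) (z.2 p.1) (z.1 p.2) (z.2 p.2)
  unfold vm
  rw [rot_fst, rot_fst, rot_snd, rot_snd]
  split_ifs
  · linear_combination y (Sum.inl p) * k
  · linear_combination y (Sum.inl p) / √2 * k
  · ring

theorem nq_rot1 {n : ℕ} (c s : ℝ) (z : (Fin n → ℝ) × (Fin n → ℝ)) :
    nq (rot n c s z).1 = c ^ 2 * nq z.1 + s ^ 2 * nq z.2 + 2 * c * s * dt z.1 z.2 := by
  unfold nq dt
  simp_rw [rot_fst]
  rw [Finset.mul_sum, Finset.mul_sum, Finset.mul_sum, ← Finset.sum_add_distrib, ← Finset.sum_add_distrib]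
  refine Finset.sum_congr rfl fun p _ => ?_
  ring

theorem nq_rot2 {n : ℕ} (c s : ℝ) (z : (Fin n → ℝ) × (Fin n → ℝ)) :
    nq (rot n c s z).2 = s ^ 2 * nq z.1 + c ^ 2 * nq z.2 - 2 * c * s * dt z.1 z.2 := by
  unfold nq dt
  simp_rw [rot_snd]
  rw [Finset.mul_sum, Finset.mul_sum, Finset.mul_sum, ← Finset.sum_add_distrib, ← Finset.sum_sub_distrib]
  refine Finset.sum_congr rfl fun p _ => ?_
  ring

theorem ham_rot {n : ℕ} (hn : 0 < n) {c s lh γ η0 q1 : ℝ} (hl : 0 < lh) (h : c ^ 2 + s ^ 2 = 1)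
    (hS : 2 * c * s * (lh * q1) = -η0) (y : KK n → ℝ) (z : (Fin n → ℝ) × (Fin n → ℝ)) :
    ham γ (lh / n) y z.1 + ham γ (lh / n) y z.2 + n * (η0 ^ 2 / (2 * lh) - lh / 2 * (dt z.1 z.2 / n - q1) ^ 2) ≤
      ham (γ + η0) (lh / n) y (rot n c s z).1 + ham (γ - η0) (lh / n) y (rot n c s z).2 := by
  have hn' : (0:ℝ) < n := by exact_mod_cast hn
  have hL := lpm_rot h y z
  have e1 := nq_rot1 c s z
  have e2 := nq_rot2 c s z
  unfold ham
  have hL' : √(lh / n) * lpm y (rot n c s z).1 = √(lh / n) * lpm y z.1 + √(lh / n) * lpm y z.2 - √(lh / n) * lpm y (rot n c s z).2 := by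
    rw [← mul_add, ← mul_sub]; congr 1; linarith
  rw [hL', e1, e2]
  generalize nq z.1 = A
  generalize nq z.2 = B
  generalize dt z.1 z.2 = R
  generalize √(lh / n) * lpm y z.1 = T1
  generalize √(lh / n) * lpm y z.2 = T2
  generalize √(lh / n) * lpm y (rot n c s z).2 = T3
  have hs2 : s ^ 2 = 1 - c ^ 2 := by linarith
  have hη : η0 = -(2 * c * s * (lh * q1)) := by linarith
  have key : -(γ + η0) * (c ^ 2 * A + s ^ 2 * B + 2 * c * s * R) / 2 + (T1 + T2 - T3) - lh / n * (c ^ 2 * A + s ^ 2 * B + 2 * c * s * R) ^ 2 / 4 +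
      (-(γ - η0) * (s ^ 2 * A + c ^ 2 * B - 2 * c * s * R) / 2 + T3 - lh / n * (s ^ 2 * A + c ^ 2 * B - 2 * c * s * R) ^ 2 / 4) -
      (-γ * A / 2 + T1 - lh / n * A ^ 2 / 4 + (-γ * B / 2 + T2 - lh / n * B ^ 2 / 4) + n * (η0 ^ 2 / (2 * lh) - lh / 2 * (R / n - q1) ^ 2)) =
      lh / (8 * n) * (2 * c * s * (A - B) - 2 * (c ^ 2 - s ^ 2) * (R - n * q1)) ^ 2 := by
    rw [hη]
    field_simp
    have e4 : s ^ 4 = (1 - c ^ 2) ^ 2 := by rw [← hs2]; ring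
    have e3 : s ^ 3 = s * (1 - c ^ 2) := by rw [← hs2]; ring
    ring_nf
    simp only [e4, e3, hs2]
    ring
  have : 0 ≤ lh / (8 * n) * (2 * c * s * (A - B) - 2 * (c ^ 2 - s ^ 2) * (R - n * q1)) ^ 2 := by positivity
  linarith

theorem ZL_congr {n : ℕ} {γ α : ℝ} {y y' : KK n → ℝ} (h : ∀ p, y (Sum.inl p) = y' (Sum.inl p)) : ZL γ α y = ZL γ α y' := by
  unfold ZL ham lpm
  simp_rw [h]

theorem pair_lb {n : ℕ} (hn : 0 < n) {lh β sig η0 q1 : ℝ} (hs : 0 < sig) (hl : 0 < lh) (hβ : 0 ≤ β)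
    (hq : 0 < q1) (hη : 0 ≤ η0) (hηq : η0 ≤ lh * q1) (y : KK n → ℝ) :
    2 * ((n:ℝ) / 2 * Real.log (2 * Real.pi * sig ^ 2) + (1 / 2) * ysq y +
        Real.log (Zp (gaussPrior n (sig ^ 2)) vs (cs n (lh / n) β) y)) + n * (η0 ^ 2 / (2 * lh)) +
      -(n * (lh / 2)) * ∫ z, (dt z.1 z.2 / n - q1) ^ 2 ∂((post (gaussPrior n (sig ^ 2)) vs (cs n (lh / n) β) y).prod
          (post (gaussPrior n (sig ^ 2)) vs (cs n (lh / n) β) y)) +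
      (-2) * ∫ x, (√β * dt (yr y) x - β * nq x / 2) ∂(post (gaussPrior n (sig ^ 2)) vs (cs n (lh / n) β) y) ≤
    Real.log (ZL (1 / sig ^ 2 + η0) (lh / n) y) + Real.log (ZL (1 / sig ^ 2 - η0) (lh / n) y) := by
  have hn' : (0:ℝ) < n := by exact_mod_cast hn
  have hv : 0 < sig ^ 2 := by positivity
  have hα : 0 < lh / n := by positivity
  have hlq : 0 < lh * q1 := by positivity
  -- the angle
  obtain ⟨c, s, hcs, hS⟩ : ∃ c s : ℝ, c ^ 2 + s ^ 2 = 1 ∧ 2 * c * s * (lh * q1) = -η0 := by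
    refine ⟨Real.cos (Real.arcsin (-η0 / (lh * q1)) / 2), Real.sin (Real.arcsin (-η0 / (lh * q1)) / 2),
      by rw [add_comm]; exact Real.sin_sq_add_cos_sq _, ?_⟩
    have := Real.sin_two_mul (Real.arcsin (-η0 / (lh * q1)) / 2)
    rw [mul_div_cancel₀ _ two_ne_zero, Real.sin_arcsin (by rw [le_div_iff₀ hlq]; linarith)
      (by rw [div_le_one hlq]; linarith)] at this
    have h2 : 2 * Real.cos (Real.arcsin (-η0 / (lh * q1)) / 2) * Real.sin (Real.arcsin (-η0 / (lh * q1)) / 2) = -η0 / (lh * q1) := by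
      refine Eq.trans ?_ this.symm; ring
    rw [h2]; field_simp
  set P := post (gaussPrior n (sig ^ 2)) vs (cs n (lh / n) β) y with hP
  haveI : IsProbabilityMeasure P := post_prob vs_meas _ _
  set sd : (Fin n → ℝ) → ℝ := fun x => √β * dt (yr y) x - β * nq x / 2 with hsd
  have hL := vs_L2 n (sig ^ 2)
  have isd : Integrable sd P := by
    have i0 : Integrable (fun x : Fin n → ℝ => dt (yr y) x) (gaussPrior n (sig ^ 2)) := by
      unfold dt
      exact integrable_finsetSum _ fun i _ => ((prior_memLp (sig ^ 2) i 2 (by norm_num)).integrable (by norm_num)).const_mul _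
    have i1 := (integral_nq n sig).1
    have i2 : Integrable sd (gaussPrior n (sig ^ 2)) := (i0.const_mul (√β)).sub ((i1.const_mul β).div_const 2)
    exact post_int vs_meas _ _ i2
  have hpr := pair_R (P := P) (fun k => post_int vs_meas _ _ (hL.int k)) q1
  set f : (Fin n → ℝ) × (Fin n → ℝ) → ℝ := fun z =>
    n * (η0 ^ 2 / (2 * lh)) - n * (lh / 2) * (dt z.1 z.2 / n - q1) ^ 2 - sd z.1 - sd z.2 with hf
  have j1 : Integrable (fun z : (Fin n → ℝ) × (Fin n → ℝ) => sd z.1) (P.prod P) := isd.comp_fst P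
  have j2 : Integrable (fun z : (Fin n → ℝ) × (Fin n → ℝ) => sd z.2) (P.prod P) := isd.comp_snd P
  have hl3 := lin3 hpr.1 j1 j2 (-(n * (lh / 2))) (-1) (-1) (n * (η0 ^ 2 / (2 * lh)))
  have efl : (fun z : (Fin n → ℝ) × (Fin n → ℝ) => -(n * (lh / 2)) * (dt z.1 z.2 / n - q1) ^ 2 + (-1) * sd z.1 + (-1) * sd z.2 + n * (η0 ^ 2 / (2 * lh))) = f := by
    ext z; simp only [hf]; ring
  have e1 : ∫ z : (Fin n → ℝ) × (Fin n → ℝ), sd z.1 ∂(P.prod P) = ∫ x, sd x ∂P := by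
    rw [integral_fun_fst (f := sd)]; simp
  have e2 : ∫ z : (Fin n → ℝ) × (Fin n → ℝ), sd z.2 ∂(P.prod P) = ∫ x, sd x ∂P := by
    rw [integral_fun_snd (f := sd)]; simp
  have fint : Integrable f (P.prod P) := by rw [← efl]; exact hl3.1
  have fval : ∫ z, f z ∂(P.prod P) = -(n * (lh / 2)) * ∫ z, (dt z.1 z.2 / n - q1) ^ 2 ∂(P.prod P) +
      (-2) * ∫ x, sd x ∂P + n * (η0 ^ 2 / (2 * lh)) := by
    rw [← efl]
    have := hl3.2
    rw [e1, e2] at this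
    rw [this]; ring
  set h : (Fin n → ℝ) → ℝ := fun x => ham (1 / sig ^ 2) (lh / n) y x + (√β * dt (yr y) x - β * nq x / 2) with hh
  have hPv : P = (volume : Measure (Fin n → ℝ)).tilted h := post_vol hα.le hβ hv y
  have mdt : Measurable (fun x : Fin n → ℝ => dt (yr y) x) := (dt_cont _).measurable
  have mnq : Measurable (fun x : Fin n → ℝ => nq x) := nq_meas
  have mham := ham_meas (1 / sig ^ 2) (lh / n) y
  have hm : Measurable h := by
    simp only [hh]; fun_prop
  have hZ := Zp_prior hα.le hβ hv y
  have hzp : 0 < Zp (gaussPrior n (sig ^ 2)) vs (cs n (lh / n) β) y := Zp_pos vs_meas _ _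
  have hi : Integrable (fun x => Real.exp (h x)) := by
    by_contra hc
    have := integral_undef hc
    simp only [hh] at this
    rw [hZ] at this
    have : 0 < (2 * Real.pi * sig ^ 2) ^ ((n:ℝ) / 2) * (Real.exp ((1 / 2) * ysq y) *
        Zp (gaussPrior n (sig ^ 2)) vs (cs n (lh / n) β) y) := by positivity
    linarith
  -- rotated integral
  have hmp := rot_mp n hcs
  have i1 := exp_ham_int hα (1 / sig ^ 2 + η0) y
  have i2 := exp_ham_int hα (1 / sig ^ 2 - η0) y
  have ip : Integrable (fun z : (Fin n → ℝ) × (Fin n → ℝ) => Real.exp (ham (1 / sig ^ 2 + η0) (lh / n) y z.1) *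
      Real.exp (ham (1 / sig ^ 2 - η0) (lh / n) y z.2)) (volume.prod volume) := i1.mul_prod i2
  have vp : ∫ z : (Fin n → ℝ) × (Fin n → ℝ), Real.exp (ham (1 / sig ^ 2 + η0) (lh / n) y z.1) *
      Real.exp (ham (1 / sig ^ 2 - η0) (lh / n) y z.2) ∂(volume.prod volume) =
      ZL (1 / sig ^ 2 + η0) (lh / n) y * ZL (1 / sig ^ 2 - η0) (lh / n) y :=
    integral_prod_mul (fun x => Real.exp (ham (1 / sig ^ 2 + η0) (lh / n) y x)) (fun x => Real.exp (ham (1 / sig ^ 2 - η0) (lh / n) y x))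
  have ipr : Integrable (fun z : (Fin n → ℝ) × (Fin n → ℝ) => Real.exp (ham (1 / sig ^ 2 + η0) (lh / n) y (rot n c s z).1) *
      Real.exp (ham (1 / sig ^ 2 - η0) (lh / n) y (rot n c s z).2)) (volume.prod volume) :=
    hmp.integrable_comp_of_integrable ip
  have vpr : ∫ z : (Fin n → ℝ) × (Fin n → ℝ), Real.exp (ham (1 / sig ^ 2 + η0) (lh / n) y (rot n c s z).1) *
      Real.exp (ham (1 / sig ^ 2 - η0) (lh / n) y (rot n c s z).2) ∂(volume.prod volume) =
      ∫ z : (Fin n → ℝ) × (Fin n → ℝ), Real.exp (ham (1 / sig ^ 2 + η0) (lh / n) y z.1) *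
      Real.exp (ham (1 / sig ^ 2 - η0) (lh / n) y z.2) ∂(volume.prod volume) := by
    have hae := ip.aestronglyMeasurable
    rw [← hmp.map_eq] at hae
    have := integral_map hmp.measurable.aemeasurable hae
    rw [hmp.map_eq] at this
    exact this.symm
  have hpt : ∀ z : (Fin n → ℝ) × (Fin n → ℝ), Real.exp (h z.1 + h z.2 + f z) ≤
      Real.exp (ham (1 / sig ^ 2 + η0) (lh / n) y (rot n c s z).1) *
      Real.exp (ham (1 / sig ^ 2 - η0) (lh / n) y (rot n c s z).2) := by
    intro z
    rw [← Real.exp_add]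
    refine Real.exp_le_exp.2 (le_trans (le_of_eq ?_) (ham_rot hn hl hcs hS y z))
    simp only [hh, hf, hsd]
    ring
  have mf : Measurable f := by
    have md : Measurable (fun z : (Fin n → ℝ) × (Fin n → ℝ) => dt z.1 z.2) := by unfold dt; fun_prop
    simp only [hf, hsd]; fun_prop
  have he : Integrable (fun z : (Fin n → ℝ) × (Fin n → ℝ) => Real.exp (h z.1 + h z.2 + f z)) (volume.prod volume) := by
    refine ipr.mono' (by fun_prop) (ae_of_all _ fun z => ?_)
    rw [Real.norm_eq_abs, abs_of_pos (Real.exp_pos _)]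
    exact hpt z
  have hj := jensen_pair hm hi (f := f) (by rw [← hPv]; exact fint) he
  rw [← hPv, fval, hZ, Real.log_mul (by positivity) (by positivity), Real.log_mul (by positivity) (by positivity),
    Real.log_exp, Real.log_rpow (by positivity)] at hj
  have hfin : Real.log (∫ z : (Fin n → ℝ) × (Fin n → ℝ), Real.exp (h z.1 + h z.2 + f z) ∂(volume.prod volume)) ≤
      Real.log (ZL (1 / sig ^ 2 + η0) (lh / n) y) + Real.log (ZL (1 / sig ^ 2 - η0) (lh / n) y) := by
    rw [← Real.log_mul (ZL_pos hα _ y).ne' (ZL_pos hα _ y).ne', ← vp, ← vpr]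
    exact Real.log_le_log (integral_exp_pos he) (integral_mono he ipr hpt)
  linarith
end

set_option linter.all false
set_option linter.deprecated false
noncomputable section

theorem dt_le {n : ℕ} (a b : Fin n → ℝ) : dt a b ≤ (1 / 2) * nq a + (1 / 2) * nq b := by
  unfold dt nq
  rw [Finset.mul_sum, Finset.mul_sum, ← Finset.sum_add_distrib]
  refine Finset.sum_le_sum fun i _ => ?_
  nlinarith [sq_nonneg (a i - b i)]

theorem ysq_val {n : ℕ} (hn : 0 < n) (sig : ℝ) {lh β : ℝ} (hl : 0 ≤ lh) (hβ : 0 ≤ β) :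
    ∫ q : (Fin n → ℝ) × (KK n → ℝ), ysq (Yv (cs n (lh / n) β) (vs q.1) q.2) ∂((gaussPrior n (sig ^ 2)).prod (GG (KK n))) =
      (n:ℝ) ^ 2 + n + n * lh * Sn n sig / 2 + n * β * sig ^ 2 := by
  have hn' : (0:ℝ) < n := by exact_mod_cast hn
  rw [integral_ysq (vs_L2 n (sig ^ 2)), Fintype.sum_sum_type]
  have e1 : ∀ p : Fin n × Fin n, cs n (lh / n) β (Sum.inl p) ^ 2 = lh / n := fun p => by
    simp only [cs, Sum.elim_inl]; exact Real.sq_sqrt (by positivity)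
  have e2 : ∀ p : Fin n, cs n (lh / n) β (Sum.inr p) ^ 2 = β := fun p => by
    simp only [cs, Sum.elim_inr]; exact Real.sq_sqrt hβ
  simp_rw [e1, e2]
  rw [← Finset.mul_sum, sum_vm_sq_int, ← Finset.mul_sum]
  have e3 : ∑ i : Fin n, ∫ s, vs s (Sum.inr i) ^ 2 ∂(gaussPrior n (sig ^ 2)) = n * sig ^ 2 := by
    have : ∀ i : Fin n, ∫ s, vs s (Sum.inr i) ^ 2 ∂(gaussPrior n (sig ^ 2)) = sig ^ 2 := fun i => prior_sq sig i
    simp [this]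
  rw [e3]
  field_simp
  ring

theorem XX_pair_lb {n : ℕ} (hn : 0 < n) {lh β sig η0 q1 : ℝ} (hs : 0 < sig) (hl : 0 < lh) (hβ : 0 < β)
    (hq : 0 < q1) (hη : 0 ≤ η0) (hηq : η0 ≤ lh * q1) :
    Real.log (2 * Real.pi * sig ^ 2) + ((n:ℝ) + 1 + lh * Sn n sig / 2) +
      2 / n * FF (gaussPrior n (sig ^ 2)) (gaussPrior n (sig ^ 2)) vs vs (cs n (lh / n) β) +
      η0 ^ 2 / (2 * lh) - lh / 2 * Vn n sig (lh / n) β q1 - √β * (1 + β * sig ^ 2 + sig ^ 2) ≤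
    XX n sig (1 / sig ^ 2 + η0) lh + XX n sig (1 / sig ^ 2 - η0) lh := by
  have hn' : (0:ℝ) < n := by exact_mod_cast hn
  have hα : 0 < lh / n := by positivity
  have hL := vs_L2 n (sig ^ 2)
  set M := (gaussPrior n (sig ^ 2)).prod (GG (KK n)) with hM
  set Y : (Fin n → ℝ) × (KK n → ℝ) → KK n → ℝ := fun q => Yv (cs n (lh / n) β) (vs q.1) q.2 with hY
  have hcongr : ∀ γ (q : (Fin n → ℝ) × (KK n → ℝ)), ZL γ (lh / n) (Yv (cs n (lh / n) 0) (vs q.1) q.2) = ZL γ (lh / n) (Y q) := by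
    intro γ q
    exact ZL_congr fun p => rfl
  have iZ : ∀ γ, Integrable (fun q => Real.log (ZL γ (lh / n) (Y q))) M := by
    intro γ
    have := logZL_int (vs_L2 n (sig ^ 2)) (cs n (lh / n) 0) (cs_nonneg _ _ _) hα γ (fun p => rfl) (fun i => by simp [cs])
    simpa only [hcongr] using this
  have vZ : ∀ γ, XX n sig γ lh = 1 / n * ∫ q, Real.log (ZL γ (lh / n) (Y q)) ∂M := by
    intro γ
    unfold XX
    simp only [hcongr]
    rfl
  have iy : Integrable (fun q => ysq (Y q)) M := ysq_int hL _
  have vy : ∫ q, ysq (Y q) ∂M = (n:ℝ) ^ 2 + n + n * lh * Sn n sig / 2 + n * β * sig ^ 2 := ysq_val hn sig hl.le hβ.le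
  have iz : Integrable (fun q => Real.log (Zp (gaussPrior n (sig ^ 2)) vs (cs n (lh / n) β) (Y q))) M :=
    logZp_int hL hL (cs_nonneg _ _ _)
  have vz : ∫ q, Real.log (Zp (gaussPrior n (sig ^ 2)) vs (cs n (lh / n) β) (Y q)) ∂M =
    FF (gaussPrior n (sig ^ 2)) (gaussPrior n (sig ^ 2)) vs vs (cs n (lh / n) β) := rfl
  have iV := (Vn_eq (n := n) (sig := sig) q1 hα hβ).1
  have inq := nish1 (μ := gaussPrior n (sig ^ 2)) (w := vs) vs_meas (cs n (lh / n) β) nq_meas (integral_nq n sig).1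
  have iyr := integral_nq_yr n sig hβ.le (lh / n)
  rw [(integral_nq n sig).2] at inq
  -- pointwise
  have hpt : ∀ q, 1 * ysq (Y q) + 2 * Real.log (Zp (gaussPrior n (sig ^ 2)) vs (cs n (lh / n) β) (Y q)) +
      -(n * (lh / 2)) * (∫ z, (dt z.1 z.2 / n - q1) ^ 2 ∂((PP n sig (lh / n) β q).prod (PP n sig (lh / n) β q))) +
        ((n:ℝ) * Real.log (2 * Real.pi * sig ^ 2) + n * (η0 ^ 2 / (2 * lh))) ≤
      √β * nq (yr (Y q)) + √β * (∫ x, nq x ∂(post (gaussPrior n (sig ^ 2)) vs (cs n (lh / n) β) (Y q))) +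
      1 * (1 * Real.log (ZL (1 / sig ^ 2 + η0) (lh / n) (Y q)) + 1 * Real.log (ZL (1 / sig ^ 2 - η0) (lh / n) (Y q)) + 0) + 0 := by
    intro q
    have hb := pair_lb hn hs hl hβ.le hq hη hηq (Y q)
    have hsd : ∫ x, (√β * dt (yr (Y q)) x - β * nq x / 2) ∂(post (gaussPrior n (sig ^ 2)) vs (cs n (lh / n) β) (Y q)) ≤
        √β / 2 * nq (yr (Y q)) + √β / 2 * (∫ x, nq x ∂(post (gaussPrior n (sig ^ 2)) vs (cs n (lh / n) β) (Y q))) := by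
      haveI : IsProbabilityMeasure (post (gaussPrior n (sig ^ 2)) vs (cs n (lh / n) β) (Y q)) := post_prob vs_meas _ _
      have in1 : Integrable nq (post (gaussPrior n (sig ^ 2)) vs (cs n (lh / n) β) (Y q)) := post_int vs_meas _ _ (integral_nq n sig).1
      have i0 : Integrable (fun x : Fin n → ℝ => dt (yr (Y q)) x) (post (gaussPrior n (sig ^ 2)) vs (cs n (lh / n) β) (Y q)) := by
        refine post_int vs_meas _ _ ?_
        unfold dt
        exact integrable_finsetSum _ fun i _ => ((prior_memLp (sig ^ 2) i 2 (by norm_num)).integrable (by norm_num)).const_mul _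
      have l2 := lin2 in1 in1 (√β / 2) 0 (√β / 2 * nq (yr (Y q)))
      have hle := integral_mono ((i0.const_mul (√β)).sub ((in1.const_mul β).div_const 2)) l2.1 (fun x => by
        dsimp only [Pi.sub_apply]
        have h1 := mul_le_mul_of_nonneg_left (dt_le (yr (Y q)) x) (Real.sqrt_nonneg β)
        have h2 := mul_nonneg hβ.le (nq_nonneg x)
        nlinarith)
      rw [l2.2] at hle
      refine le_trans (le_of_eq rfl) (hle.trans (le_of_eq ?_))
      ring
    have : PP n sig (lh / n) β q = post (gaussPrior n (sig ^ 2)) vs (cs n (lh / n) β) (Y q) := rfl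
    rw [this]
    nlinarith
  have A := lin3 iy iz iV 1 2 (-(n * (lh / 2))) ((n:ℝ) * Real.log (2 * Real.pi * sig ^ 2) + n * (η0 ^ 2 / (2 * lh)))
  have B0 := lin2 (iZ (1 / sig ^ 2 + η0)) (iZ (1 / sig ^ 2 - η0)) 1 1 0
  have B := lin3 iyr.1 inq.1 B0.1 (√β) (√β) 1 0
  have hfin := integral_mono A.1 B.1 hpt
  rw [A.2, B.2, B0.2, vy, vz, inq.2, iyr.2] at hfin
  rw [vZ, vZ]
  change _ + -(n * (lh / 2)) * Vn n sig (lh / n) β q1 + _ ≤ _ at hfin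
  have hx : ∀ a b : ℝ, 1 / (n:ℝ) * a + 1 / n * b = (a + b) / n := by intro a b; ring
  rw [hx, le_div_iff₀ hn']
  have e5 : (Real.log (2 * Real.pi * sig ^ 2) + ((n:ℝ) + 1 + lh * Sn n sig / 2) +
      2 / n * FF (gaussPrior n (sig ^ 2)) (gaussPrior n (sig ^ 2)) vs vs (cs n (lh / n) β) +
      η0 ^ 2 / (2 * lh) - lh / 2 * Vn n sig (lh / n) β q1 - √β * (1 + β * sig ^ 2 + sig ^ 2)) * n =
      n * Real.log (2 * Real.pi * sig ^ 2) + ((n:ℝ) ^ 2 + n + n * lh * Sn n sig / 2) + 2 * FF (gaussPrior n (sig ^ 2)) (gaussPrior n (sig ^ 2)) vs vs (cs n (lh / n) β) +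
      n * (η0 ^ 2 / (2 * lh)) - n * (lh / 2) * Vn n sig (lh / n) β q1 - √β * (n * (1 + β * sig ^ 2) + n * sig ^ 2) := by
    field_simp
  rw [e5]
  have : 0 ≤ n * β * sig ^ 2 := by positivity
  linarith
end

set_option linter.all false
set_option linter.deprecated false
noncomputable section

theorem Uf_low {γ lam T : ℝ} (h : γ ≤ lam * T) : Uf γ lam 0 T = (lam * T - γ) ^ 2 / (4 * lam) +
    (1 / 2) * Real.log (2 * Real.pi / (lam * T)) + (lam * T - γ) / (2 * (lam * T)) := by
  unfold Uf
  rw [add_zero, add_zero, max_eq_right h]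

set_option maxHeartbeats 1000000 in
theorem XX_lb_low {sig sig' lam : ℝ} (hs' : 0 < sig') (hle : sig' ≤ sig) (hl : 0 < lam)
    (hc : 1 / sig' ^ 2 ≤ lam * sig ^ 2) {ε : ℝ} (hε : 0 < ε) :
    ∀ᶠ n : ℕ in atTop, Uf (1 / sig' ^ 2) lam 0 (sig ^ 2) - ε ≤ XX n sig (1 / sig' ^ 2) lam := by
  have hs : 0 < sig := hs'.trans_le hle
  set η0 := 1 / sig' ^ 2 - 1 / sig ^ 2 with hη0
  have hη : 0 ≤ η0 := by
    rw [hη0, sub_nonneg]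
    exact one_div_le_one_div_of_le (by positivity) (by gcongr)
  have hγ' : 1 / sig' ^ 2 = 1 / sig ^ 2 + η0 := by rw [hη0]; ring
  rw [hγ'] at hc ⊢
  clear_value η0
  have hB : 1 / sig ^ 2 ≤ lam * sig ^ 2 := by linarith
  obtain ⟨δ, hδ, hub⟩ := XX_ub (sig := sig) (lam := lam) hs hl (1 / sig ^ 2 - η0) (η := ε / 4) (by positivity)
  -- limiting function
  set R : ℝ → ℝ := fun l => Real.log (2 * Real.pi * sig ^ 2) - Real.log (l * sig ^ 4) +
    lam * ((sig ^ 2 - 1 / (l * sig ^ 2)) * sig ^ 2 - (sig ^ 2 - 1 / (l * sig ^ 2)) ^ 2 / 2) + η0 ^ 2 / (2 * l) -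
    √((l - lam) * (sig ^ 2 - 1 / (l * sig ^ 2))) * (1 + (l - lam) * (sig ^ 2 - 1 / (l * sig ^ 2)) * sig ^ 2 + sig ^ 2) -
    (l - lam) * (sig ^ 4 + 1) / 4 with hR
  have hRc : ContinuousAt R lam := by
    have h1 : lam * sig ^ 4 ≠ 0 := by positivity
    have h2 : lam * sig ^ 2 ≠ 0 := by positivity
    have h3 : 2 * lam ≠ 0 := by positivity
    have c1 : ContinuousAt (fun l : ℝ => Real.log (l * sig ^ 4)) lam :=
      ContinuousAt.log (by fun_prop) h1
    have c2 : ContinuousAt (fun l : ℝ => 1 / (l * sig ^ 2)) lam :=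
      ContinuousAt.div (by fun_prop) (by fun_prop) h2
    have c3 : ContinuousAt (fun l : ℝ => η0 ^ 2 / (2 * l)) lam :=
      ContinuousAt.div (by fun_prop) (by fun_prop) h3
    simp only [hR]
    fun_prop
  have hRl : R lam = Uf (1 / sig ^ 2 + η0) lam 0 (sig ^ 2) + Uf (1 / sig ^ 2 - η0) lam 0 (sig ^ 2) := by
    rw [Uf_low hc, Uf_low (by linarith)]
    simp only [hR, sub_self, zero_mul, Real.sqrt_zero]
    have : Real.log (2 * Real.pi * sig ^ 2) - Real.log (lam * sig ^ 4) = Real.log (2 * Real.pi / (lam * sig ^ 2)) := by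
      rw [← Real.log_div (by positivity) (by positivity)]
      congr 1
      field_simp
    rw [this]
    generalize Real.log (2 * Real.pi / (lam * sig ^ 2)) = L
    field_simp
    ring
  have hev : ∀ᶠ l in nhdsWithin lam (Set.Ioi lam), R lam - ε / 4 < R l ∧ l ≤ lam + δ ∧ lam < l := by
    have e1 : ∀ᶠ l in nhds lam, R lam - ε / 4 < R l := hRc.eventually (lt_mem_nhds (by linarith))
    have e2 : ∀ᶠ l in nhds lam, l ≤ lam + δ := ge_mem_nhds (by linarith)
    filter_upwards [nhdsWithin_le_nhds e1, nhdsWithin_le_nhds e2, self_mem_nhdsWithin] with l h1 h2 h3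
    exact ⟨h1, h2, h3⟩
  obtain ⟨lam1, hR1, hld, hl1⟩ := hev.exists
  have hl10 : 0 < lam1 := hl.trans hl1
  have h14 : 1 < lam1 * sig ^ 4 := by
    rw [div_le_iff₀ (by positivity)] at hB
    have : lam * sig ^ 4 < lam1 * sig ^ 4 := by gcongr
    have e : lam * sig ^ 2 * sig ^ 2 = lam * sig ^ 4 := by ring
    linarith
  have hov := Bayes_overlap hs hl hl1 h14 (η := ε / 4 / lam1) (by positivity)
  have hSn : ∀ᶠ n : ℕ in atTop, Sn n sig < sig ^ 4 + 1 := (Sn_tendsto sig).eventually (gt_mem_nhds (by linarith))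
  filter_upwards [hub, hov, hSn, eventually_gt_atTop 0] with n hubn hovn hSnn hn
  obtain ⟨t, ht0, ht1, hV, hF⟩ := hovn
  have hn' : (0:ℝ) < n := by exact_mod_cast hn
  rw [hRl] at hR1
  simp only [hR] at hR1
  set q1 := sig ^ 2 - 1 / (lam1 * sig ^ 2) with hq1
  have hq : 0 < q1 := by
    rw [hq1, sub_pos, div_lt_iff₀ (by positivity)]
    have e : sig ^ 2 * (lam1 * sig ^ 2) = lam1 * sig ^ 4 := by ring
    linarith
  have hqs : q1 ≤ sig ^ 2 := by
    have : 0 < 1 / (lam1 * sig ^ 2) := by positivity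
    linarith
  have htpos : 0 < t := lt_trans (by positivity) ht0
  set lh := lam1 * t with hlh
  have hlh1 : lam < lh := by
    rw [div_lt_iff₀ hl10] at ht0; linarith
  have hlt : lh < lam1 := mul_lt_of_lt_one_right hl10 ht1
  have hlh2 : lh ≤ lam1 := hlt.le
  have hlh0 : 0 < lh := hl.trans hlh1
  have eα : 0 + lam1 / n * t = lh / n := by rw [hlh]; ring
  have eβ : lam1 * q1 + -(lam1 * q1) * t = (lam1 - lh) * q1 := by rw [hlh]; ring
  unfold FB at hF
  rw [eα, eβ] at hF hV
  set β := (lam1 - lh) * q1 with hβd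
  have hβ : 0 < β := mul_pos (by linarith) hq
  have hβm : β ≤ (lam1 - lam) * q1 := by rw [hβd]; gcongr
  have hηq : η0 ≤ lh * q1 := by
    have e1 : lam * q1 = lam * sig ^ 2 - lam / lam1 * (1 / sig ^ 2) := by
      rw [hq1]; field_simp
    have e2 : lam / lam1 * (1 / sig ^ 2) ≤ 1 * (1 / sig ^ 2) := by
      gcongr
      rw [div_le_one hl10]; exact hl1.le
    have e3 : lam * q1 ≤ lh * q1 := by gcongr
    linarith
  have hP := XX_pair_lb hn hs hlh0 hβ hq hη hηq
  have hu := hubn lh hlh1.le (by linarith)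
  -- monotonicity in lam
  have hmono : XX n sig (1 / sig ^ 2 + η0) lh - (lh - lam) * Sn n sig / 4 ≤ XX n sig (1 / sig ^ 2 + η0) lam := by
    have h1 := Phi_anti hn sig sig' hl hlh1.le
    rw [Phi_XX hn sig hs' hl, Phi_XX hn sig hs' hlh0, hγ'] at h1
    linarith
  have hSn0 : 0 ≤ Sn n sig := integral_nonneg fun s => sq_nonneg _
  have a1 : (lh - lam) * Sn n sig ≤ (lam1 - lam) * (sig ^ 4 + 1) :=
    mul_le_mul (by linarith) hSnn.le hSn0 (by linarith)
  have a2 : √β * (1 + β * sig ^ 2 + sig ^ 2) ≤ √((lam1 - lam) * q1) * (1 + (lam1 - lam) * q1 * sig ^ 2 + sig ^ 2) := by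
    gcongr
  have a3 : lh / 2 * Vn n sig (lh / n) β q1 ≤ ε / 4 := by
    have v0 := Vn_nonneg n sig (lh / n) β q1
    calc lh / 2 * Vn n sig (lh / n) β q1 ≤ lam1 * (ε / 4 / lam1) :=
          mul_le_mul (by linarith) hV v0 hl10.le
      _ = ε / 4 := by field_simp
  have a4 : η0 ^ 2 / (2 * lam1) ≤ η0 ^ 2 / (2 * lh) := by gcongr
  have a5 : lam * (q1 * sig ^ 2 - q1 ^ 2 / 2) ≤ lh * (q1 * sig ^ 2 - q1 ^ 2 / 2) := by
    have h5 := mul_le_mul_of_nonneg_left hqs hq.le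
    have : 0 ≤ q1 * sig ^ 2 - q1 ^ 2 / 2 := by rw [sq q1]; linarith [mul_pos hq hq]
    gcongr
  have a6 : -(n:ℝ) - 1 - Real.log (lam1 * sig ^ 4) + lh / 2 * Kn n sig q1 ≤
      2 / n * FF (gaussPrior n (sig ^ 2)) (gaussPrior n (sig ^ 2)) vs vs (cs n (lh / n) β) := by
    have := mul_le_mul_of_nonneg_left hF (show (0:ℝ) ≤ 2 / n by positivity)
    refine le_trans (le_of_eq ?_) this
    rw [hlh]
    field_simp
    ring
  unfold Kn at a6
  linarith
end

set_option linter.all false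
set_option linter.deprecated false
noncomputable section

theorem Uf_high {sig sig' lam : ℝ} (hs' : 0 < sig') (h : lam * sig ^ 2 ≤ 1 / sig' ^ 2) :
    Uf (1 / sig' ^ 2) lam 0 (sig ^ 2) = (1 / 2) * Real.log (2 * Real.pi * sig' ^ 2) := by
  unfold Uf
  rw [add_zero, add_zero, max_eq_left h, sub_self]
  have : 2 * Real.pi / (1 / sig' ^ 2) = 2 * Real.pi * sig' ^ 2 := by field_simp
  rw [this]
  simp

theorem XX_tendsto {sig sig' lam : ℝ} (hs' : 0 < sig') (hle : sig' ≤ sig) (hl : 0 < lam) :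
    Tendsto (fun n : ℕ => XX n sig (1 / sig' ^ 2) lam) atTop (nhds (Uf (1 / sig' ^ 2) lam 0 (sig ^ 2))) := by
  have hs : 0 < sig := hs'.trans_le hle
  rw [tendsto_order]
  constructor
  · intro a ha
    rcases le_total (lam * sig ^ 2) (1 / sig' ^ 2) with h | h
    · rw [Uf_high hs' h] at ha
      filter_upwards [eventually_gt_atTop 0] with n hn
      exact ha.trans_le (XX_lb_high hn hs' hle hl)
    · filter_upwards [XX_lb_low hs' hle hl h (ε := (Uf (1 / sig' ^ 2) lam 0 (sig ^ 2) - a) / 2) (by linarith)] with n hn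
      linarith
  · intro a ha
    obtain ⟨δ, hδ, h⟩ := XX_ub (sig := sig) (lam := lam) hs hl (1 / sig' ^ 2) (η := (a - Uf (1 / sig' ^ 2) lam 0 (sig ^ 2)) / 2) (by linarith)
    filter_upwards [h] with n hn
    have := hn lam le_rfl (by linarith)
    linarith

/-- limiting free energy -/
def Gf (sig sig' lam : ℝ) : ℝ := Uf (1 / sig' ^ 2) lam 0 (sig ^ 2) - (1 / 2) * Real.log (2 * Real.pi * sig' ^ 2) - lam * sig ^ 4 / 4

theorem Phi_tendsto {sig sig' lam : ℝ} (hs' : 0 < sig') (hle : sig' ≤ sig) (hl : 0 < lam) :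
    Tendsto (fun n : ℕ => Phi n sig sig' lam + ((n:ℝ) + 1) / 2) atTop (nhds (Gf sig sig' lam)) := by
  have h := ((XX_tendsto hs' hle hl).sub_const ((1 / 2) * Real.log (2 * Real.pi * sig' ^ 2))).sub
    (((Sn_tendsto sig).const_mul lam).div_const 4)
  refine h.congr' ?_
  filter_upwards [eventually_gt_atTop 0] with n hn
  rw [Phi_XX hn sig hs' hl]
  ring

theorem Gf_deriv {sig sig' : ℝ} (hs' : 0 < sig') (hle : sig' ≤ sig) {F : ℝ → ℝ}
    (hunif : ∀ K : Set ℝ, IsCompact K → K ⊆ Set.Ioi 0 →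
      TendstoUniformlyOn (fun n lam => MSE n sig sig' lam lam) F atTop K) {lam : ℝ} (hl : 0 < lam) :
    HasDerivAt (Gf sig sig') (-(1 / 4) * F lam) lam := by
  have hK := hunif (Set.Icc (lam / 2) (lam + 1)) isCompact_Icc (fun x hx => lt_of_lt_of_le (by positivity) hx.1)
  have hu : TendstoUniformlyOn (fun (n : ℕ) l => -(1 / 4) * MSE n sig sig' l l) (fun l => -(1 / 4) * F l) atTop
      (Set.Ioo (lam / 2) (lam + 1)) := by
    have := (uniformContinuous_const_smul (-(1 / 4) : ℝ) (M := ℝ) (X := ℝ)).comp_tendstoUniformlyOn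
      (hK.mono Set.Ioo_subset_Icc_self)
    exact this
  refine hasDerivAt_of_tendstoUniformlyOn (f := fun (n : ℕ) l => Phi n sig sig' l + ((n:ℝ) + 1) / 2)
    isOpen_Ioo hu ?_ (fun x hx => ?_) ⟨by linarith, by linarith⟩
  · filter_upwards [eventually_gt_atTop 0] with n hn x hx
    exact (Phi_deriv hn sig sig' x (lt_trans (by positivity) hx.1)).add_const _
  · exact Phi_tendsto hs' hle (lt_trans (by positivity) hx.1)

theorem F_high {sig sig' : ℝ} (hs' : 0 < sig') (hle : sig' ≤ sig) {F : ℝ → ℝ} {lam : ℝ} (hl : 0 < lam)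
    (hd : HasDerivAt (Gf sig sig') (-(1 / 4) * F lam) lam) (h : lam * sig ^ 2 ≤ 1 / sig' ^ 2) : F lam = sig ^ 4 := by
  have hlt : lam / 2 < lam := by linarith
  have hU := uniqueDiffOn_Icc hlt lam ⟨hlt.le, le_rfl⟩
  have h1 : HasDerivWithinAt (fun x : ℝ => -(x * sig ^ 4 / 4)) (-(1 * sig ^ 4 / 4)) (Set.Icc (lam / 2) lam) lam :=
    (((hasDerivAt_id lam).mul_const (sig ^ 4)).div_const 4).neg.hasDerivWithinAt
  have h2 : HasDerivWithinAt (Gf sig sig') (-(1 * sig ^ 4 / 4)) (Set.Icc (lam / 2) lam) lam := by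
    have e : ∀ x ∈ Set.Icc (lam / 2) lam, Gf sig sig' x = -(x * sig ^ 4 / 4) := by
      intro x hx
      unfold Gf
      rw [Uf_high hs' (le_trans (by gcongr; exact hx.2) h)]
      ring
    exact h1.congr e (e lam ⟨hlt.le, le_rfl⟩)
  have := hU.eq_deriv _ hd.hasDerivWithinAt h2
  linarith

theorem F_low {sig sig' : ℝ} (hs' : 0 < sig') (hle : sig' ≤ sig) {F : ℝ → ℝ} {lam : ℝ} (hl : 0 < lam)
    (hd : HasDerivAt (Gf sig sig') (-(1 / 4) * F lam) lam) (h : 1 / sig' ^ 2 ≤ lam * sig ^ 2) :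
    F lam = 2 / lam - (1 / (lam ^ 2 * sig' ^ 2)) * (2 / sig ^ 2 - 1 / sig' ^ 2) := by
  have hs : 0 < sig := hs'.trans_le hle
  have hlt : lam < lam + 1 := by linarith
  have hU := uniqueDiffOn_Icc hlt lam ⟨le_rfl, hlt.le⟩
  set A := (1 / sig' ^ 2) ^ 2 / 4 - (1 / sig' ^ 2) / (2 * sig ^ 2) with hA
  set C := -(sig ^ 2 * (1 / sig' ^ 2) / 2) + (1 / 2) * Real.log (2 * Real.pi / sig ^ 2) + 1 / 2 - (1 / 2) * Real.log (2 * Real.pi * sig' ^ 2) with hC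
  have h1 : HasDerivWithinAt (fun x : ℝ => A * x⁻¹ - (1 / 2) * Real.log x + C) (A * (-(lam ^ 2)⁻¹) - (1 / 2) * lam⁻¹) (Set.Icc lam (lam + 1)) lam :=
    ((((hasDerivAt_inv hl.ne').const_mul A).sub ((Real.hasDerivAt_log hl.ne').const_mul (1 / 2))).add_const C).hasDerivWithinAt
  have h2 : HasDerivWithinAt (Gf sig sig') (A * (-(lam ^ 2)⁻¹) - (1 / 2) * lam⁻¹) (Set.Icc lam (lam + 1)) lam := by
    have e : ∀ x ∈ Set.Icc lam (lam + 1), Gf sig sig' x = A * x⁻¹ - (1 / 2) * Real.log x + C := by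
      intro x hx
      have hx0 : 0 < x := hl.trans_le hx.1
      unfold Gf
      rw [Uf_low (h.trans (by gcongr; exact hx.1))]
      have e1 : 2 * Real.pi / (x * sig ^ 2) = (2 * Real.pi / sig ^ 2) / x := by field_simp
      rw [e1, Real.log_div (by positivity) hx0.ne', hA, hC]
      generalize Real.log (2 * Real.pi / sig ^ 2) = L1
      generalize Real.log (2 * Real.pi * sig' ^ 2) = L2
      generalize Real.log x = L3
      field_simp
      ring
    exact h1.congr e (e lam ⟨le_rfl, hlt.le⟩)
  have := hU.eq_deriv _ hd.hasDerivWithinAt h2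
  have e : F lam = -4 * (A * (-(lam ^ 2)⁻¹) - (1 / 2) * lam⁻¹) := by linarith
  rw [e, hA]
  field_simp
  ring

theorem main_thm (sig sig' : ℝ) (hsig' : 0 < sig') (hle : sig' ≤ sig) (F : ℝ → ℝ)
    (hunif : ∀ K : Set ℝ, IsCompact K → K ⊆ Set.Ioi 0 →
      TendstoUniformlyOn (fun n lam => MSE n sig sig' lam lam) F atTop K) :
    ∀ lam : ℝ, 0 < lam →
      (lam ≤ 1 / (sig ^ 2 * sig' ^ 2) →
        Tendsto (fun n => MSE n sig sig' lam lam) atTop (nhds (sig ^ 4))) ∧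
      (1 / (sig ^ 2 * sig' ^ 2) ≤ lam →
        Tendsto (fun n => MSE n sig sig' lam lam) atTop
          (nhds (2 / lam - (1 / (lam ^ 2 * sig' ^ 2)) * (2 / sig ^ 2 - 1 / sig' ^ 2)))) := by
  intro lam hl
  have hs : 0 < sig := hsig'.trans_le hle
  have hd := Gf_deriv hsig' hle hunif hl
  have ht : Tendsto (fun n => MSE n sig sig' lam lam) atTop (nhds (F lam)) :=
    (hunif {lam} isCompact_singleton (by simpa using hl)).tendsto_at rfl
  have e1 : 1 / (sig ^ 2 * sig' ^ 2) * sig ^ 2 = 1 / sig' ^ 2 := by field_simp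
  constructor
  · intro h
    rw [← F_high hsig' hle hl hd (by rw [← e1]; gcongr)]
    exact ht
  · intro h
    rw [← F_low hsig' hle hl hd (by rw [← e1]; gcongr)]
    exact ht
end

/-- Matched-SNR (`λ' = λ`) limiting MSE for `σ' ≤ σ`, assuming
uniform convergence of `MSE_n(σ,σ',λ,λ)` in `λ` on compact subsets of `ℝ₊`. -/
theorem matched_snr_mse_limit_underestimate (sig sig' : ℝ)
    (hsig' : 0 < sig') (hle : sig' ≤ sig) (F : ℝ → ℝ)
    (hunif : ∀ K : Set ℝ, IsCompact K → K ⊆ Set.Ioi 0 →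
      TendstoUniformlyOn (fun n lam => MSE n sig sig' lam lam) F atTop K) :
    ∀ lam : ℝ, 0 < lam →
      (lam ≤ 1 / (sig ^ 2 * sig' ^ 2) →
        Tendsto (fun n => MSE n sig sig' lam lam) atTop (nhds (sig ^ 4))) ∧
      (1 / (sig ^ 2 * sig' ^ 2) ≤ lam →
        Tendsto (fun n => MSE n sig sig' lam lam) atTop
          (nhds (2 / lam - (1 / (lam ^ 2 * sig' ^ 2)) * (2 / sig ^ 2 - 1 / sig' ^ 2)))) := by
  exact main_thm sig sig' hsig' hle F hunif

end
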